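/- Let D be a pseudoconvex domain in ℂ^N. Let 𝒱 be the set of all f ∈ 𝒪(D) with the following property: for every finite length path γ to bD and every complex number c ∈ ℂ, there exists a sequence (r_n) ⊂ [0,1) with r_n → 1 such that f(γ(r_n)) → c as n → ∞. Then 𝒱 is residual in 𝒪(D). -/

import Mathlib

open Set Filter Topology Metric MeasureTheory
open scoped ENNReal NNReal InnerProductSpace ComplexConjugate

noncomputable section

/-- `ℂ^N` with the Euclidean structure. -/
abbrev EN (N : ℕ) := EuclideanSpace ℂ (Fin N)

instance {N : ℕ} : MeasurableSpace (EN N) := borel _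
instance {N : ℕ} : BorelSpace (EN N) := ⟨rfl⟩

/-- A domain: a nonempty open connected subset. -/
def IsDomainSet {N : ℕ} (D : Set (EN N)) : Prop := IsOpen D ∧ IsConnected D

/-- `u` is plurisubharmonic on `D`: upper semicontinuous on `D`, and its restriction to
every complex affine line satisfies the sub-mean value inequality on every closed disc
(of that line) contained in `D`. -/
def PlurisubharmonicOn {N : ℕ} (u : EN N → ℝ) (D : Set (EN N)) : Prop :=
  UpperSemicontinuousOn u D ∧
  ∀ (a b : EN N) (t₀ : ℂ) (r : ℝ), 0 < r →
    (fun t : ℂ => a + t • b) '' Metric.closedBall t₀ r ⊆ D →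
    u (a + t₀ • b) ≤ (2 * Real.pi)⁻¹ *
      ∫ θ in (0:ℝ)..(2 * Real.pi), u (a + (t₀ + r * Complex.exp (θ * Complex.I)) • b)

/-- `D` is a pseudoconvex domain: a domain carrying a continuous plurisubharmonic
exhaustion function. -/
def Pseudoconvex {N : ℕ} (D : Set (EN N)) : Prop :=
  IsDomainSet D ∧ ∃ u : EN N → ℝ, ContinuousOn u D ∧ PlurisubharmonicOn u D ∧
    ∀ c : ℝ, IsCompact (closure {z ∈ D | u z < c}) ∧ closure {z ∈ D | u z < c} ⊆ D

/-- The space `𝒪(D)` of holomorphic functions on `D`, as a submodule of `ℂ^N → ℂ`. -/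
def Hol {N : ℕ} (D : Set (EN N)) : Submodule ℂ (EN N → ℂ) where
  carrier := {f | DifferentiableOn ℂ f D}
  add_mem' hf hg := hf.add hg
  zero_mem' := differentiableOn_const 0
  smul_mem' c f hf := hf.const_smul c

/-- The topology of uniform convergence on compact subsets of `D`, on `𝒪(D)`. -/
instance holTopology {N : ℕ} (D : Set (EN N)) : TopologicalSpace ↥(Hol D) :=
  TopologicalSpace.induced
    (fun f => UniformOnFun.ofFun {K : Set (EN N) | K ⊆ D ∧ IsCompact K} f.1)
    inferInstance

/-- A set is residual if it contains a dense `G_δ` set. -/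
def ResidualIn {X : Type*} [TopologicalSpace X] (S : Set X) : Prop :=
  ∃ T : Set X, T ⊆ S ∧ IsGδ T ∧ Dense T

/-- `S` is densely lineable: `S ∪ {0}` contains a dense vector subspace. -/
def DenselyLineableIn {X : Type*} [TopologicalSpace X] [AddCommMonoid X] [Module ℂ X]
    (S : Set X) : Prop :=
  ∃ p : Submodule ℂ X, Dense (p : Set X) ∧ (p : Set X) ⊆ S ∪ {0}

/-- `S` is spaceable: `S ∪ {0}` contains a closed infinite-dimensional vector subspace. -/
def SpaceableIn {X : Type*} [TopologicalSpace X] [AddCommMonoid X] [Module ℂ X]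
    (S : Set X) : Prop :=
  ∃ p : Submodule ℂ X, IsClosed (p : Set X) ∧ ¬ Module.Finite ℂ ↥p ∧ (p : Set X) ⊆ S ∪ {0}

/-- A finite length path to `bD`: continuous and piecewise `C¹` on `[0,1)`, with values in `D`,
finite length (total variation), converging to a boundary point of `D` as `r → 1`. -/
def FiniteLengthPathTo {N : ℕ} (D : Set (EN N)) (γ : ℝ → EN N) : Prop :=
  MapsTo γ (Ico (0:ℝ) 1) D ∧ ContinuousOn γ (Ico (0:ℝ) 1) ∧
  (∃ u : ℕ → ℝ, u 0 = 0 ∧ StrictMono u ∧ (∀ n, u n < 1) ∧ Tendsto u atTop (𝓝 1) ∧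
    ∀ n, ContDiffOn ℝ 1 γ (Icc (u n) (u (n+1)))) ∧
  eVariationOn γ (Ico (0:ℝ) 1) < ⊤ ∧
  ∃ ζ ∈ frontier D, Tendsto γ (𝓝[<] (1:ℝ)) (𝓝 ζ)

/-- The set of `f ∈ 𝒪(D)` with maximal cluster set along every finite length path to `bD`. -/
def WildSet {N : ℕ} (D : Set (EN N)) : Set ↥(Hol D) :=
  {f | ∀ γ : ℝ → EN N, FiniteLengthPathTo D γ → ∀ c : ℂ,
    ∃ r : ℕ → ℝ, (∀ n, r n ∈ Ico (0:ℝ) 1) ∧ Tendsto r atTop (𝓝 1) ∧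
      Tendsto (fun n => f.1 (γ (r n))) atTop (𝓝 c)}

/-- The `𝒪(D)`-hull of `K`. -/
def holHull {N : ℕ} (D K : Set (EN N)) : Set (EN N) :=
  {z ∈ D | ∀ φ : EN N → ℂ, DifferentiableOn ℂ φ D → ‖φ z‖ ≤ ⨆ w ∈ K, ‖φ w‖}

/-- `K` is `𝒪(D)`-convex. -/
def HolConvexIn {N : ℕ} (D K : Set (EN N)) : Prop := K ⊆ D ∧ holHull D K = K

/-- The polynomial hull of a compact subset of `ℂ`. -/
def polyHull1 (E : Set ℂ) : Set ℂ :=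
  {z | ∀ p : Polynomial ℂ, ‖p.eval z‖ ≤ ⨆ w ∈ E, ‖p.eval w‖}

/-- The polynomial hull of a subset of `ℂ^N`. -/
def polyHull {N : ℕ} (E : Set (EN N)) : Set (EN N) :=
  {z | ∀ p : MvPolynomial (Fin N) ℂ,
    ‖MvPolynomial.eval (fun j => z j) p‖ ≤ ⨆ w ∈ E, ‖MvPolynomial.eval (fun j => w j) p‖}

/-- `E ⊆ ℂ^N` is polynomially convex. -/
def PolynomiallyConvex {N : ℕ} (E : Set (EN N)) : Prop := polyHull E = E

/-- The (real) Hessian of `ρ` at `p`, applied to the pair `(v, w)`. -/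
def Hess {N : ℕ} (ρ : EN N → ℝ) (p v w : EN N) : ℝ :=
  fderiv ℝ (fderiv ℝ ρ) p v w

/-- The Levi form `∑_{j,k} ∂²ρ/∂z_j∂z̄_k (p) w_j w̄_k`, expressed through the real Hessian. -/
def LeviForm {N : ℕ} (ρ : EN N → ℝ) (p w : EN N) : ℝ :=
  (Hess ρ p w w + Hess ρ p (Complex.I • w) (Complex.I • w)) / 4

/-- `w` belongs to the complex tangent space `{w : ∑_j ∂ρ/∂z_j(p) w_j = 0}` at `p`. -/
def ComplexTangent {N : ℕ} (ρ : EN N → ℝ) (p w : EN N) : Prop :=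
  fderiv ℝ ρ p w = 0 ∧ fderiv ℝ ρ p (Complex.I • w) = 0

/-- `ρ` is a `C²` defining function for `D` on the open neighborhood `V` of `cl D`. -/
def IsDefiningFunctionOn {N : ℕ} (D : Set (EN N)) (ρ : EN N → ℝ) (V : Set (EN N)) : Prop :=
  IsOpen V ∧ closure D ⊆ V ∧ ContDiffOn ℝ 2 ρ V ∧
  D = {z ∈ V | ρ z < 0} ∧ ∀ p ∈ frontier D, fderiv ℝ ρ p ≠ 0

/-- `D` is a strictly pseudoconvex domain with defining function `ρ`. -/
def StrictPSCWith {N : ℕ} (D : Set (EN N)) (ρ : EN N → ℝ) : Prop :=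
  IsDomainSet D ∧ Bornology.IsBounded D ∧ (∃ V, IsDefiningFunctionOn D ρ V) ∧
  ∀ p ∈ frontier D, ∀ w : EN N, w ≠ 0 → ComplexTangent ρ p w → 0 < LeviForm ρ p w

/-- `D` is a strictly pseudoconvex domain. -/
def StrictlyPseudoconvex {N : ℕ} (D : Set (EN N)) : Prop := ∃ ρ, StrictPSCWith D ρ

/-- `ρ` and `σ` are at `C²`-distance `< ε` on `V`. -/
def C2DistLt {N : ℕ} (V : Set (EN N)) (ρ σ : EN N → ℝ) (ε : ℝ) : Prop :=
  ∀ z ∈ V, |ρ z - σ z| + ‖fderiv ℝ ρ z - fderiv ℝ σ z‖ +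
    ‖fderiv ℝ (fderiv ℝ ρ) z - fderiv ℝ (fderiv ℝ σ) z‖ < ε

/-- The standing assumptions on the map `γ : bD × [0,1] → cl D`: it is `C^k`, maps
`bD × [0,1)` into `D`, satisfies `γ(x,1) = x`, and the curves `r ↦ γ(x,r)` hit `bD`
transversally at `x` (the `r`-derivative at `1` is not annihilated by `dρ(x)`,
i.e. it is not tangent to `bD` at `x`). -/
def GammaMap {N : ℕ} (D : Set (EN N)) (ρ : EN N → ℝ) (γ : EN N × ℝ → EN N) (k : ℕ) : Prop :=
  ContDiffOn ℝ k γ ((frontier D) ×ˢ Icc (0:ℝ) 1) ∧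
  (∀ x ∈ frontier D, ∀ r ∈ Ico (0:ℝ) 1, γ (x, r) ∈ D) ∧
  (∀ x ∈ frontier D, γ (x, 1) = x) ∧
  ∀ x ∈ frontier D, fderiv ℝ ρ x (derivWithin (fun r => γ (x, r)) (Icc (0:ℝ) 1) 1) ≠ 0

/-- Assumption (†): for all `r` close enough to `1`, `bD_r := γ(bD × {r})` bounds a strictly
pseudoconvex domain `D_r ⊆ D` whose defining function converges to `ρ` in `C²` norm on a
neighborhood `V` of `cl D` as `r → 1`. -/
def Dagger {N : ℕ} (D : Set (EN N)) (ρ : EN N → ℝ) (γ : EN N × ℝ → EN N) : Prop :=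
  ∃ V : Set (EN N), IsOpen V ∧ closure D ⊆ V ∧
  ∃ (Dr : ℝ → Set (EN N)) (ρr : ℝ → EN N → ℝ),
    ∀ ε > 0, ∃ r₀ ∈ Ico (0:ℝ) 1, ∀ r ∈ Ioo r₀ 1,
      StrictPSCWith (Dr r) (ρr r) ∧ Dr r ⊆ D ∧
      frontier (Dr r) = (fun x => γ (x, r)) '' frontier D ∧
      C2DistLt V (ρr r) ρ ε

/-- The `(2N-1)`-dimensional Hausdorff (surface) measure on `bD`. -/
def surfMeasure {N : ℕ} (D : Set (EN N)) : Measure (EN N) :=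
  (Measure.hausdorffMeasure (2 * (N:ℝ) - 1)).restrict (frontier D)

/-- The normalized surface measure on `bD`. -/
def surfMeasureNorm {N : ℕ} (D : Set (EN N)) : Measure (EN N) :=
  ((Measure.hausdorffMeasure (2 * (N:ℝ) - 1) : Measure (EN N)) (frontier D))⁻¹ • surfMeasure D

/-- The set `𝒲((r_j))` of `f ∈ 𝒪(D)` such that every measurable function on `bD` is an
a.e. limit of `f ∘ γ(·, r_{j_k})` along some subsequence of `(r_j)`. -/
def WSet {N : ℕ} (D : Set (EN N)) (γ : EN N × ℝ → EN N) (r : ℕ → ℝ) : Set ↥(Hol D) :=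
  {f | ∀ h : EN N → ℂ, Measurable h → ∃ φ : ℕ → ℕ, StrictMono φ ∧
    ∀ᵐ x ∂ surfMeasure D, Tendsto (fun k => f.1 (γ (x, r (φ k)))) atTop (𝓝 (h x))}

/-- `Γ` is a closed cap of a convex set `V`: the closure of a connected component of
`V \ H` for some real affine hyperplane `H` (for convex `V`, a nonempty open half-space
slice of `V`). -/
def IsClosedCap {N : ℕ} (V : Set (EN N)) (Γ : Set (EN N)) : Prop :=
  ∃ (l : EN N →L[ℝ] ℝ) (c : ℝ), l ≠ 0 ∧ (V ∩ {z | c < l z}).Nonempty ∧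
    Γ = closure (V ∩ {z | c < l z})

/-- `V` is a strictly convex domain: a bounded convex domain with `C²` boundary whose
defining function has positive definite real Hessian on the real tangent space. -/
def StrictlyConvexDomain {N : ℕ} (V : Set (EN N)) : Prop :=
  IsDomainSet V ∧ Bornology.IsBounded V ∧ Convex ℝ V ∧
  ∃ (ρ : EN N → ℝ) (W : Set (EN N)), IsDefiningFunctionOn V ρ W ∧
    ∀ p ∈ frontier V, ∀ w : EN N, w ≠ 0 → fderiv ℝ ρ p w = 0 → 0 < Hess ρ p w w

/-- The defining function `‖z‖² - 1` of the unit ball. -/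
def ballRho {N : ℕ} : EN N → ℝ := fun z => ‖z‖ ^ 2 - 1

/-- The normalized surface measure on the unit sphere of `ℂ^N`. -/
def sphMeasure (N : ℕ) : Measure (EN N) :=
  ((Measure.hausdorffMeasure (2 * (N:ℝ) - 1) : Measure (EN N)) (Metric.sphere 0 1))⁻¹ •
    (Measure.hausdorffMeasure (2 * (N:ℝ) - 1)).restrict (Metric.sphere 0 1)

/-- `v` is a weight: increasing on `[0,∞)`, nonnegative, and tending to `∞`. -/
def IsWeight (v : ℝ → ℝ) : Prop :=
  (∀ x ∈ Ici (0:ℝ), 0 ≤ v x) ∧ MonotoneOn v (Ici 0) ∧ Tendsto v atTop atTop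

/-- The norm `‖f‖ = sup_{z ∈ 𝔹_N} |f z| / v(|z|)` of `H_v^0`. -/
def hvNorm {N : ℕ} (v : ℝ → ℝ) (f : EN N → ℂ) : ℝ :=
  ⨆ z ∈ Metric.ball (0:EN N) 1, ‖f z‖ / v ‖z‖

/-- Membership in `H_v^0`: `f` is holomorphic on `𝔹_N` and `sup_{|z|=r} |f z| / v(r) → 0`
as `r → 1⁻`. -/
def MemHv {N : ℕ} (v : ℝ → ℝ) (f : EN N → ℂ) : Prop :=
  DifferentiableOn ℂ f (Metric.ball 0 1) ∧
  Tendsto (fun r : ℝ => ⨆ z ∈ Metric.sphere (0:EN N) r, ‖f z‖ / v r) (𝓝[<] 1) (𝓝 0)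

/-- `S` contains, relatively to `H_v^0` with its norm topology, a dense `G_δ` subset:
there are countably many relatively norm-open sets `U n` whose intersection with `H_v^0`
is norm-dense in `H_v^0` and contained in `S`. -/
def ResidualInHv {N : ℕ} (v : ℝ → ℝ) (S : Set (EN N → ℂ)) : Prop :=
  ∃ U : ℕ → Set (EN N → ℂ),
    (∀ n, ∀ f, MemHv v f → f ∈ U n →
      ∃ δ > 0, ∀ g, MemHv v g → hvNorm v (g - f) < δ → g ∈ U n) ∧
    (∀ f, MemHv v f → ∀ δ > 0, ∃ g, MemHv v g ∧ (∀ n, g ∈ U n) ∧ hvNorm v (g - f) < δ) ∧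
    ∀ f, MemHv v f → (∀ n, f ∈ U n) → f ∈ S

/-- `S` is densely lineable in `H_v^0`: `S ∪ {0}` contains a norm-dense subspace of `H_v^0`. -/
def DenselyLineableInHv {N : ℕ} (v : ℝ → ℝ) (S : Set (EN N → ℂ)) : Prop :=
  ∃ p : Submodule ℂ (EN N → ℂ), (↑p ⊆ {f : EN N → ℂ | MemHv v f}) ∧ (↑p ⊆ S ∪ {0}) ∧
    ∀ f, MemHv v f → ∀ δ > 0, ∃ g ∈ p, hvNorm v (g - f) < δ

/-- `S` is spaceable in `H_v^0`: `S ∪ {0}` contains a norm-closed infinite-dimensional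
subspace of `H_v^0`. -/
def SpaceableInHv {N : ℕ} (v : ℝ → ℝ) (S : Set (EN N → ℂ)) : Prop :=
  ∃ p : Submodule ℂ (EN N → ℂ), (↑p ⊆ {f : EN N → ℂ | MemHv v f}) ∧ (↑p ⊆ S ∪ {0}) ∧
    ¬ Module.Finite ℂ ↥p ∧
    ∀ f, MemHv v f → (∀ δ > 0, ∃ g ∈ p, hvNorm v (g - f) < δ) → f ∈ p

/-- The standing assumptions on the family `{γ_z : z ∈ 𝔹_N}`: each `γ_z` is a `C¹` map
`b𝔹_N × [0,1] → cl 𝔹_N` into `𝔹_N` for `r < 1` with `γ_z(x,1) = x`, transversal approach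
and (†), with joint continuity of `(z,x,r) ↦ γ_z(x,r)` and of `(z,r) ↦ ∂γ_z(x,r)/∂r`. -/
def BallGammaFamily {N : ℕ} (γ : EN N → EN N × ℝ → EN N) : Prop :=
  (∀ z ∈ Metric.ball (0:EN N) 1,
    GammaMap (Metric.ball 0 1) ballRho (γ z) 1 ∧ Dagger (Metric.ball 0 1) ballRho (γ z)) ∧
  ContinuousOn (fun p : EN N × (EN N × ℝ) => γ p.1 p.2)
    (Metric.ball 0 1 ×ˢ (Metric.sphere 0 1 ×ˢ Icc (0:ℝ) 1)) ∧
  ∀ x ∈ Metric.sphere (0:EN N) 1,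
    ContinuousOn (fun p : EN N × ℝ => derivWithin (fun r => γ p.1 (x, r)) (Icc (0:ℝ) 1) p.2)
      (Metric.ball 0 1 ×ˢ Icc (0:ℝ) 1)

/-- The set of `f` such that for every `z ∈ 𝔹_N`, every measurable function on `b𝔹_N` is an
a.e. limit of `f ∘ γ_z(·, r_{j_k})` along some subsequence of `(r_j)`. -/
def WSetHv {N : ℕ} (γ : EN N → EN N × ℝ → EN N) (r : ℕ → ℝ) : Set (EN N → ℂ) :=
  {f | ∀ z ∈ Metric.ball (0:EN N) 1, ∀ h : EN N → ℂ, Measurable h →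
    ∃ φ : ℕ → ℕ, StrictMono φ ∧
      ∀ᵐ x ∂ sphMeasure N, Tendsto (fun k => f (γ z (x, r (φ k)))) atTop (𝓝 (h x))}

/-- The set `E_L^* = {γ_z(x,r) : x ∈ E, r ∈ [0,1], z ∈ L}`. -/
def EStarSet {N : ℕ} (γ : EN N → EN N × ℝ → EN N) (L E : Set (EN N)) : Set (EN N) :=
  {w | ∃ z ∈ L, ∃ x ∈ E, ∃ r ∈ Icc (0:ℝ) 1, w = γ z (x, r)}

/-- The Korányi approach region `D_α(x)`. -/
def Koranyi {N : ℕ} (α : ℝ) (x : EN N) : Set (EN N) :=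
  {z ∈ Metric.ball (0:EN N) 1 | ‖1 - (⟪x, z⟫_ℂ : ℂ)‖ < α / 2 * (1 - ‖z‖ ^ 2)}

/-- `h` has a `K`-limit at `x`: for every `α > 1` the values of `h` converge along every
sequence in `D_α(x)` converging to `x`. -/
def HasKLimitAt {N : ℕ} (h : EN N → ℂ) (x : EN N) : Prop :=
  ∀ α > (1:ℝ), ∃ c : ℂ, ∀ z : ℕ → EN N, (∀ i, z i ∈ Koranyi α x) →
    Tendsto z atTop (𝓝 x) → Tendsto (fun i => h (z i)) atTop (𝓝 c)

/-- The circle `bL_x = L_x ∩ b𝔹_N` cut out on the complex line through `x` and `0`. -/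
def lineCircle {N : ℕ} (x : EN N) : Set (EN N) :=
  {z | ∃ t : ℂ, z = t • x} ∩ Metric.sphere 0 1

end
open Set Filter Topology Metric MeasureTheory
open scoped ENNReal NNReal InnerProductSpace ComplexConjugate

namespace WB

variable {N : ℕ}

/-- standard basis vector -/
noncomputable def eb (j : Fin N) : EN N := EuclideanSpace.single j (1:ℂ)

/-- Wirtinger derivative `∂/∂z_j`. -/
noncomputable def dz (j : Fin N) (w : EN N → ℂ) (z : EN N) : ℂ :=
  (1/2) * (fderiv ℝ w z (eb j) - Complex.I * fderiv ℝ w z (Complex.I • eb j))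

/-- Wirtinger derivative `∂/∂z̄_j`. -/
noncomputable def dzb (j : Fin N) (w : EN N → ℂ) (z : EN N) : ℂ :=
  (1/2) * (fderiv ℝ w z (eb j) + Complex.I * fderiv ℝ w z (Complex.I • eb j))

lemma fderiv_star (w : EN N → ℂ) (z v : EN N) :
    fderiv ℝ (fun x => conj (w x)) z v = conj (fderiv ℝ w z v) := by
  have := (Complex.conjCLE).comp_fderiv (f := w) (x := z)
  have h2 : (fun x => conj (w x)) = Complex.conjCLE ∘ w := by ext x; simp
  rw [h2, this]; simp

lemma dz_conj (j : Fin N) (w : EN N → ℂ) (z : EN N) :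
    dz j (fun x => conj (w x)) z = conj (dzb j w z) := by
  simp only [dz, dzb, fderiv_star, map_mul, map_add, Complex.conj_I]
  have h2 : (starRingEnd ℂ) 2 = 2 := map_ofNat _ 2
  simp [h2]; ring

lemma dzb_conj (j : Fin N) (w : EN N → ℂ) (z : EN N) :
    dzb j (fun x => conj (w x)) z = conj (dz j w z) := by
  simp only [dz, dzb, fderiv_star, map_mul, map_sub, Complex.conj_I]
  have h2 : (starRingEnd ℂ) 2 = 2 := map_ofNat _ 2
  simp [h2]

lemma fderiv_mul_apply' {u w : EN N → ℂ} {z : EN N} (hu : DifferentiableAt ℝ u z)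
    (hw : DifferentiableAt ℝ w z) (v : EN N) :
    fderiv ℝ (fun x => u x * w x) z v = u z * fderiv ℝ w z v + fderiv ℝ u z v * w z := by
  rw [fderiv_fun_mul hu hw]; simp [mul_comm]

lemma dz_mul {u w : EN N → ℂ} {z : EN N} (j : Fin N) (hu : DifferentiableAt ℝ u z)
    (hw : DifferentiableAt ℝ w z) :
    dz j (fun x => u x * w x) z = u z * dz j w z + dz j u z * w z := by
  simp only [dz, fderiv_mul_apply' hu hw]; ring

lemma dzb_mul {u w : EN N → ℂ} {z : EN N} (j : Fin N) (hu : DifferentiableAt ℝ u z)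
    (hw : DifferentiableAt ℝ w z) :
    dzb j (fun x => u x * w x) z = u z * dzb j w z + dzb j u z * w z := by
  simp only [dzb, fderiv_mul_apply' hu hw]; ring

lemma dzb_sub {u w : EN N → ℂ} {z : EN N} (j : Fin N) (hu : DifferentiableAt ℝ u z)
    (hw : DifferentiableAt ℝ w z) :
    dzb j (fun x => u x - w x) z = dzb j u z - dzb j w z := by
  simp only [dzb, fderiv_fun_sub hu hw]; simp; ring

lemma dzb_add {u w : EN N → ℂ} {z : EN N} (j : Fin N) (hu : DifferentiableAt ℝ u z)
    (hw : DifferentiableAt ℝ w z) :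
    dzb j (fun x => u x + w x) z = dzb j u z + dzb j w z := by
  simp only [dzb, fderiv_fun_add hu hw]; simp; ring

lemma dz_add {u w : EN N → ℂ} {z : EN N} (j : Fin N) (hu : DifferentiableAt ℝ u z)
    (hw : DifferentiableAt ℝ w z) :
    dz j (fun x => u x + w x) z = dz j u z + dz j w z := by
  simp only [dz, fderiv_fun_add hu hw]; simp; ring

lemma dzb_congr {u w : EN N → ℂ} {z : EN N} (j : Fin N) (h : u =ᶠ[𝓝 z] w) :
    dzb j u z = dzb j w z := by simp only [dzb, h.fderiv_eq]

lemma dz_congr {u w : EN N → ℂ} {z : EN N} (j : Fin N) (h : u =ᶠ[𝓝 z] w) :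
    dz j u z = dz j w z := by simp only [dz, h.fderiv_eq]

lemma contDiff_fderiv_apply {n m : ℕ∞} {w : EN N → ℂ} (hw : ContDiff ℝ n w) (h : m + 1 ≤ n)
    (v : EN N) : ContDiff ℝ m (fun x => fderiv ℝ w x v) := by
  have := hw.fderiv_right (m := m) (by exact_mod_cast h)
  exact this.clm_apply contDiff_const

lemma contDiff_dz {n m : ℕ∞} {w : EN N → ℂ} (hw : ContDiff ℝ n w) (h : m + 1 ≤ n)
    (j : Fin N) : ContDiff ℝ m (dz j w) := by
  unfold dz
  exact contDiff_const.mul ((contDiff_fderiv_apply hw h _).sub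
    (contDiff_const.mul (contDiff_fderiv_apply hw h _)))

lemma contDiff_dzb {n m : ℕ∞} {w : EN N → ℂ} (hw : ContDiff ℝ n w) (h : m + 1 ≤ n)
    (j : Fin N) : ContDiff ℝ m (dzb j w) := by
  unfold dzb
  exact contDiff_const.mul ((contDiff_fderiv_apply hw h _).add
    (contDiff_const.mul (contDiff_fderiv_apply hw h _)))

lemma tsupport_fderiv_apply_subset' (w : EN N → ℂ) (v : EN N) :
    tsupport (fun x => fderiv ℝ w x v) ⊆ tsupport w := by
  exact tsupport_fderiv_apply_subset ℝ v

lemma dz_eq_zero {w : EN N → ℂ} {z : EN N} (j : Fin N) (h : z ∉ tsupport w) : dz j w z = 0 := by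
  have := notMem_tsupport_iff_eventuallyEq.1 h
  rw [dz_congr j this]; simp [dz]

lemma dzb_eq_zero {w : EN N → ℂ} {z : EN N} (j : Fin N) (h : z ∉ tsupport w) : dzb j w z = 0 := by
  have := notMem_tsupport_iff_eventuallyEq.1 h
  rw [dzb_congr j this]; simp [dzb]

lemma tsupport_dz_subset (w : EN N → ℂ) (j : Fin N) : tsupport (dz j w) ⊆ tsupport w := by
  refine closure_minimal ?_ (isClosed_tsupport w)
  intro z hz; by_contra h; exact hz (dz_eq_zero j h)

lemma tsupport_dzb_subset (w : EN N → ℂ) (j : Fin N) : tsupport (dzb j w) ⊆ tsupport w := by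
  refine closure_minimal ?_ (isClosed_tsupport w)
  intro z hz; by_contra h; exact hz (dzb_eq_zero j h)

lemma hcs_of_tsupport {u w : EN N → ℂ} (hu : HasCompactSupport u) (h : tsupport w ⊆ tsupport u) :
    HasCompactSupport w := hu.of_isClosed_subset (isClosed_tsupport w) h

variable (μ : Measure (EN N)) [μ.IsAddHaarMeasure]

lemma ibp {u w : EN N → ℂ} (hu : ContDiff ℝ 1 u) (hw : ContDiff ℝ 1 w) (hc : HasCompactSupport u)
    (v : EN N) :
    ∫ x, fderiv ℝ u x v * w x ∂μ = - ∫ x, u x * fderiv ℝ w x v ∂μ := by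
  have c1 : Continuous (fun x => fderiv ℝ u x v) :=
    (contDiff_fderiv_apply (n := 1) (m := 0) hu (by simp) v).continuous
  have c2 : Continuous (fun x => fderiv ℝ w x v) :=
    (contDiff_fderiv_apply (n := 1) (m := 0) hw (by simp) v).continuous
  have h1 : HasCompactSupport (fun x => fderiv ℝ u x v) :=
    hcs_of_tsupport hc (tsupport_fderiv_apply_subset' u v)
  have := integral_mul_fderiv_eq_neg_fderiv_mul_of_integrable (μ := μ) (f := u) (g := w) (v := v)
    ((c1.mul hw.continuous).integrable_of_hasCompactSupport (h1.mul_right))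
    ((hu.continuous.mul c2).integrable_of_hasCompactSupport (hc.mul_right))
    ((hu.continuous.mul hw.continuous).integrable_of_hasCompactSupport (hc.mul_right))
    (fun x _ => hu.differentiable (by simp) x) (fun x _ => hw.differentiable (by simp) x)
  rw [this]; simp

lemma int_cc {u : EN N → ℂ} (hu : Continuous u) (hc : HasCompactSupport u) : Integrable u μ :=
  hu.integrable_of_hasCompactSupport hc

lemma ibp_dz {u w : EN N → ℂ} (hu : ContDiff ℝ 1 u) (hw : ContDiff ℝ 1 w)
    (hc : HasCompactSupport u) (j : Fin N) :
    ∫ x, dz j u x * w x ∂μ = - ∫ x, u x * dz j w x ∂μ := by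
  have c1 : ∀ v, Continuous (fun x => fderiv ℝ u x v) := fun v =>
    (contDiff_fderiv_apply (n := 1) (m := 0) hu (by simp) v).continuous
  have c2 : ∀ v, Continuous (fun x => fderiv ℝ w x v) := fun v =>
    (contDiff_fderiv_apply (n := 1) (m := 0) hw (by simp) v).continuous
  have h1 : ∀ v, HasCompactSupport (fun x => fderiv ℝ u x v) := fun v =>
    hcs_of_tsupport hc (tsupport_fderiv_apply_subset' u v)
  have i1 : ∀ v, Integrable (fun x => fderiv ℝ u x v * w x) μ := fun v =>
    ((c1 v).mul hw.continuous).integrable_of_hasCompactSupport ((h1 v).mul_right)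
  have i2 : ∀ v, Integrable (fun x => u x * fderiv ℝ w x v) μ := fun v =>
    (hu.continuous.mul (c2 v)).integrable_of_hasCompactSupport (hc.mul_right)
  have e1 : ∀ x, dz j u x * w x = (1/2) * (fderiv ℝ u x (eb j) * w x)
      - (Complex.I/2) * (fderiv ℝ u x (Complex.I • eb j) * w x) := fun x => by
    simp only [dz]; ring
  have e2 : ∀ x, u x * dz j w x = (1/2) * (u x * fderiv ℝ w x (eb j))
      - (Complex.I/2) * (u x * fderiv ℝ w x (Complex.I • eb j)) := fun x => by
    simp only [dz]; ring
  simp_rw [e1, e2]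
  rw [integral_sub ((i1 _).const_mul _) ((i1 _).const_mul _),
    integral_sub ((i2 _).const_mul _) ((i2 _).const_mul _)]
  simp only [integral_const_mul]
  rw [ibp μ hu hw hc, ibp μ hu hw hc]; ring

lemma ibp_dzb {u w : EN N → ℂ} (hu : ContDiff ℝ 1 u) (hw : ContDiff ℝ 1 w)
    (hc : HasCompactSupport u) (j : Fin N) :
    ∫ x, dzb j u x * w x ∂μ = - ∫ x, u x * dzb j w x ∂μ := by
  have c1 : ∀ v, Continuous (fun x => fderiv ℝ u x v) := fun v =>
    (contDiff_fderiv_apply (n := 1) (m := 0) hu (by simp) v).continuous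
  have c2 : ∀ v, Continuous (fun x => fderiv ℝ w x v) := fun v =>
    (contDiff_fderiv_apply (n := 1) (m := 0) hw (by simp) v).continuous
  have h1 : ∀ v, HasCompactSupport (fun x => fderiv ℝ u x v) := fun v =>
    hcs_of_tsupport hc (tsupport_fderiv_apply_subset' u v)
  have i1 : ∀ v, Integrable (fun x => fderiv ℝ u x v * w x) μ := fun v =>
    ((c1 v).mul hw.continuous).integrable_of_hasCompactSupport ((h1 v).mul_right)
  have i2 : ∀ v, Integrable (fun x => u x * fderiv ℝ w x v) μ := fun v =>
    (hu.continuous.mul (c2 v)).integrable_of_hasCompactSupport (hc.mul_right)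
  have e1 : ∀ x, dzb j u x * w x = (1/2) * (fderiv ℝ u x (eb j) * w x)
      + (Complex.I/2) * (fderiv ℝ u x (Complex.I • eb j) * w x) := fun x => by
    simp only [dzb]; ring
  have e2 : ∀ x, u x * dzb j w x = (1/2) * (u x * fderiv ℝ w x (eb j))
      + (Complex.I/2) * (u x * fderiv ℝ w x (Complex.I • eb j)) := fun x => by
    simp only [dzb]; ring
  simp_rw [e1, e2]
  rw [integral_add ((i1 _).const_mul _) ((i1 _).const_mul _),
    integral_add ((i2 _).const_mul _) ((i2 _).const_mul _)]
  simp only [integral_const_mul]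
  rw [ibp μ hu hw hc, ibp μ hu hw hc]; ring

lemma fderiv_fderiv_apply {w : EN N → ℂ} (hw : ContDiff ℝ 2 w) (z v v' : EN N) :
    fderiv ℝ (fun x => fderiv ℝ w x v) z v' = fderiv ℝ (fderiv ℝ w) z v' v := by
  have h : DifferentiableAt ℝ (fderiv ℝ w) z :=
    (hw.fderiv_right (m := 1) (by norm_num)).differentiable (by simp) z
  rw [fderiv_clm_apply h (differentiableAt_const v)]; simp

lemma sym2 {w : EN N → ℂ} (hw : ContDiff ℝ 2 w) (z v v' : EN N) :
    fderiv ℝ (fderiv ℝ w) z v' v = fderiv ℝ (fderiv ℝ w) z v v' :=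
  (hw.contDiffAt (x := z)).isSymmSndFDerivAt (by simp) v' v

lemma diff_fa {w : EN N → ℂ} (hw : ContDiff ℝ 2 w) (v z : EN N) :
    DifferentiableAt ℝ (fun x => fderiv ℝ w x v) z :=
  (contDiff_fderiv_apply (n := 2) (m := 1) hw (by norm_num) v).differentiable (by simp) z

lemma fderiv_comb {a b : EN N → ℂ} {z : EN N} (c d : ℂ) (ha : DifferentiableAt ℝ a z)
    (hb : DifferentiableAt ℝ b z) (v : EN N) :
    fderiv ℝ (fun x => c * (a x + d * b x)) z v = c * (fderiv ℝ a z v + d * fderiv ℝ b z v) := by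
  rw [fderiv_const_mul (ha.fun_add (hb.const_mul d)), fderiv_fun_add ha (hb.const_mul d),
    fderiv_const_mul hb]
  simp; ring

lemma dzb_eq_fun (j : Fin N) (w : EN N → ℂ) : dzb j w = fun x =>
    (1/2) * (fderiv ℝ w x (eb j) + Complex.I * fderiv ℝ w x (Complex.I • eb j)) := rfl

lemma dz_eq_fun (j : Fin N) (w : EN N → ℂ) : dz j w = fun x =>
    (1/2) * (fderiv ℝ w x (eb j) + (-Complex.I) * fderiv ℝ w x (Complex.I • eb j)) := by
  ext x; simp [dz]; ring

lemma dzb_dz {w : EN N → ℂ} (hw : ContDiff ℝ 2 w) (j k : Fin N) (z : EN N) :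
    dzb j (dz k w) z = (1/4) * (fderiv ℝ (fderiv ℝ w) z (eb j) (eb k)
      + fderiv ℝ (fderiv ℝ w) z (Complex.I • eb j) (Complex.I • eb k)
      + Complex.I * (fderiv ℝ (fderiv ℝ w) z (Complex.I • eb j) (eb k)
      - fderiv ℝ (fderiv ℝ w) z (eb j) (Complex.I • eb k))) := by
  have hI : Complex.I * Complex.I = -1 := Complex.I_mul_I
  rw [dz_eq_fun]; simp only [dzb]
  rw [fderiv_comb _ _ (diff_fa hw _ _) (diff_fa hw _ _),
    fderiv_comb _ _ (diff_fa hw _ _) (diff_fa hw _ _)]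
  simp only [fderiv_fderiv_apply hw]
  linear_combination (-1/4) * fderiv ℝ (fderiv ℝ w) z (Complex.I • eb j) (Complex.I • eb k) * hI

lemma dz_dzb {w : EN N → ℂ} (hw : ContDiff ℝ 2 w) (j k : Fin N) (z : EN N) :
    dz k (dzb j w) z = dzb j (dz k w) z := by
  have hI : Complex.I * Complex.I = -1 := Complex.I_mul_I
  rw [dzb_dz hw]
  rw [dzb_eq_fun]; simp only [dz]
  rw [fderiv_comb _ _ (diff_fa hw _ _) (diff_fa hw _ _),
    fderiv_comb _ _ (diff_fa hw _ _) (diff_fa hw _ _)]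
  simp only [fderiv_fderiv_apply hw]
  rw [sym2 hw z (eb j) (eb k), sym2 hw z (Complex.I • eb j) (Complex.I • eb k),
    sym2 hw z (Complex.I • eb j) (eb k), sym2 hw z (eb j) (Complex.I • eb k)]
  linear_combination (-1/4) * fderiv ℝ (fderiv ℝ w) z (Complex.I • eb j) (Complex.I • eb k) * hI

lemma dzb_dzb {w : EN N → ℂ} (hw : ContDiff ℝ 2 w) (j k : Fin N) (z : EN N) :
    dzb k (dzb j w) z = dzb j (dzb k w) z := by
  have hI : Complex.I * Complex.I = -1 := Complex.I_mul_I
  rw [dzb_eq_fun j w, dzb_eq_fun k w]; simp only [dzb]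
  rw [fderiv_comb _ _ (diff_fa hw _ _) (diff_fa hw _ _),
    fderiv_comb _ _ (diff_fa hw _ _) (diff_fa hw _ _),
    fderiv_comb _ _ (diff_fa hw _ _) (diff_fa hw _ _),
    fderiv_comb _ _ (diff_fa hw _ _) (diff_fa hw _ _)]
  simp only [fderiv_fderiv_apply hw]
  rw [sym2 hw z (eb j) (eb k), sym2 hw z (Complex.I • eb j) (Complex.I • eb k),
    sym2 hw z (Complex.I • eb j) (eb k), sym2 hw z (eb j) (Complex.I • eb k)]
  ring

end WB

open Set Filter Topology Metric MeasureTheory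
open scoped ENNReal NNReal InnerProductSpace ComplexConjugate

namespace WB

variable {N : ℕ}

/-- complexification of a real function -/
noncomputable def cx (φ : EN N → ℝ) (z : EN N) : ℂ := (φ z : ℂ)

/-- the weight exp(-φ) as complex function -/
noncomputable def ex (φ : EN N → ℝ) (z : EN N) : ℂ := (Real.exp (-φ z) : ℂ)

lemma contDiff_cx {n : ℕ∞} {φ : EN N → ℝ} (h : ContDiff ℝ n φ) : ContDiff ℝ n (cx φ) :=
  Complex.ofRealCLM.contDiff.comp h

lemma contDiff_ex {n : ℕ∞} {φ : EN N → ℝ} (h : ContDiff ℝ n φ) : ContDiff ℝ n (ex φ) :=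
  Complex.ofRealCLM.contDiff.comp (Real.contDiff_exp.comp h.neg)

lemma fderiv_cx {φ : EN N → ℝ} {z : EN N} (h : DifferentiableAt ℝ φ z) (v : EN N) :
    fderiv ℝ (cx φ) z v = (fderiv ℝ φ z v : ℂ) := by
  have := Complex.ofRealCLM.hasFDerivAt.comp z h.hasFDerivAt
  have h2 : fderiv ℝ (cx φ) z = _ := this.fderiv
  rw [h2]; simp

lemma fderiv_ex {φ : EN N → ℝ} {z : EN N} (h : DifferentiableAt ℝ φ z) (v : EN N) :
    fderiv ℝ (ex φ) z v = - fderiv ℝ (cx φ) z v * ex φ z := by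
  have h1 : HasFDerivAt (fun x => Real.exp (-φ x)) _ z := h.hasFDerivAt.neg.exp
  have := Complex.ofRealCLM.hasFDerivAt.comp z h1
  have h2 : fderiv ℝ (ex φ) z = _ := this.fderiv
  rw [h2, fderiv_cx h]; simp [ex]; ring

lemma dz_ex {φ : EN N → ℝ} {z : EN N} (h : DifferentiableAt ℝ φ z) (j : Fin N) :
    dz j (ex φ) z = - dz j (cx φ) z * ex φ z := by
  simp only [dz, fderiv_ex h]; ring

/-- the twisted derivative -/
noncomputable def dl (φ : EN N → ℝ) (j : Fin N) (w : EN N → ℂ) (z : EN N) : ℂ :=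
  dz j w z - dz j (cx φ) z * w z

lemma contDiff_dl {φ : EN N → ℝ} (hφ : ContDiff ℝ 2 φ) (j : Fin N) {w : EN N → ℂ}
    (hw : ContDiff ℝ 2 w) : ContDiff ℝ 1 (dl φ j w) := by
  unfold dl
  exact (contDiff_dz (n := 2) (m := 1) hw (by norm_num) j).sub
    ((contDiff_dz (n := 2) (m := 1) (contDiff_cx hφ) (by norm_num) j).mul
      (hw.of_le (by norm_num)))

lemma continuous_dl {φ : EN N → ℝ} (hφ : ContDiff ℝ 1 φ) (j : Fin N) {w : EN N → ℂ}
    (hw : ContDiff ℝ 1 w) : Continuous (dl φ j w) := by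
  unfold dl
  exact (contDiff_dz (n := 1) (m := 0) hw (by norm_num) j).continuous.sub
    ((contDiff_dz (n := 1) (m := 0) (contDiff_cx hφ) (by norm_num) j).continuous.mul
      hw.continuous)

lemma tsupport_dl_subset (φ : EN N → ℝ) (j : Fin N) (w : EN N → ℂ) :
    tsupport (dl φ j w) ⊆ tsupport w := by
  refine closure_minimal ?_ (isClosed_tsupport w)
  intro z hz; by_contra h
  apply hz
  simp [dl, dz_eq_zero j h, image_eq_zero_of_notMem_tsupport h]

lemma dz_mul_ex {φ : EN N → ℝ} {z : EN N} (h : DifferentiableAt ℝ φ z) (j : Fin N) {u : EN N → ℂ}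
    (hu : DifferentiableAt ℝ u z) :
    dz j (fun x => u x * ex φ x) z = dl φ j u z * ex φ z := by
  have he : DifferentiableAt ℝ (ex φ) z :=
    (Complex.ofRealCLM.hasFDerivAt.comp z h.hasFDerivAt.neg.exp).differentiableAt
  rw [dz_mul j hu he, dz_ex h, dl]; ring

variable (μ : Measure (EN N)) [μ.IsAddHaarMeasure]

lemma ibp_dl {φ : EN N → ℝ} (hφ : ContDiff ℝ 1 φ) {u w : EN N → ℂ} (hu : ContDiff ℝ 1 u)
    (hw : ContDiff ℝ 1 w) (hc : HasCompactSupport u) (j : Fin N) :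
    ∫ x, dl φ j u x * conj (w x) * ex φ x ∂μ = - ∫ x, u x * conj (dzb j w x) * ex φ x ∂μ := by
  have hex := contDiff_ex (n := 1) hφ
  have hcw : ContDiff ℝ 1 (fun x => conj (w x)) := Complex.conjCLE.contDiff.comp hw
  have := ibp_dz μ (u := fun x => u x * ex φ x) (w := fun x => conj (w x)) (hu.mul hex) hcw
    hc.mul_right j
  have e1 : ∀ x, dl φ j u x * conj (w x) * ex φ x
      = dz j (fun x => u x * ex φ x) x * conj (w x) := fun x => by
    rw [dz_mul_ex (hφ.differentiable (by simp) x) j (hu.differentiable (by simp) x)]; ring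
  simp_rw [e1, this, dz_conj]
  congr 2; ext x; ring

lemma dzb_dl {φ : EN N → ℝ} (hφ : ContDiff ℝ 2 φ) {w : EN N → ℂ} (hw : ContDiff ℝ 2 w)
    (j k : Fin N) (z : EN N) :
    dzb j (dl φ k w) z = dl φ k (dzb j w) z - dzb j (dz k (cx φ)) z * w z := by
  have hd : ∀ {g : EN N → ℂ}, ContDiff ℝ 2 g → DifferentiableAt ℝ (dz k g) z := fun hg =>
    (contDiff_dz (n := 2) (m := 1) hg (by norm_num) k).differentiable (by simp) z
  have hw1 := hw.differentiable (by simp) z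
  have e : dl φ k w = fun z => dz k w z - dz k (cx φ) z * w z := rfl
  rw [e, dzb_sub j (hd hw) ((hd (contDiff_cx (n := 2) hφ)).fun_mul hw1),
    dzb_mul j (hd (contDiff_cx (n := 2) hφ)) hw1, dl, dz_dzb hw]
  ring

lemma be_pair {φ : EN N → ℝ} (hφ : ContDiff ℝ 2 φ) {u w : EN N → ℂ} (hu : ContDiff ℝ 2 u)
    (hw : ContDiff ℝ 2 w) (hcu : HasCompactSupport u) (hcw : HasCompactSupport w) (j k : Fin N) :
    ∫ x, dl φ j u x * conj (dl φ k w x) * ex φ x ∂μ =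
      ∫ x, dzb k u x * conj (dzb j w x) * ex φ x ∂μ
      + ∫ x, u x * conj (w x) * conj (dzb j (dz k (cx φ)) x) * ex φ x ∂μ := by
  have h1 : ContDiff ℝ 1 φ := hφ.of_le (by norm_num)
  have u1 : ContDiff ℝ 1 u := hu.of_le (by norm_num)
  have w1 : ContDiff ℝ 1 w := hw.of_le (by norm_num)
  have g1 : ContDiff ℝ 1 (dzb j w) := contDiff_dzb (n := 2) (m := 1) hw (by norm_num) j
  have hce : Continuous (ex φ) := (contDiff_ex (n := 1) h1).continuous
  have hcg : HasCompactSupport (dzb j w) := hcs_of_tsupport hcw (tsupport_dzb_subset w j)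
  rw [ibp_dl μ h1 u1 (contDiff_dl hφ k hw) hcu j]
  have e1 : ∀ x, u x * conj (dzb j (dl φ k w) x) * ex φ x =
      conj (dl φ k (dzb j w) x * conj (u x) * ex φ x)
      - u x * conj (w x) * conj (dzb j (dz k (cx φ)) x) * ex φ x := fun x => by
    rw [dzb_dl hφ hw]; simp [ex, Complex.conj_ofReal, -Complex.ofReal_exp]; ring
  simp_rw [e1]
  have cφ : Continuous (dzb j (dz k (cx φ))) :=
    (contDiff_dzb (n := 1) (m := 0) (contDiff_dz (n := 2) (m := 1) (contDiff_cx (n := 2) hφ)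
      (by norm_num) k) (by norm_num) j).continuous
  have i1 : Integrable (fun x => dl φ k (dzb j w) x * conj (u x) * ex φ x) μ := by
    apply int_cc
    · exact ((continuous_dl h1 k g1).mul (Complex.continuous_conj.comp u1.continuous)).mul hce
    · exact (HasCompactSupport.mul_right (hcs_of_tsupport hcg (tsupport_dl_subset φ k _))).mul_right
  have i2 : Integrable (fun x => u x * conj (w x) * conj (dzb j (dz k (cx φ)) x) * ex φ x) μ := by
    apply int_cc
    · exact ((u1.continuous.mul (Complex.continuous_conj.comp w1.continuous)).mul
        (Complex.continuous_conj.comp cφ)).mul hce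
    · exact ((HasCompactSupport.mul_right hcu).mul_right).mul_right
  have i1' : Integrable (fun x => conj (dl φ k (dzb j w) x * conj (u x) * ex φ x)) μ := by
    apply int_cc
    · exact Complex.continuous_conj.comp
        (((continuous_dl h1 k g1).mul (Complex.continuous_conj.comp u1.continuous)).mul hce)
    · exact HasCompactSupport.comp_left ((HasCompactSupport.mul_right
        (hcs_of_tsupport hcg (tsupport_dl_subset φ k _))).mul_right) (map_zero _)
  rw [integral_sub i1' i2, integral_conj, ibp_dl μ h1 g1 u1 hcg k, map_neg, ← integral_conj]
  have e2 : ∀ x, conj (dzb j w x * conj (dzb k u x) * ex φ x) =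
      dzb k u x * conj (dzb j w x) * ex φ x := fun x => by
    simp [ex, Complex.conj_ofReal, -Complex.ofReal_exp]; ring
  simp_rw [e2]; ring

/-- vector field from components -/
noncomputable def vec (f : Fin N → EN N → ℂ) (z : EN N) : EN N := WithLp.toLp 2 (fun j => f j z)

lemma decomp (b : EN N) : b = ∑ j, (((b j).re : ℝ) • eb j + ((b j).im : ℝ) • (Complex.I • eb j)) := by
  ext k
  simp only [eb]
  rw [WithLp.ofLp_sum, Finset.sum_apply, Finset.sum_eq_single k]
  · simp
  · intro j _ hj; simp [hj.symm]
  · simp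

lemma decompI (b : EN N) : Complex.I • b =
    ∑ j, ((-(b j).im : ℝ) • eb j + ((b j).re : ℝ) • (Complex.I • eb j)) := by
  have := decomp (Complex.I • b)
  simpa using this

lemma ff_cx {φ : EN N → ℝ} (hφ : ContDiff ℝ 2 φ) (z v w : EN N) :
    fderiv ℝ (fderiv ℝ (cx φ)) z v w = (Hess φ z v w : ℂ) := by
  rw [← fderiv_fderiv_apply (contDiff_cx (n := 2) hφ)]
  have h : DifferentiableAt ℝ (fderiv ℝ φ) z :=
    (hφ.fderiv_right (m := 1) (by norm_num)).differentiable (by simp) z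
  have e : (fun x => fderiv ℝ (cx φ) x w) = cx (fun x => fderiv ℝ φ x w) := by
    ext x; exact fderiv_cx (hφ.differentiable (by simp) x) w
  rw [e, fderiv_cx (h.clm_apply (differentiableAt_const w)),
    fderiv_clm_apply h (differentiableAt_const w)]
  simp [Hess]

lemma levi_eq {φ : EN N → ℝ} (hφ : ContDiff ℝ 2 φ) (z b : EN N) :
    LeviForm φ z b = (∑ j, ∑ k, b j * conj (b k) * conj (dzb j (dz k (cx φ)) z)).re := by
  have key : ∀ v w : Fin N → EN N, Hess φ z (∑ j, v j) (∑ k, w k) = ∑ j, ∑ k, Hess φ z (v j) (w k) := by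
    intro v w; simp only [Hess, map_sum, _root_.sum_apply]
    rw [Finset.sum_comm]
  unfold LeviForm
  have e1 : Hess φ z b b = _ := congrArg₂ (Hess φ z) (decomp b) (decomp b)
  rw [decompI b, e1, key, key, ← Finset.sum_add_distrib, Finset.sum_div, Complex.re_sum]
  refine Finset.sum_congr rfl fun j _ => ?_
  rw [← Finset.sum_add_distrib, Finset.sum_div, Complex.re_sum]
  refine Finset.sum_congr rfl fun k _ => ?_
  rw [dzb_dz (contDiff_cx (n := 2) hφ)]
  simp only [ff_cx hφ]
  have hb : ∀ (a b : ℝ) (x y x' y' : EN N) (c d : ℝ), Hess φ z (a • x + b • y) (c • x' + d • y') =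
      a * c * Hess φ z x x' + a * d * Hess φ z x y' + b * c * Hess φ z y x' + b * d * Hess φ z y y' := by
    intro a b x y x' y' c d; simp [Hess]; ring
  rw [hb, hb]
  have h4 : (starRingEnd ℂ) (1/4) = 1/4 := by
    simp [show (starRingEnd ℂ) 4 = 4 from map_ofNat _ 4]
  simp only [map_mul, map_add, map_sub, Complex.conj_ofReal, Complex.conj_I, h4]
  simp [Complex.mul_re, Complex.mul_im]
  ring

lemma re_curl (A : Fin N → Fin N → ℂ) :
    -(1/2) * ∑ j, ∑ k, ‖A j k - A k j‖^2 ≤ (∑ j, ∑ k, A k j * conj (A j k)).re := by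
  have h1 : ∀ j k, ‖A j k - A k j‖^2 = ‖A j k‖^2 + ‖A k j‖^2 - 2 * (A k j * conj (A j k)).re := by
    intro j k
    simp only [← Complex.normSq_eq_norm_sq, Complex.normSq_apply]; simp [Complex.mul_re]; ring
  simp only [h1, Complex.re_sum, Finset.sum_add_distrib, Finset.sum_sub_distrib, ← Finset.mul_sum]
  have : 0 ≤ ∑ j, ∑ k, ‖A j k‖^2 := by positivity
  have : 0 ≤ ∑ j, ∑ k, ‖A k j‖^2 := by positivity
  linarith

lemma re_int {g : EN N → ℂ} (hg : Integrable g μ) : (∫ x, g x ∂μ).re = ∫ x, (g x).re ∂μ :=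
  (integral_re hg).symm

theorem be {φ : EN N → ℝ} (hφ : ContDiff ℝ 2 φ) {f : Fin N → EN N → ℂ} (hf : ∀ j, ContDiff ℝ 2 (f j))
    (hc : ∀ j, HasCompactSupport (f j)) :
    ∫ x, LeviForm φ x (vec f x) * Real.exp (-φ x) ∂μ ≤
      ∫ x, ‖∑ j, dl φ j (f j) x‖^2 * Real.exp (-φ x) ∂μ
      + (1/2) * ∫ x, (∑ j, ∑ k, ‖dzb j (f k) x - dzb k (f j) x‖^2) * Real.exp (-φ x) ∂μ := by
  have h1 : ContDiff ℝ 1 φ := hφ.of_le (by norm_num)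
  have f1 : ∀ j, ContDiff ℝ 1 (f j) := fun j => (hf j).of_le (by norm_num)
  have hce : Continuous (ex φ) := (contDiff_ex (n := 1) h1).continuous
  have hcd : ∀ j k, Continuous (dzb j (f k)) := fun j k =>
    (contDiff_dzb (n := 1) (m := 0) (f1 k) (by norm_num) j).continuous
  have hsd : ∀ j k, HasCompactSupport (dzb j (f k)) := fun j k =>
    hcs_of_tsupport (hc k) (tsupport_dzb_subset _ _)
  have cφ : ∀ j k, Continuous (dzb j (dz k (cx φ))) := fun j k =>
    (contDiff_dzb (n := 1) (m := 0) (contDiff_dz (n := 2) (m := 1) (contDiff_cx (n := 2) hφ)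
      (by norm_num) k) (by norm_num) j).continuous
  have iA : ∀ j k, Integrable (fun x => dzb k (f j) x * conj (dzb j (f k) x) * ex φ x) μ := by
    intro j k; apply int_cc
    · exact ((hcd k j).mul (Complex.continuous_conj.comp (hcd j k))).mul hce
    · exact (HasCompactSupport.mul_right (hsd k j)).mul_right
  have iB : ∀ j k, Integrable
      (fun x => f j x * conj (f k x) * conj (dzb j (dz k (cx φ)) x) * ex φ x) μ := by
    intro j k; apply int_cc
    · exact (((f1 j).continuous.mul (Complex.continuous_conj.comp (f1 k).continuous)).mul
        (Complex.continuous_conj.comp (cφ j k))).mul hce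
    · exact ((HasCompactSupport.mul_right (hc j)).mul_right).mul_right
  have iC : ∀ j k, Integrable
      (fun x => dl φ j (f j) x * conj (dl φ k (f k) x) * ex φ x) μ := by
    intro j k; apply int_cc
    · exact ((continuous_dl h1 j (f1 j)).mul
        (Complex.continuous_conj.comp (continuous_dl h1 k (f1 k)))).mul hce
    · exact (HasCompactSupport.mul_right (hcs_of_tsupport (hc j) (tsupport_dl_subset _ _ _))).mul_right
  have tot : ∫ x, ∑ j, ∑ k, dl φ j (f j) x * conj (dl φ k (f k) x) * ex φ x ∂μ
     = ∫ x, ∑ j, ∑ k, dzb k (f j) x * conj (dzb j (f k) x) * ex φ x ∂μ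
      + ∫ x, ∑ j, ∑ k, f j x * conj (f k x) * conj (dzb j (dz k (cx φ)) x) * ex φ x ∂μ := by
    rw [integral_finsetSum _ (fun j _ => integrable_finset_sum _ (fun k _ => iA j k)),
      integral_finsetSum _ (fun j _ => integrable_finset_sum _ (fun k _ => iB j k)),
      integral_finsetSum _ (fun j _ => integrable_finset_sum _ (fun k _ => iC j k)),
      ← Finset.sum_add_distrib]
    refine Finset.sum_congr rfl fun j _ => ?_
    rw [integral_finsetSum _ (fun k _ => iA j k), integral_finsetSum _ (fun k _ => iB j k),
      integral_finsetSum _ (fun k _ => iC j k), ← Finset.sum_add_distrib]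
    exact Finset.sum_congr rfl fun k _ => be_pair μ hφ (hf j) (hf k) (hc j) (hc k) j k
  have iA' := integrable_finset_sum Finset.univ (fun j _ => integrable_finset_sum Finset.univ
    (fun k _ => iA j k))
  have iB' := integrable_finset_sum Finset.univ (fun j _ => integrable_finset_sum Finset.univ
    (fun k _ => iB j k))
  have iC' := integrable_finset_sum Finset.univ (fun j _ => integrable_finset_sum Finset.univ
    (fun k _ => iC j k))
  have tr := congrArg Complex.re tot
  rw [Complex.add_re, re_int μ iA', re_int μ iB', re_int μ iC'] at tr
  have eC : ∀ x, (∑ j, ∑ k, dl φ j (f j) x * conj (dl φ k (f k) x) * ex φ x).re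
      = ‖∑ j, dl φ j (f j) x‖^2 * Real.exp (-φ x) := by
    intro x
    simp_rw [← Finset.sum_mul, ← Finset.mul_sum, ← map_sum, ← Finset.sum_mul]
    rw [Complex.mul_conj, Complex.normSq_eq_norm_sq, ex, ← Complex.ofReal_mul, Complex.ofReal_re]
  have eB : ∀ x, (∑ j, ∑ k, f j x * conj (f k x) * conj (dzb j (dz k (cx φ)) x) * ex φ x).re
      = LeviForm φ x (vec f x) * Real.exp (-φ x) := by
    intro x
    rw [levi_eq hφ]
    simp_rw [← Finset.sum_mul]
    rw [ex, Complex.re_mul_ofReal]; rfl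
  have eA : ∀ x, -(1/2) * ((∑ j, ∑ k, ‖dzb j (f k) x - dzb k (f j) x‖^2) * Real.exp (-φ x))
      ≤ (∑ j, ∑ k, dzb k (f j) x * conj (dzb j (f k) x) * ex φ x).re := by
    intro x
    simp_rw [← Finset.sum_mul]
    rw [ex, Complex.re_mul_ofReal, ← mul_assoc]
    exact mul_le_mul_of_nonneg_right (re_curl (fun j k => dzb j (f k) x)) (Real.exp_pos _).le
  have iD : Integrable (fun x => (∑ j, ∑ k, ‖dzb j (f k) x - dzb k (f j) x‖^2)
      * Real.exp (-φ x)) μ := by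
    refine Continuous.integrable_of_hasCompactSupport ?_ ?_
    · have := fun j k => hcd j k
      have := h1.continuous
      fun_prop
    · have hK : IsCompact (⋃ j, tsupport (f j)) := isCompact_iUnion fun j => hc j
      refine HasCompactSupport.intro hK ?_
      intro x hx
      simp only [mem_iUnion, not_exists] at hx
      simp [dzb_eq_zero _ (hx _)]
  simp_rw [eC, eB] at tr
  have := integral_mono (iD.const_mul (-(1/2))) iA'.re eA
  rw [integral_const_mul] at this
  have h3 : ∫ x, RCLike.re (∑ j, ∑ k, dzb k (f j) x * conj (dzb j (f k) x) * ex φ x) ∂μ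
    = ∫ x, (∑ j, ∑ k, dzb k (f j) x * conj (dzb j (f k) x) * ex φ x).re ∂μ := rfl
  rw [h3] at this
  linarith

end WB

open Set Filter Topology Metric MeasureTheory
open scoped ENNReal NNReal InnerProductSpace ComplexConjugate

namespace WB

variable {N : ℕ}

lemma norm_vec_sq (f : Fin N → EN N → ℂ) (z : EN N) : ‖vec f z‖^2 = ∑ j, ‖f j z‖^2 := by
  rw [EuclideanSpace.norm_sq_eq]; rfl

lemma norm_sum_mul_sq_le (a b : Fin N → ℂ) :
    ‖∑ j, a j * b j‖^2 ≤ (∑ j, ‖a j‖^2) * ∑ j, ‖b j‖^2 := by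
  have h1 : ‖∑ j, a j * b j‖ ≤ ∑ j, ‖a j‖ * ‖b j‖ := by
    refine (norm_sum_le _ _).trans (le_of_eq ?_); simp
  calc ‖∑ j, a j * b j‖^2 ≤ (∑ j, ‖a j‖ * ‖b j‖)^2 := by gcongr
    _ ≤ _ := Finset.sum_mul_sq_le_sq_mul_sq _ _ _

lemma norm_add_sq_le (a b : ℂ) : ‖a + b‖^2 ≤ 2 * ‖a‖^2 + 2 * ‖b‖^2 := by
  have := norm_add_le a b
  nlinarith [sq_nonneg (‖a‖ - ‖b‖), norm_nonneg (a+b), norm_nonneg a, norm_nonneg b]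

lemma dz_cx_sub {φ ψ : EN N → ℝ} {z : EN N} (hφ : DifferentiableAt ℝ φ z)
    (hψ : DifferentiableAt ℝ ψ z) (j : Fin N) :
    dz j (cx (fun x => φ x - ψ x)) z = dz j (cx φ) z - dz j (cx ψ) z := by
  simp only [dz, fderiv_cx hφ, fderiv_cx hψ, fderiv_cx (hφ.fun_sub hψ), fderiv_fun_sub hφ hψ]
  simp; ring

variable (μ : Measure (EN N)) [μ.IsAddHaarMeasure]

/-- The Levi condition for the three-weights estimate. -/
def LeviCond (φ ψ : EN N → ℝ) (z : EN N) : Prop :=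
  ∀ b : EN N, (2 * ∑ j, ‖dz j (cx ψ) z‖^2 + Real.exp (ψ z)) * ‖b‖^2 ≤ LeviForm φ z b

theorem est_test_real {φ ψ : EN N → ℝ} (hφ : ContDiff ℝ 2 φ) (hψ : ContDiff ℝ 2 ψ)
    {f : Fin N → EN N → ℂ} (hf : ∀ j, ContDiff ℝ 2 (f j)) (hc : ∀ j, HasCompactSupport (f j))
    (hL : ∀ z ∈ ⋃ j, tsupport (f j), LeviCond φ ψ z) :
    ∫ x, (∑ j, ‖f j x‖^2) * Real.exp (ψ x - φ x) ∂μ ≤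
      2 * ∫ x, ‖∑ j, dl (fun x => φ x - ψ x) j (f j) x‖^2 * Real.exp (-φ x) ∂μ
      + (1/2) * ∫ x, (∑ j, ∑ k, ‖dzb j (f k) x - dzb k (f j) x‖^2) * Real.exp (-φ x) ∂μ := by
  have hbe := be μ hφ hf hc
  have h1 : ContDiff ℝ 1 φ := hφ.of_le (by norm_num)
  have p1 : ContDiff ℝ 1 ψ := hψ.of_le (by norm_num)
  have f1 : ∀ j, ContDiff ℝ 1 (f j) := fun j => (hf j).of_le (by norm_num)
  have hK : IsCompact (⋃ j, tsupport (f j)) := isCompact_iUnion fun j => hc j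
  have c1 := h1.continuous
  have c2 := p1.continuous
  have c3 := fun j => (f1 j).continuous
  have c4 : ∀ j, Continuous (dz j (cx ψ)) := fun j =>
    (contDiff_dz (n := 1) (m := 0) (contDiff_cx (n := 1) p1) (by norm_num) j).continuous
  have c5 : ∀ j, Continuous (dl φ j (f j)) := fun j => continuous_dl h1 j (f1 j)
  have c6 : ∀ j, Continuous (dl (fun x => φ x - ψ x) j (f j)) := fun j =>
    continuous_dl (h1.sub p1) j (f1 j)
  have z0 : ∀ x, x ∉ ⋃ j, tsupport (f j) → ∀ j, f j x = 0 := by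
    intro x hx j; simp only [mem_iUnion, not_exists] at hx
    exact image_eq_zero_of_notMem_tsupport (hx j)
  have z1 : ∀ x, x ∉ ⋃ j, tsupport (f j) → ∀ φ j, dl φ j (f j) x = 0 := by
    intro x hx φ j; have h0 := z0 x hx j; simp only [mem_iUnion, not_exists] at hx
    simp [dl, dz_eq_zero j (hx j), h0]
  have iP : Integrable (fun x => (∑ j, ‖f j x‖^2) * Real.exp (ψ x - φ x)) μ := by
    refine Continuous.integrable_of_hasCompactSupport (by fun_prop) (HasCompactSupport.intro hK ?_)
    intro x hx; simp [z0 x hx]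
  have iQ : Integrable (fun x => ‖∑ j, dl (fun x => φ x - ψ x) j (f j) x‖^2 * Real.exp (-φ x)) μ := by
    refine Continuous.integrable_of_hasCompactSupport (by fun_prop) (HasCompactSupport.intro hK ?_)
    intro x hx; simp [z1 x hx]
  have iR : Integrable (fun x => (2 * ∑ j, ‖dz j (cx ψ) x‖^2) * (∑ j, ‖f j x‖^2) * Real.exp (-φ x)) μ := by
    refine Continuous.integrable_of_hasCompactSupport (by fun_prop) (HasCompactSupport.intro hK ?_)
    intro x hx; simp [z0 x hx]
  have iS : Integrable (fun x => ‖∑ j, dl φ j (f j) x‖^2 * Real.exp (-φ x)) μ := by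
    refine Continuous.integrable_of_hasCompactSupport (by fun_prop) (HasCompactSupport.intro hK ?_)
    intro x hx; simp [z1 x hx]
  have iL : Integrable (fun x => LeviForm φ x (vec f x) * Real.exp (-φ x)) μ := by
    have ct : Continuous (fun x => LeviForm φ x (vec f x)) := by
      have cH : Continuous (fderiv ℝ (fderiv ℝ φ)) :=
        ((hφ.fderiv_right (m := 1) (by norm_num)).fderiv_right (m := 0) (by norm_num)).continuous
      have cv : Continuous (vec f) := by unfold vec; fun_prop
      unfold LeviForm Hess
      fun_prop
    refine Continuous.integrable_of_hasCompactSupport (by fun_prop) (HasCompactSupport.intro hK ?_)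
    intro x hx
    have : vec f x = 0 := by ext j; simp [vec, z0 x hx]
    simp [this, LeviForm, Hess]
  have m1 : ∫ x, (∑ j, ‖f j x‖^2) * Real.exp (ψ x - φ x) ∂μ
      + ∫ x, (2 * ∑ j, ‖dz j (cx ψ) x‖^2) * (∑ j, ‖f j x‖^2) * Real.exp (-φ x) ∂μ
      ≤ ∫ x, LeviForm φ x (vec f x) * Real.exp (-φ x) ∂μ := by
    rw [← integral_add iP iR]
    refine integral_mono (iP.add iR) iL fun x => ?_
    by_cases hx : x ∈ ⋃ j, tsupport (f j)
    · have := mul_le_mul_of_nonneg_right (hL x hx (vec f x)) (Real.exp_pos (-φ x)).le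
      rw [norm_vec_sq] at this
      refine le_trans (le_of_eq ?_) this
      rw [sub_eq_add_neg, Real.exp_add]; simp only [Pi.add_apply]; ring
    · have : vec f x = 0 := by ext j; simp [vec, z0 x hx]
      simp [this, LeviForm, Hess, z0 x hx]
  have m2 : ∫ x, ‖∑ j, dl φ j (f j) x‖^2 * Real.exp (-φ x) ∂μ
      ≤ 2 * ∫ x, ‖∑ j, dl (fun x => φ x - ψ x) j (f j) x‖^2 * Real.exp (-φ x) ∂μ
      + ∫ x, (2 * ∑ j, ‖dz j (cx ψ) x‖^2) * (∑ j, ‖f j x‖^2) * Real.exp (-φ x) ∂μ := by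
    rw [← integral_const_mul, ← integral_add (iQ.const_mul _) iR]
    refine integral_mono iS ((iQ.const_mul _).add iR) fun x => ?_
    have e : ∑ j, dl φ j (f j) x = ∑ j, dl (fun x => φ x - ψ x) j (f j) x
        + ∑ j, (- dz j (cx ψ) x) * f j x := by
      rw [← Finset.sum_add_distrib]
      refine Finset.sum_congr rfl fun j _ => ?_
      simp only [dl]
      rw [dz_cx_sub (h1.differentiable (by simp) x) (p1.differentiable (by simp) x)]; ring
    have e2 := norm_sum_mul_sq_le (fun j => - dz j (cx ψ) x) (fun j => f j x)
    simp only [norm_neg] at e2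
    have e3 := norm_add_sq_le (∑ j, dl (fun x => φ x - ψ x) j (f j) x)
      (∑ j, (- dz j (cx ψ) x) * f j x)
    rw [← e] at e3
    have := mul_le_mul_of_nonneg_right (e3.trans (add_le_add_right
      (mul_le_mul_of_nonneg_left e2 (by norm_num : (0:ℝ) ≤ 2)) _)) (Real.exp_pos (-φ x)).le
    refine this.trans (le_of_eq ?_)
    ring
  linarith

theorem est_test {φ ψ : EN N → ℝ} (hφ : ContDiff ℝ 2 φ) (hψ : ContDiff ℝ 2 ψ)
    {f : Fin N → EN N → ℂ} (hf : ∀ j, ContDiff ℝ 2 (f j)) (hc : ∀ j, HasCompactSupport (f j))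
    (hL : ∀ z ∈ ⋃ j, tsupport (f j), LeviCond φ ψ z) :
    ∫⁻ x, ENNReal.ofReal ((∑ j, ‖f j x‖^2) * Real.exp (ψ x - φ x)) ∂μ ≤
      ∫⁻ x, ENNReal.ofReal (2 * ‖∑ j, dl (fun x => φ x - ψ x) j (f j) x‖^2 * Real.exp (-φ x)
      + (∑ j, ∑ k, ‖dzb j (f k) x - dzb k (f j) x‖^2) * Real.exp (-φ x)) ∂μ := by
  have h := est_test_real μ hφ hψ hf hc hL
  have h1 : ContDiff ℝ 1 φ := hφ.of_le (by norm_num)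
  have p1 : ContDiff ℝ 1 ψ := hψ.of_le (by norm_num)
  have f1 : ∀ j, ContDiff ℝ 1 (f j) := fun j => (hf j).of_le (by norm_num)
  have hK : IsCompact (⋃ j, tsupport (f j)) := isCompact_iUnion fun j => hc j
  have c1 := h1.continuous
  have c2 := p1.continuous
  have c3 := fun j => (f1 j).continuous
  have c6 : ∀ j, Continuous (dl (fun x => φ x - ψ x) j (f j)) := fun j =>
    continuous_dl (h1.sub p1) j (f1 j)
  have c7 : ∀ j k, Continuous (dzb j (f k)) := fun j k =>
    (contDiff_dzb (n := 1) (m := 0) (f1 k) (by norm_num) j).continuous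
  have z0 : ∀ x, x ∉ ⋃ j, tsupport (f j) → ∀ j, f j x = 0 := by
    intro x hx j; simp only [mem_iUnion, not_exists] at hx
    exact image_eq_zero_of_notMem_tsupport (hx j)
  have z1 : ∀ x, x ∉ ⋃ j, tsupport (f j) → ∀ φ j, dl φ j (f j) x = 0 := by
    intro x hx φ j; have h0 := z0 x hx j; simp only [mem_iUnion, not_exists] at hx
    simp [dl, dz_eq_zero j (hx j), h0]
  have z2 : ∀ x, x ∉ ⋃ j, tsupport (f j) → ∀ j k, dzb j (f k) x = 0 := by
    intro x hx j k; simp only [mem_iUnion, not_exists] at hx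
    exact dzb_eq_zero j (hx k)
  have iP : Integrable (fun x => (∑ j, ‖f j x‖^2) * Real.exp (ψ x - φ x)) μ := by
    refine Continuous.integrable_of_hasCompactSupport (by fun_prop) (HasCompactSupport.intro hK ?_)
    intro x hx; simp [z0 x hx]
  have iQ : Integrable (fun x => 2 * ‖∑ j, dl (fun x => φ x - ψ x) j (f j) x‖^2 * Real.exp (-φ x)) μ := by
    refine Continuous.integrable_of_hasCompactSupport (by fun_prop) (HasCompactSupport.intro hK ?_)
    intro x hx; simp [z1 x hx]
  have iD : Integrable (fun x => (∑ j, ∑ k, ‖dzb j (f k) x - dzb k (f j) x‖^2)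
      * Real.exp (-φ x)) μ := by
    refine Continuous.integrable_of_hasCompactSupport (by fun_prop) (HasCompactSupport.intro hK ?_)
    intro x hx; simp [z2 x hx]
  rw [← ofReal_integral_eq_lintegral_ofReal iP (Eventually.of_forall fun x => by positivity),
    ← ofReal_integral_eq_lintegral_ofReal (f := fun x => _ + _) (iQ.add iD)
      (Eventually.of_forall fun x => by simp only [Pi.zero_apply]; positivity)]
  apply ENNReal.ofReal_le_ofReal
  rw [integral_add iQ iD]
  have e : ∫ x, 2 * ‖∑ j, dl (fun x => φ x - ψ x) j (f j) x‖^2 * Real.exp (-φ x) ∂μ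
     = 2 * ∫ x, ‖∑ j, dl (fun x => φ x - ψ x) j (f j) x‖^2 * Real.exp (-φ x) ∂μ := by
    rw [← integral_const_mul]; simp only [mul_assoc]
  have : 0 ≤ ∫ x, (∑ j, ∑ k, ‖dzb j (f k) x - dzb k (f j) x‖^2) * Real.exp (-φ x) ∂μ :=
    integral_nonneg fun x => by positivity
  rw [e]; linarith

end WB

open Set Filter Topology Metric MeasureTheory
open scoped ENNReal NNReal InnerProductSpace ComplexConjugate

namespace WB
open scoped Convolution
open ContinuousLinearMap (lsmul)

variable {N : ℕ}

/-- standard bumps -/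
noncomputable def bmp (n : ℕ) : ContDiffBump (0 : EN N) where
  rIn := 1 / (2 * ((n:ℝ) + 1))
  rOut := 1 / ((n:ℝ) + 1)
  rIn_pos := by positivity
  rIn_lt_rOut := by
    apply one_div_lt_one_div_of_lt (by positivity)
    have : (0:ℝ) < (n:ℝ) + 1 := by positivity
    linarith

lemma bmp_rOut (n : ℕ) : (bmp (N := N) n).rOut = 1 / ((n:ℝ)+1) := rfl

variable (μ : Measure (EN N)) [μ.IsAddHaarMeasure]

/-- mollification -/
noncomputable def moll (n : ℕ) (h : EN N → ℂ) : EN N → ℂ :=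
  ((bmp n).normed μ ⋆[lsmul ℝ ℝ, μ] h)

lemma moll_apply (n : ℕ) (h : EN N → ℂ) (x : EN N) :
    moll μ n h x = ∫ t, (bmp n).normed μ t • h (x - t) ∂μ := rfl

lemma moll_swap (n : ℕ) (h : EN N → ℂ) (x : EN N) :
    moll μ n h x = ∫ t, (bmp n).normed μ (x - t) • h t ∂μ := by
  unfold moll; rw [convolution_eq_swap]; rfl

lemma moll_congr {n : ℕ} {h h' : EN N → ℂ} (e : h =ᵐ[μ] h') : moll μ n h = moll μ n h' := by
  ext x
  rw [moll_swap, moll_swap]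
  apply integral_congr_ae
  filter_upwards [e] with t ht
  rw [ht]

lemma moll_contDiff (n : ℕ) {h : EN N → ℂ} (hh : LocallyIntegrable h μ) :
    ContDiff ℝ 2 (moll μ n h) :=
  HasCompactSupport.contDiff_convolution_left (n := 2) _ ((bmp n).hasCompactSupport_normed)
    ((bmp n).contDiff_normed) hh

lemma moll_sub (n : ℕ) {h h' : EN N → ℂ} (hh : LocallyIntegrable h μ)
    (hh' : LocallyIntegrable h' μ) (x : EN N) :
    moll μ n (h - h') x = moll μ n h x - moll μ n h' x := by
  have i : ∀ {g : EN N → ℂ}, LocallyIntegrable g μ →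
      Integrable (fun t => (bmp n).normed μ (x - t) • g t) μ := by
    intro g hg
    refine LocallyIntegrable.integrable_smul_left_of_hasCompactSupport hg ?_ ?_
    · exact ((bmp n).continuous_normed).comp (by fun_prop)
    · exact ((bmp n).hasCompactSupport_normed).comp_homeomorph (Homeomorph.subLeft x)
  simp only [moll_swap, Pi.sub_apply, smul_sub]
  rw [integral_sub (i hh) (i hh')]

lemma moll_zero_off (n : ℕ) {h : EN N → ℂ} {K : Set (EN N)} (hK : ∀ x ∉ K, h x = 0) {x : EN N}
    (hx : x ∉ thickening (1 / ((n:ℝ)+1)) K) : moll μ n h x = 0 := by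
  rw [moll_swap]
  rw [integral_eq_zero_of_ae]
  refine Eventually.of_forall fun t => ?_
  by_cases ht : t ∈ K
  · have : (bmp (N := N) n).normed μ (x - t) = 0 := by
      by_contra h0
      have : x - t ∈ Function.support ((bmp (N := N) n).normed μ) := h0
      rw [(bmp n).support_normed_eq, mem_ball_zero_iff, bmp_rOut] at this
      exact hx (mem_thickening_iff.2 ⟨t, ht, by rwa [dist_eq_norm]⟩)
    simp [this]
  · simp [hK t ht]

lemma moll_contr (n : ℕ) {h : EN N → ℂ} (hh : AEStronglyMeasurable h μ) :
    eLpNorm (moll μ n h) 2 μ ≤ eLpNorm h 2 μ := by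
  wlog hm : StronglyMeasurable h generalizing h
  · have := this hh.stronglyMeasurable_mk.aestronglyMeasurable hh.stronglyMeasurable_mk
    rw [moll_congr μ hh.ae_eq_mk, eLpNorm_congr_ae hh.ae_eq_mk]
    exact this
  set b := (bmp (N := N) n).normed μ with hb
  have hbm : Measurable (fun t => ENNReal.ofReal (b t)) :=
    ((bmp n).continuous_normed).measurable.ennreal_ofReal
  set ν := μ.withDensity (fun t => ENNReal.ofReal (b t)) with hν
  have hprob : IsProbabilityMeasure ν := by
    constructor
    rw [hν, withDensity_apply _ MeasurableSet.univ, Measure.restrict_univ,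
      ← ofReal_integral_eq_lintegral_ofReal (bmp n).integrable_normed
        (Eventually.of_forall (bmp n).nonneg_normed), (bmp n).integral_normed]
    simp
  have p2 : ∀ F : EN N → ℂ, ∀ m : Measure (EN N), eLpNorm F 2 m = (∫⁻ x, ‖F x‖ₑ^2 ∂m)^(1/2:ℝ) := by
    intro F m
    rw [eLpNorm_eq_lintegral_rpow_enorm_toReal (by norm_num) (by norm_num)]
    norm_num
  rw [p2, p2]
  apply ENNReal.rpow_le_rpow _ (by norm_num)
  have step : ∀ x, ‖moll μ n h x‖ₑ^2 ≤ ∫⁻ t, ‖h (x - t)‖ₑ^2 ∂ν := by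
    intro x
    have hmx : StronglyMeasurable (fun t => h (x - t)) :=
      hm.comp_measurable (measurable_const.sub measurable_id)
    have s1 : ‖moll μ n h x‖ₑ ≤ ∫⁻ t, ‖h (x - t)‖ₑ ∂ν := by
      rw [moll_apply]
      refine (enorm_integral_le_lintegral_enorm _).trans (le_of_eq ?_)
      rw [hν, lintegral_withDensity_eq_lintegral_mul _ hbm hmx.enorm]
      refine lintegral_congr fun t => ?_
      simp only [Pi.mul_apply, enorm_smul]
      rw [Real.enorm_of_nonneg ((bmp n).nonneg_normed t)]
    have s2 := eLpNorm_le_eLpNorm_of_exponent_le (μ := ν) (p := 1) (q := 2) (by norm_num)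
      hmx.aestronglyMeasurable
    rw [eLpNorm_one_eq_lintegral_enorm, p2] at s2
    have s3 := pow_le_pow_left' (s1.trans s2) 2
    refine s3.trans (le_of_eq ?_)
    rw [← ENNReal.rpow_natCast, ← ENNReal.rpow_mul]; norm_num
  refine (lintegral_mono step).trans (le_of_eq ?_)
  rw [lintegral_lintegral_swap]
  · have : ∀ t, ∫⁻ x, ‖h (x - t)‖ₑ^2 ∂μ = ∫⁻ x, ‖h x‖ₑ^2 ∂μ := fun t =>
      lintegral_sub_right_eq_self (fun x => ‖h x‖ₑ^2) t
    simp_rw [this]; simp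
  · apply Measurable.aemeasurable
    exact (hm.enorm.comp (measurable_fst.sub measurable_snd)).pow_const 2

lemma tendsto_rOut : Tendsto (fun n : ℕ => 1 / ((n:ℝ)+1)) atTop (𝓝 0) :=
  tendsto_one_div_add_atTop_nhds_zero_nat

lemma moll_tendsto {h : EN N → ℂ} (hh : MemLp h 2 μ) :
    Tendsto (fun n => eLpNorm (moll μ n h - h) 2 μ) atTop (𝓝 0) := by
  rw [ENNReal.tendsto_nhds_zero]
  intro ε hε
  by_cases hεt : ε = ⊤
  · simp [hεt]
  obtain ⟨g, gc, gε, gcont, gm⟩ := hh.exists_hasCompactSupport_eLpNorm_sub_le (by norm_num)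
    (ε := ε / 3) (by simp [hε.ne'])
  set K := cthickening 1 (tsupport g) with hK
  have hKc : IsCompact K := gc.cthickening
  have hKm : μ K ≠ ⊤ := hKc.measure_lt_top.ne
  obtain ⟨δ, δ0, hδ⟩ : ∃ δ : ℝ, 0 < δ ∧ μ K ^ (1/2:ℝ) * ENNReal.ofReal δ ≤ ε / 3 := by
    set M := (μ K ^ (1/2:ℝ)) with hM
    have hMt : M ≠ ⊤ := ENNReal.rpow_ne_top_of_nonneg (by norm_num) hKm
    refine ⟨((ε/3) / (M + 1)).toReal, ?_, ?_⟩
    · apply ENNReal.toReal_pos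
      · simp [hε.ne', hMt, ENNReal.div_eq_zero_iff]
      · exact ENNReal.div_ne_top (ENNReal.div_ne_top hεt (by norm_num)) (by simp)
    · rw [ENNReal.ofReal_toReal (ENNReal.div_ne_top (ENNReal.div_ne_top hεt (by norm_num)) (by simp))]
      calc M * (ε/3/(M+1)) ≤ (M+1) * (ε/3/(M+1)) := by gcongr; exact le_self_add
        _ ≤ ε/3 := ENNReal.mul_div_le
  have huc : UniformContinuous g := gc.uniformContinuous_of_continuous gcont
  obtain ⟨η, η0, hη⟩ := Metric.uniformContinuous_iff.1 huc δ δ0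
  have ev : ∀ᶠ n : ℕ in atTop, 1 / ((n:ℝ)+1) < η := tendsto_rOut.eventually (gt_mem_nhds η0)
  filter_upwards [ev] with n hn
  have b1 : ∀ x, ‖moll μ n g x - g x‖ ≤ δ := by
    intro x
    rw [← dist_eq_norm]
    refine ContDiffBump.dist_normed_convolution_le gcont.aestronglyMeasurable ?_
    intro y hy
    rw [mem_ball, bmp_rOut] at hy
    exact (hη (hy.trans hn)).le
  have b2 : ∀ x ∉ K, moll μ n g x - g x = 0 := by
    intro x hx
    have hx1 : x ∉ tsupport g := fun h => hx (self_subset_cthickening _ h)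
    rw [image_eq_zero_of_notMem_tsupport hx1, sub_zero]
    refine moll_zero_off μ n (K := tsupport g) (fun x hx => image_eq_zero_of_notMem_tsupport hx) ?_
    intro h
    apply hx
    refine thickening_subset_cthickening _ _ (thickening_mono ?_ _ h)
    rw [div_le_one (by positivity)]; linarith [(Nat.cast_nonneg n : (0:ℝ) ≤ n)]
  have lg : LocallyIntegrable g μ := gm.locallyIntegrable (by norm_num)
  have lh : LocallyIntegrable h μ := hh.locallyIntegrable (by norm_num)
  have cm : Continuous (moll μ n g) := (moll_contDiff μ n lg).continuous
  have ch : Continuous (moll μ n h) := (moll_contDiff μ n lh).continuous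
  have b3 : eLpNorm (moll μ n g - g) 2 μ ≤ ε / 3 := by
    have e : eLpNorm (moll μ n g - g) 2 μ = eLpNorm (moll μ n g - g) 2 (μ.restrict K) := by
      rw [eLpNorm_restrict_eq_of_support_subset]
      intro x hx; by_contra h; exact hx (b2 x h)
    rw [e]
    refine (eLpNorm_le_of_ae_bound (C := δ) (Eventually.of_forall b1)).trans ?_
    simpa using hδ
  have e : moll μ n h - h = (moll μ n (h - g) + (moll μ n g - g)) + (g - h) := by
    ext x; simp only [Pi.add_apply, Pi.sub_apply, moll_sub μ n lh lg]; ring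
  have ch2 : Continuous (moll μ n (h - g)) := (moll_contDiff μ n (lh.sub lg)).continuous
  rw [e]
  calc _ ≤ eLpNorm (moll μ n (h - g) + (moll μ n g - g)) 2 μ + eLpNorm (g - h) 2 μ :=
        eLpNorm_add_le (ch2.add (cm.sub gcont)).aestronglyMeasurable
          (gm.1.sub hh.1) (by norm_num)
    _ ≤ eLpNorm (moll μ n (h - g)) 2 μ + eLpNorm (moll μ n g - g) 2 μ + eLpNorm (g - h) 2 μ := by
        gcongr
        exact eLpNorm_add_le ch2.aestronglyMeasurable (cm.sub gcont).aestronglyMeasurable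
          (by norm_num)
    _ ≤ ε / 3 + ε / 3 + ε / 3 := by
        gcongr
        · exact (moll_contr μ n (hh.1.sub gm.1)).trans gε
        · rw [eLpNorm_sub_comm]; exact gε
    _ = ε := ENNReal.add_thirds ε

lemma lint_moll_tendsto {h : EN N → ℂ} (hh : MemLp h 2 μ) :
    Tendsto (fun n => ∫⁻ x, ENNReal.ofReal (‖moll μ n h x - h x‖^2) ∂μ) atTop (𝓝 0) := by
  have h1 := (ENNReal.continuous_pow 2).tendsto 0 |>.comp (moll_tendsto μ hh)
  simp only [Function.comp_def] at h1
  rw [zero_pow (by norm_num)] at h1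
  refine h1.congr fun n => ?_
  rw [eLpNorm_eq_lintegral_rpow_enorm_toReal (by norm_num) (by norm_num), ← ENNReal.rpow_natCast,
    ← ENNReal.rpow_mul]
  norm_num

/-- derivative of the mollification -/
lemma fderiv_moll (n : ℕ) {h : EN N → ℂ} (hh : LocallyIntegrable h μ) (x v : EN N) :
    fderiv ℝ (moll μ n h) x v = ∫ t, (fderiv ℝ ((bmp n).normed μ) (x - t) v : ℝ) • h t ∂μ := by
  have hs := (bmp (N := N) n).hasCompactSupport_normed (μ := μ)
  have hd : ContDiff ℝ 1 ((bmp (N := N) n).normed μ) := (bmp n).contDiff_normed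
  have := HasCompactSupport.hasFDerivAt_convolution_left (L := lsmul ℝ ℝ) (μ := μ) hs hd hh x
  have e : fderiv ℝ (moll μ n h) x = _ := this.fderiv
  rw [e, convolution_eq_swap, ContinuousLinearMap.integral_apply]
  · rfl
  · have hc : ConvolutionExistsAt (fderiv ℝ ((bmp (N := N) n).normed μ)) h x
        ((lsmul ℝ ℝ : ℝ →L[ℝ] ℂ →L[ℝ] ℂ).precompL (EN N)) μ :=
      (hs.fderiv (𝕜 := ℝ)).convolutionExists_left _ (hd.continuous_fderiv (by simp)) hh x
    exact hc.integrable_swap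

end WB

open Set Filter Topology Metric MeasureTheory
open scoped ENNReal NNReal InnerProductSpace ComplexConjugate

namespace WB

variable {N : ℕ} (μ : Measure (EN N)) [μ.IsAddHaarMeasure]

/-- the mollifier kernel as a test function -/
noncomputable def kx (n : ℕ) (x t : EN N) : ℂ := (((bmp n).normed μ (x - t) : ℝ) : ℂ)

lemma kx_contDiff (n : ℕ) (x : EN N) : ContDiff ℝ 2 (kx μ n x) := by
  have : ContDiff ℝ 2 (fun t => (bmp (N := N) n).normed μ (x - t)) :=
    ((bmp n).contDiff_normed).comp (contDiff_const.sub contDiff_id)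
  exact Complex.ofRealCLM.contDiff.comp this

lemma kx_hcs (n : ℕ) (x : EN N) : HasCompactSupport (kx μ n x) := by
  have : HasCompactSupport (fun t => (bmp (N := N) n).normed μ (x - t)) :=
    ((bmp n).hasCompactSupport_normed).comp_homeomorph (Homeomorph.subLeft x)
  exact this.comp_left (g := fun r : ℝ => (r : ℂ)) (by simp)

lemma fderiv_kx (n : ℕ) (x t v : EN N) :
    fderiv ℝ (kx μ n x) t v = - ((fderiv ℝ ((bmp n).normed μ) (x - t) v : ℝ) : ℂ) := by
  have hd : DifferentiableAt ℝ ((bmp (N := N) n).normed μ) (x - t) :=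
    ((bmp n).contDiff_normed (n := 1)).differentiable (by simp) _
  have h1 : HasFDerivAt (fun t => x - t) (-ContinuousLinearMap.id ℝ (EN N)) t :=
    (hasFDerivAt_id t).const_sub x
  have h2 := hd.hasFDerivAt.comp t h1
  have h3 := Complex.ofRealCLM.hasFDerivAt.comp t h2
  have e : fderiv ℝ (kx μ n x) t = _ := h3.fderiv
  rw [e]; simp

lemma int_mul_test {h g : EN N → ℂ} (hh : LocallyIntegrable h μ) (hg : Continuous g)
    (hc : HasCompactSupport g) : Integrable (fun t => h t * g t) μ := by
  have := LocallyIntegrable.integrable_smul_left_of_hasCompactSupport hh hg hc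
  refine this.congr (Eventually.of_forall fun t => ?_)
  simp [mul_comm]

lemma fderiv_moll' (n : ℕ) {h : EN N → ℂ} (hh : LocallyIntegrable h μ) (x v : EN N) :
    fderiv ℝ (moll μ n h) x v = - ∫ t, h t * fderiv ℝ (kx μ n x) t v ∂μ := by
  rw [fderiv_moll μ n hh, ← integral_neg]
  congr 1; ext t
  rw [fderiv_kx]; simp [mul_comm]

lemma int_mul_fd {h g : EN N → ℂ} (hh : LocallyIntegrable h μ) (hg : ContDiff ℝ 1 g)
    (hc : HasCompactSupport g) (v : EN N) : Integrable (fun t => h t * fderiv ℝ g t v) μ :=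
  int_mul_test μ hh (contDiff_fderiv_apply (n := 1) (m := 0) hg (by simp) v).continuous
    (hcs_of_tsupport hc (tsupport_fderiv_apply_subset' g v))

lemma dz_moll (n : ℕ) {h : EN N → ℂ} (hh : LocallyIntegrable h μ) (x : EN N) (j : Fin N) :
    dz j (moll μ n h) x = - ∫ t, h t * dz j (kx μ n x) t ∂μ := by
  have i := fun v => int_mul_fd μ hh ((kx_contDiff μ n x).of_le (by norm_num)) (kx_hcs μ n x) v
  have e : ∀ t, h t * dz j (kx μ n x) t = (1/2) * (h t * fderiv ℝ (kx μ n x) t (eb j))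
    - (Complex.I/2) * (h t * fderiv ℝ (kx μ n x) t (Complex.I • eb j)) := fun t => by
      simp only [dz]; ring
  simp_rw [e]
  rw [integral_sub ((i _).const_mul _) ((i _).const_mul _), integral_const_mul, integral_const_mul]
  simp only [dz, fderiv_moll' μ n hh]; ring

lemma dzb_moll (n : ℕ) {h : EN N → ℂ} (hh : LocallyIntegrable h μ) (x : EN N) (j : Fin N) :
    dzb j (moll μ n h) x = - ∫ t, h t * dzb j (kx μ n x) t ∂μ := by
  have i := fun v => int_mul_fd μ hh ((kx_contDiff μ n x).of_le (by norm_num)) (kx_hcs μ n x) v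
  have e : ∀ t, h t * dzb j (kx μ n x) t = (1/2) * (h t * fderiv ℝ (kx μ n x) t (eb j))
    + (Complex.I/2) * (h t * fderiv ℝ (kx μ n x) t (Complex.I • eb j)) := fun t => by
      simp only [dzb]; ring
  simp_rw [e]
  rw [integral_add ((i _).const_mul _) ((i _).const_mul _), integral_const_mul, integral_const_mul]
  simp only [dzb, fderiv_moll' μ n hh]; ring

lemma moll_eq_kx (n : ℕ) (m : EN N → ℂ) (x : EN N) :
    moll μ n m x = ∫ t, m t * kx μ n x t ∂μ := by
  rw [moll_swap]; congr 1; ext t; simp [kx, mul_comm]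

lemma moll_hcs (n : ℕ) {h : EN N → ℂ} {K : Set (EN N)} (hK : IsCompact K)
    (h0 : ∀ x ∉ K, h x = 0) : HasCompactSupport (moll μ n h) := by
  refine HasCompactSupport.intro (hK.cthickening (r := 1/((n:ℝ)+1))) fun x hx => ?_
  exact moll_zero_off μ n h0 fun h => hx (thickening_subset_cthickening _ _ h)

lemma tsupport_moll (n : ℕ) {h : EN N → ℂ} {K : Set (EN N)}
    (h0 : ∀ x ∉ K, h x = 0) : tsupport (moll μ n h) ⊆ cthickening (1/((n:ℝ)+1)) K := by
  refine closure_minimal ?_ isClosed_cthickening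
  intro x hx; by_contra h
  exact hx (moll_zero_off μ n h0 fun h' => h (thickening_subset_cthickening _ _ h'))

lemma sum_add_sq (a b : Fin N → ℂ) : ∑ j, ‖a j‖^2 ≤ 2 * ∑ j, ‖b j‖^2 + 2 * ∑ j, ‖b j - a j‖^2 := by
  rw [Finset.mul_sum, Finset.mul_sum, ← Finset.sum_add_distrib]
  refine Finset.sum_le_sum fun j _ => ?_
  have := norm_add_sq_le (b j) (-(b j - a j))
  simpa [norm_sub_rev] using this

theorem est_cpt {φ ψ : EN N → ℝ} (hφ : ContDiff ℝ 2 φ) (hψ : ContDiff ℝ 2 ψ)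
    {K U : Set (EN N)} (hK : IsCompact K) (hU : IsOpen U) (hKU : K ⊆ U)
    (hL : ∀ z ∈ U, LeviCond φ ψ z)
    {h : Fin N → EN N → ℂ} {m : EN N → ℂ} {r : Fin N → Fin N → EN N → ℂ}
    (hh : ∀ j, MemLp (h j) 2 μ) (hm : MemLp m 2 μ) (hr : ∀ j k, MemLp (r j k) 2 μ)
    (h0 : ∀ j, ∀ x ∉ K, h j x = 0) (m0 : ∀ x ∉ K, m x = 0) (r0 : ∀ j k, ∀ x ∉ K, r j k x = 0)
    (hdiv : ∀ g : EN N → ℂ, ContDiff ℝ 2 g → HasCompactSupport g →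
      ∑ j, ∫ x, h j x * dz j g x ∂μ = - ∫ x, m x * g x ∂μ)
    (hcurl : ∀ g : EN N → ℂ, ContDiff ℝ 2 g → HasCompactSupport g → ∀ j k,
      ∫ x, h k x * dzb j g x ∂μ - ∫ x, h j x * dzb k g x ∂μ = - ∫ x, r j k x * g x ∂μ) :
    ∫⁻ x, ENNReal.ofReal ((∑ j, ‖h j x‖^2) * Real.exp (ψ x - φ x)) ∂μ ≤
    ∫⁻ x, ENNReal.ofReal (8 * ‖m x - ∑ j, dz j (cx (fun x => φ x - ψ x)) x * h j x‖^2
      * Real.exp (-φ x) + 4 * (∑ j, ∑ k, ‖r j k x‖^2) * Real.exp (-φ x)) ∂μ := by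
  set K1 := cthickening 1 K with hK1
  have hK1c : IsCompact K1 := hK.cthickening
  have h1 : ContDiff ℝ 1 φ := hφ.of_le (by norm_num)
  have p1 : ContDiff ℝ 1 ψ := hψ.of_le (by norm_num)
  have cφ := h1.continuous
  have cψ := p1.continuous
  set c := fun j => dz j (cx (fun x => φ x - ψ x)) with hc
  have cc : ∀ j, Continuous (c j) := fun j =>
    (contDiff_dz (n := 1) (m := 0) (contDiff_cx (n := 1) (h1.sub p1)) (by norm_num) j).continuous
  obtain ⟨M, M0, hM1, hM2, hM3⟩ : ∃ M : ℝ, 0 ≤ M ∧ (∀ x ∈ K1, Real.exp (ψ x - φ x) ≤ M) ∧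
      (∀ x ∈ K1, Real.exp (-φ x) ≤ M) ∧ (∀ x ∈ K1, ∑ j, ‖c j x‖^2 ≤ M) := by
    have cont : Continuous (fun x => Real.exp (ψ x - φ x) + Real.exp (-φ x) + ∑ j, ‖c j x‖^2) := by
      fun_prop
    obtain ⟨M, hM⟩ := hK1c.exists_bound_of_continuousOn cont.continuousOn
    have hM' : ∀ x ∈ K1, Real.exp (ψ x - φ x) + Real.exp (-φ x) + ∑ j, ‖c j x‖^2 ≤ max M 0 :=
      fun x hx => ((Real.le_norm_self _).trans (hM x hx)).trans (le_max_left _ _)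
    have q : ∀ x, 0 ≤ ∑ j, ‖c j x‖^2 := fun x => by positivity
    refine ⟨max M 0, le_max_right _ _, fun x hx => ?_, fun x hx => ?_, fun x hx => ?_⟩ <;>
    · have := hM' x hx
      linarith [q x, Real.exp_pos (ψ x - φ x), Real.exp_pos (-φ x)]
  have lh : ∀ j, LocallyIntegrable (h j) μ := fun j => (hh j).locallyIntegrable (by norm_num)
  have lm : LocallyIntegrable m μ := hm.locallyIntegrable (by norm_num)
  have lr : ∀ j k, LocallyIntegrable (r j k) μ := fun j k => (hr j k).locallyIntegrable (by norm_num)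
  set E : ℕ → EN N → ℝ := fun n x => ∑ j, ‖moll μ n (h j) x - h j x‖^2 + ‖moll μ n m x - m x‖^2
    + ∑ j, ∑ k, ‖moll μ n (r j k) x - r j k x‖^2 with hE
  have E0 : ∀ n x, 0 ≤ E n x := fun n x => by simp only [hE]; positivity
  have ms : ∀ (u : EN N → ℂ) n, MemLp u 2 μ →
      AEMeasurable (fun x => ENNReal.ofReal (‖moll μ n u x - u x‖^2)) μ := by
    intro u n hu
    have cu : Continuous (moll μ n u) := (moll_contDiff μ n (hu.locallyIntegrable (by norm_num))).continuous
    exact (((cu.aestronglyMeasurable.sub hu.1).norm.pow 2).aemeasurable).ennreal_ofReal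
  have Elim : Tendsto (fun n => ∫⁻ x, ENNReal.ofReal (E n x) ∂μ) atTop (𝓝 0) := by
    have e : ∀ n, ∫⁻ x, ENNReal.ofReal (E n x) ∂μ =
      ∑ j, ∫⁻ x, ENNReal.ofReal (‖moll μ n (h j) x - h j x‖^2) ∂μ
      + ∫⁻ x, ENNReal.ofReal (‖moll μ n m x - m x‖^2) ∂μ
      + ∑ j, ∑ k, ∫⁻ x, ENNReal.ofReal (‖moll μ n (r j k) x - r j k x‖^2) ∂μ := by
      intro n
      rw [← lintegral_finsetSum' _ (fun j _ => ms _ n (hh j))]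
      rw [Finset.sum_congr rfl fun j _ => (lintegral_finsetSum' (μ := μ) Finset.univ
        (fun k _ => ms _ n (hr j k))).symm]
      rw [← lintegral_finsetSum' _ (fun j _ => Finset.aemeasurable_fun_sum _ fun k _ => ms _ n (hr j k))]
      rw [← lintegral_add_right' _ (ms _ n hm), ← lintegral_add_right' _
        (Finset.aemeasurable_fun_sum _ fun j _ => Finset.aemeasurable_fun_sum _ fun k _ => ms _ n (hr j k))]
      refine lintegral_congr fun x => ?_
      simp only [hE]
      rw [ENNReal.ofReal_add (by positivity) (by positivity), ENNReal.ofReal_add (by positivity)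
        (by positivity), ENNReal.ofReal_sum_of_nonneg (fun _ _ => by positivity),
        ENNReal.ofReal_sum_of_nonneg (fun _ _ => by positivity)]
      congr 1
      refine Finset.sum_congr rfl fun j _ => ?_
      rw [ENNReal.ofReal_sum_of_nonneg (fun _ _ => by positivity)]
    simp_rw [e]
    have t1 := tendsto_finsetSum (Finset.univ) (fun j (_ : j ∈ Finset.univ) => lint_moll_tendsto μ (hh j))
    have t2 := tendsto_finsetSum (Finset.univ) (fun j (_ : j ∈ Finset.univ) =>
      tendsto_finsetSum (Finset.univ) (fun k (_ : k ∈ Finset.univ) => lint_moll_tendsto μ (hr j k)))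
    have := (t1.add (lint_moll_tendsto μ hm)).add t2
    simpa using this
  set C : ℝ := 2*M + 2 * (8*(1+M)*M + 2*M) with hC
  have C0 : 0 ≤ C := by positivity
  set Q : EN N → ℝ := fun x => 8 * ‖m x - ∑ j, c j x * h j x‖^2
      * Real.exp (-φ x) + 4 * (∑ j, ∑ k, ‖r j k x‖^2) * Real.exp (-φ x) with hQ
  have Q0 : ∀ x, 0 ≤ Q x := fun x => by simp only [hQ]; positivity
  change _ ≤ ∫⁻ x, ENNReal.ofReal (Q x) ∂μ
  have main : ∀ᶠ n : ℕ in atTop, ∫⁻ x, ENNReal.ofReal ((∑ j, ‖h j x‖^2) * Real.exp (ψ x - φ x)) ∂μ ≤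
      ∫⁻ x, ENNReal.ofReal (Q x) ∂μ + ENNReal.ofReal C * ∫⁻ x, ENNReal.ofReal (E n x) ∂μ := by
    obtain ⟨δ, δ0, hδ⟩ := hK.exists_cthickening_subset_open hU hKU
    filter_upwards [tendsto_rOut.eventually (gt_mem_nhds δ0)] with n hn
    set f : Fin N → EN N → ℂ := fun j => moll μ n (h j) with hf
    have fC : ∀ j, ContDiff ℝ 2 (f j) := fun j => moll_contDiff μ n (lh j)
    have ffC := fun j => (fC j).continuous
    have fS : ∀ j, HasCompactSupport (f j) := fun j => moll_hcs μ n hK (h0 j)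
    have hLf : ∀ z ∈ ⋃ j, tsupport (f j), LeviCond φ ψ z := by
      intro z hz
      obtain ⟨j, hj⟩ := mem_iUnion.1 hz
      exact hL z (hδ (cthickening_mono hn.le _ (tsupport_moll μ n (h0 j) hj)))
    have est := est_test μ hφ hψ fC fS hLf
    have ediv : ∀ x, ∑ j, dl (fun x => φ x - ψ x) j (f j) x = moll μ n m x - ∑ j, c j x * f j x := by
      intro x
      simp only [dl, Finset.sum_sub_distrib]
      congr 1
      simp only [hf, dz_moll μ n (lh _), Finset.sum_neg_distrib]
      rw [hdiv _ (kx_contDiff μ n x) (kx_hcs μ n x), moll_eq_kx]; ring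
    have ecurl : ∀ x j k, dzb j (f k) x - dzb k (f j) x = moll μ n (r j k) x := by
      intro x j k
      simp only [hf, dzb_moll μ n (lh _)]
      rw [moll_eq_kx]
      have := hcurl _ (kx_contDiff μ n x) (kx_hcs μ n x) j k
      linear_combination -this
    simp_rw [ediv, ecurl] at est
    have hn1 : 1/((n:ℝ)+1) ≤ 1 := by
      rw [div_le_one (by positivity)]; linarith [(Nat.cast_nonneg n : (0:ℝ) ≤ n)]
    have off : ∀ {u : EN N → ℂ}, (∀ x ∉ K, u x = 0) → ∀ x ∉ K1, moll μ n u x = 0 := by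
      intro u hu x hx
      exact moll_zero_off μ n hu fun h => hx (thickening_subset_cthickening _ _ (thickening_mono hn1 _ h))
    have offK : ∀ x ∉ K1, x ∉ K := fun x hx h => hx (self_subset_cthickening _ h)
    have pa : ∀ x, (∑ j, ‖h j x‖^2) * Real.exp (ψ x - φ x) ≤
        2 * ((∑ j, ‖f j x‖^2) * Real.exp (ψ x - φ x)) + (2 * M) * E n x := by
      intro x
      by_cases hx : x ∈ K1
      · have s := sum_add_sq (fun j => h j x) (fun j => f j x)
        have s2 : ∑ j, ‖f j x - h j x‖^2 ≤ E n x := by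
          simp only [hE, hf]
          have : 0 ≤ ∑ j, ∑ k, ‖moll μ n (r j k) x - r j k x‖^2 := by positivity
          have : 0 ≤ ‖moll μ n m x - m x‖^2 := by positivity
          linarith
        have s3 := mul_le_mul_of_nonneg_right s (Real.exp_pos (ψ x - φ x)).le
        have s4 : (∑ j, ‖f j x - h j x‖^2) * Real.exp (ψ x - φ x) ≤ E n x * M :=
          mul_le_mul s2 (hM1 x hx) (Real.exp_pos _).le (E0 n x)
        nlinarith
      · have hz : ∀ j, h j x = 0 := fun j => h0 j x (offK x hx)
        have : 0 ≤ (2 * M) * E n x := mul_nonneg (by positivity) (E0 n x)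
        simp only [hz]; simp; positivity
    have pb : ∀ x, 2 * ‖moll μ n m x - ∑ j, c j x * f j x‖^2 * Real.exp (-φ x)
        + (∑ j, ∑ k, ‖moll μ n (r j k) x‖^2) * Real.exp (-φ x)
        ≤ (1/2) * Q x + (8*(1+M)*M + 2*M) * E n x := by
      intro x
      by_cases hx : x ∈ K1
      · have t1 : ∑ j, ‖f j x - h j x‖^2 + ‖moll μ n m x - m x‖^2 ≤ E n x := by
          simp only [hE, hf]
          have : 0 ≤ ∑ j, ∑ k, ‖moll μ n (r j k) x - r j k x‖^2 := by positivity
          linarith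
        have t2 : ∑ j, ∑ k, ‖moll μ n (r j k) x - r j k x‖^2 ≤ E n x := by
          simp only [hE]
          have : 0 ≤ ∑ j, ‖moll μ n (h j) x - h j x‖^2 := by positivity
          have : 0 ≤ ‖moll μ n m x - m x‖^2 := by positivity
          linarith
        have e1 : moll μ n m x - ∑ j, c j x * f j x = (m x - ∑ j, c j x * h j x)
            + ((moll μ n m x - m x) + - ∑ j, c j x * (f j x - h j x)) := by
          simp only [mul_sub, Finset.sum_sub_distrib]; ring
        have s1 := norm_add_sq_le (m x - ∑ j, c j x * h j x)
          ((moll μ n m x - m x) + - ∑ j, c j x * (f j x - h j x))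
        have s2 := norm_add_sq_le (moll μ n m x - m x) (- ∑ j, c j x * (f j x - h j x))
        rw [norm_neg] at s2
        have s3 := norm_sum_mul_sq_le (fun j => c j x) (fun j => f j x - h j x)
        have s4 : (∑ j, ‖c j x‖^2) * ∑ j, ‖f j x - h j x‖^2 ≤ M * E n x :=
          mul_le_mul (hM3 x hx) (by linarith [sq_nonneg ‖moll μ n m x - m x‖]) (by positivity) M0
        have s5 : ‖moll μ n m x - m x‖^2 ≤ E n x := by
          have : 0 ≤ ∑ j, ‖f j x - h j x‖^2 := by positivity
          linarith
        rw [← e1] at s1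
        have s6 : ‖moll μ n m x - ∑ j, c j x * f j x‖^2 ≤
          2 * ‖m x - ∑ j, c j x * h j x‖^2 + 4 * (1 + M) * E n x := by linarith
        have s7 : ∑ j, ∑ k, ‖moll μ n (r j k) x‖^2 ≤ 2 * ∑ j, ∑ k, ‖r j k x‖^2 + 2 * E n x := by
          have : ∑ j, ∑ k, ‖moll μ n (r j k) x‖^2 ≤ 2 * ∑ j, ∑ k, ‖r j k x‖^2
              + 2 * ∑ j, ∑ k, ‖moll μ n (r j k) x - r j k x‖^2 := by
            rw [Finset.mul_sum, Finset.mul_sum, ← Finset.sum_add_distrib]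
            refine Finset.sum_le_sum fun j _ => ?_
            have := sum_add_sq (fun k => moll μ n (r j k) x) (fun k => r j k x)
            simp only [norm_sub_rev (r j _ x)] at this
            exact this
          linarith
        have w0 := (Real.exp_pos (-φ x)).le
        have v6 := mul_le_mul_of_nonneg_right s6 w0
        have v7 := mul_le_mul_of_nonneg_right s7 w0
        have v8 : E n x * Real.exp (-φ x) ≤ E n x * M := mul_le_mul_of_nonneg_left (hM2 x hx) (E0 n x)
        have v9 : (4 * (1 + M)) * (E n x * Real.exp (-φ x)) ≤ (4 * (1+M)) * (E n x * M) :=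
          mul_le_mul_of_nonneg_left v8 (by positivity)
        simp only [hQ]
        linarith
      · have z1 := off m0 x hx
        have z2 : ∀ j, f j x = 0 := fun j => off (h0 j) x hx
        have z3 : ∀ j k, moll μ n (r j k) x = 0 := fun j k => off (r0 j k) x hx
        have : 0 ≤ (8*(1+M)*M + 2*M) * E n x := mul_nonneg (by positivity) (E0 n x)
        simp only [z1, z2, z3]; simp
        linarith [Q0 x]
    have mP : Measurable (fun x => ENNReal.ofReal ((∑ j, ‖f j x‖^2) * Real.exp (ψ x - φ x))) := by
      have : Continuous (fun x => (∑ j, ‖f j x‖^2) * Real.exp (ψ x - φ x)) := by fun_prop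
      exact this.measurable.ennreal_ofReal
    have mQ : AEMeasurable (fun x => ENNReal.ofReal (Q x)) μ := by
      apply AEMeasurable.ennreal_ofReal
      have a1 : AEMeasurable (fun x => m x - ∑ j, c j x * h j x) μ :=
        hm.1.aemeasurable.sub (Finset.aemeasurable_fun_sum _ fun j _ =>
          (cc j).aemeasurable.mul (hh j).1.aemeasurable)
      have a2 : AEMeasurable (fun x => ∑ j, ∑ k, ‖r j k x‖^2) μ :=
        Finset.aemeasurable_fun_sum _ fun j _ => Finset.aemeasurable_fun_sum _ fun k _ =>
          (hr j k).1.aemeasurable.norm.pow_const 2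
      have a3 : AEMeasurable (fun x => Real.exp (-φ x)) μ := by
        have : Continuous (fun x => Real.exp (-φ x)) := by fun_prop
        exact this.aemeasurable
      exact (((a1.norm.pow_const 2).const_mul 8).mul a3).add ((a2.const_mul 4).mul a3)
    calc _ ≤ ∫⁻ x, (2 * ENNReal.ofReal ((∑ j, ‖f j x‖^2) * Real.exp (ψ x - φ x))
            + ENNReal.ofReal (2*M) * ENNReal.ofReal (E n x)) ∂μ := by
          refine lintegral_mono fun x => ?_
          refine (ENNReal.ofReal_le_ofReal (pa x)).trans (le_of_eq ?_)
          rw [ENNReal.ofReal_add (by positivity) (mul_nonneg (by positivity) (E0 n x)),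
            ENNReal.ofReal_mul (p := 2) (by norm_num), ENNReal.ofReal_mul (p := 2*M) (by positivity),
            ENNReal.ofReal_ofNat]
      _ = 2 * ∫⁻ x, ENNReal.ofReal ((∑ j, ‖f j x‖^2) * Real.exp (ψ x - φ x)) ∂μ
            + ENNReal.ofReal (2*M) * ∫⁻ x, ENNReal.ofReal (E n x) ∂μ := by
          rw [lintegral_add_left (mP.const_mul 2), lintegral_const_mul _ mP,
            lintegral_const_mul' _ _ ENNReal.ofReal_ne_top]
      _ ≤ 2 * (∫⁻ x, (ENNReal.ofReal (1/2) * ENNReal.ofReal (Q x)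
            + ENNReal.ofReal (8*(1+M)*M + 2*M) * ENNReal.ofReal (E n x)) ∂μ)
            + ENNReal.ofReal (2*M) * ∫⁻ x, ENNReal.ofReal (E n x) ∂μ := by
          refine add_le_add (mul_le_mul' le_rfl (est.trans (lintegral_mono fun x => ?_))) le_rfl
          refine (ENNReal.ofReal_le_ofReal (pb x)).trans (le_of_eq ?_)
          rw [ENNReal.ofReal_add (by linarith [Q0 x]) (mul_nonneg (by positivity) (E0 n x)),
            ENNReal.ofReal_mul (p := 1/2) (by norm_num),
            ENNReal.ofReal_mul (p := 8*(1+M)*M + 2*M) (by positivity)]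
      _ = _ := by
          rw [lintegral_add_left' (mQ.const_mul _), lintegral_const_mul'' _ mQ,
            lintegral_const_mul' _ _ ENNReal.ofReal_ne_top, mul_add, ← mul_assoc, ← mul_assoc]
          have e1 : (2:ℝ≥0∞) * ENNReal.ofReal (1/2) = 1 := by
            rw [show (2:ℝ≥0∞) = ENNReal.ofReal 2 by simp, ← ENNReal.ofReal_mul (by norm_num)]; norm_num
          rw [e1, one_mul, add_assoc, ← add_mul]
          congr 2
          rw [show (2:ℝ≥0∞) = ENNReal.ofReal 2 by simp, ← ENNReal.ofReal_mul (by norm_num),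
            ← ENNReal.ofReal_add (by positivity) (by positivity)]
          congr 1; rw [hC]; ring
  refine ge_of_tendsto ?_ main
  have := (ENNReal.Tendsto.const_mul Elim (Or.inr (ENNReal.ofReal_ne_top (r := C)))).const_add
    (∫⁻ x, ENNReal.ofReal (Q x) ∂μ)
  simpa using this

end WB

open Set Filter Topology Metric MeasureTheory
open scoped ENNReal NNReal InnerProductSpace ComplexConjugate

namespace WB

variable {N : ℕ} (μ : Measure (EN N)) [μ.IsAddHaarMeasure]

lemma memLp_mul_cc {f g : EN N → ℂ} (hf : MemLp f 2 μ) (hg : Continuous g)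
    (hc : HasCompactSupport g) : MemLp (fun x => f x * g x) 2 μ := by
  obtain ⟨M, hM⟩ := hg.bounded_above_of_compact_support hc
  refine MemLp.of_le_mul (c := M) hf (hf.1.mul hg.aestronglyMeasurable) (Eventually.of_forall fun x => ?_)
  rw [norm_mul, mul_comm]
  exact mul_le_mul_of_nonneg_right (hM x) (norm_nonneg _)

lemma int_mul_cc {f g : EN N → ℂ} (hf : MemLp f 2 μ) (hg : Continuous g)
    (hc : HasCompactSupport g) : Integrable (fun x => f x * g x) μ :=
  int_mul_test μ (hf.locallyIntegrable (by norm_num)) hg hc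

lemma memLp_coord {b : EN N → EN N} (hb : MemLp b 2 μ) (j : Fin N) : MemLp (fun x => b x j) 2 μ := by
  refine MemLp.of_le hb ?_ (Eventually.of_forall fun x => ?_)
  · exact (EuclideanSpace.proj (𝕜 := ℂ) j).continuous.comp_aestronglyMeasurable hb.1
  · exact PiLp.norm_apply_le (b x) j

lemma norm_dzb_cx {η : EN N → ℝ} {z : EN N} (j : Fin N) : ‖dzb j (cx η) z‖ = ‖dz j (cx η) z‖ := by
  have : cx η = fun x => conj (cx η x) := by ext x; simp [cx]
  rw [this, dzb_conj, ← this, RCLike.norm_conj]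

/-- cut-off estimate -/
theorem est_eta {φ ψ : EN N → ℝ} (hφ : ContDiff ℝ 2 φ) (hψ : ContDiff ℝ 2 ψ)
    {U : Set (EN N)} (hU : IsOpen U) (hL : ∀ z ∈ U, LeviCond φ ψ z)
    {η : EN N → ℝ} (hη : ContDiff ℝ 2 η) (hηc : HasCompactSupport η) (hηU : tsupport η ⊆ U)
    {b : EN N → EN N} (hb : MemLp b 2 μ) {τ : EN N → ℂ} (hτ : MemLp τ 2 μ)
    (hT : ∀ g : EN N → ℂ, ContDiff ℝ 2 g → HasCompactSupport g → tsupport g ⊆ U →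
      ∑ j, ∫ x, b x j * ((Real.exp ((ψ x - φ x)/2) : ℝ) : ℂ) * dz j g x ∂μ =
        ∫ x, τ x * ((Real.exp (ψ x - φ x / 2) : ℝ) : ℂ) * g x ∂μ)
    (hR : ∀ g : EN N → ℂ, ContDiff ℝ 2 g → HasCompactSupport g → tsupport g ⊆ U → ∀ j k,
      ∫ x, b x k * ((Real.exp (-((ψ x - φ x)/2)) : ℝ) : ℂ) * dzb j g x ∂μ =
        ∫ x, b x j * ((Real.exp (-((ψ x - φ x)/2)) : ℝ) : ℂ) * dzb k g x ∂μ) :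
    ∫⁻ x, ENNReal.ofReal ((η x)^2 * ‖b x‖^2) ∂μ ≤
    ∫⁻ x, ENNReal.ofReal (16 * (η x)^2 * ‖τ x‖^2 +
      32 * ((∑ j, ‖dz j (cx η) x‖^2) * Real.exp (- ψ x)) * ‖b x‖^2) ∂μ := by
  set ω := fun x => ψ x - φ x with hω
  have h1 : ContDiff ℝ 1 φ := hφ.of_le (by norm_num)
  have p1 : ContDiff ℝ 1 ψ := hψ.of_le (by norm_num)
  have hω2 : ContDiff ℝ 2 ω := hψ.sub hφ
  have hω1 : ContDiff ℝ 1 ω := p1.sub h1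
  have cφ := h1.continuous
  have cψ := p1.continuous
  set si : EN N → ℂ := fun x => ((Real.exp (-((ψ x - φ x)/2)) : ℝ) : ℂ) with hsi
  set sb : EN N → ℂ := fun x => ((Real.exp ((ψ x - φ x)/2) : ℝ) : ℂ) with hsb
  set sa : EN N → ℂ := fun x => ((Real.exp (ψ x - φ x/2) : ℝ) : ℂ) with hsa
  have csi : Continuous si := by rw [hsi]; fun_prop
  have cη2 : ContDiff ℝ 2 (cx η) := contDiff_cx (n := 2) hη
  have cη1 : ContDiff ℝ 1 (cx η) := cη2.of_le (by norm_num)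
  have cη := cη1.continuous
  have cηc : HasCompactSupport (cx η) := hηc.comp_left (g := fun r : ℝ => (r : ℂ)) (by simp)
  have tη : tsupport (cx η) ⊆ tsupport η := closure_mono fun x hx h => hx (by simp [cx, h])
  have bj := memLp_coord μ hb
  have dzη : ∀ j, Continuous (dz j (cx η)) := fun j =>
    (contDiff_dz (n := 1) (m := 0) cη1 (by norm_num) j).continuous
  have dbη : ∀ j, Continuous (dzb j (cx η)) := fun j =>
    (contDiff_dzb (n := 1) (m := 0) cη1 (by norm_num) j).continuous
  have dω : ∀ j, Continuous (dz j (cx ω)) := fun j =>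
    (contDiff_dz (n := 1) (m := 0) (contDiff_cx (n := 1) hω1) (by norm_num) j).continuous
  have kη : ∀ j, HasCompactSupport (dz j (cx η)) := fun j => hcs_of_tsupport cηc (tsupport_dz_subset _ j)
  have kbη : ∀ j, HasCompactSupport (dzb j (cx η)) := fun j =>
    hcs_of_tsupport cηc (tsupport_dzb_subset _ j)
  have eq1 : ∀ x, sb x * ex ω x = si x := fun x => by
    simp only [hsb, hsi, ex, hω]; rw [← Complex.ofReal_mul, ← Real.exp_add]; ring_nf
  have eq2 : ∀ x, sa x * ex ω x = ((Real.exp (φ x/2) : ℝ) : ℂ) := fun x => by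
    simp only [hsa, ex, hω]; rw [← Complex.ofReal_mul, ← Real.exp_add]; ring_nf
  have ce : Continuous (fun x => ((Real.exp (φ x/2) : ℝ) : ℂ)) := by fun_prop
  set M1 : Fin N → EN N → ℂ := fun j x => dz j (cx η) x - dz j (cx ω) x * cx η x with hM1
  have M1c : ∀ j, Continuous (M1 j) := fun j => (dzη j).sub ((dω j).mul cη)
  have M1k : ∀ j, HasCompactSupport (M1 j) := fun j => (kη j).sub (cηc.mul_left)
  set m : EN N → ℂ := fun x => ∑ j, b x j * (si x * M1 j x)
    - τ x * (((Real.exp (φ x/2) : ℝ) : ℂ) * cx η x) with hm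
  have key := est_cpt μ hφ hψ (K := tsupport η) hηc hU hηU hL
    (h := fun j x => b x j * (si x * cx η x)) (m := m)
    (r := fun j k x => b x k * (si x * dzb j (cx η) x) - b x j * (si x * dzb k (cx η) x))
    (fun j => memLp_mul_cc μ (bj j) (csi.mul cη) cηc.mul_left)
    ((memLp_finsetSum _ fun j _ => memLp_mul_cc μ (bj j) (csi.mul (M1c j)) (M1k j).mul_left).sub
      (memLp_mul_cc μ hτ (ce.mul cη) cηc.mul_left))
    (fun j k => (memLp_mul_cc μ (bj k) (csi.mul (dbη j)) (kbη j).mul_left).sub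
      (memLp_mul_cc μ (bj j) (csi.mul (dbη k)) (kbη k).mul_left))
    (fun j x hx => by
      have : cx η x = 0 := image_eq_zero_of_notMem_tsupport fun h => hx (tη h)
      simp [this])
    (fun x hx => by
      have h0 : cx η x = 0 := image_eq_zero_of_notMem_tsupport fun h => hx (tη h)
      simp [hm, hM1, h0, fun j => dz_eq_zero j (fun h => hx (tη h))])
    (fun j k x hx => by
      simp [fun j => dzb_eq_zero j (fun h => hx (tη h))])
    ?_ ?_
  · have lhs : ∀ x, (∑ j, ‖b x j * (si x * cx η x)‖^2) * Real.exp (ψ x - φ x) = (η x)^2 * ‖b x‖^2 := by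
      intro x
      rw [EuclideanSpace.norm_sq_eq]
      simp only [norm_mul, mul_pow, ← Finset.sum_mul, hsi, cx, Complex.norm_real, Real.norm_eq_abs,
        sq_abs, ← Real.exp_nat_mul]
      have : Real.exp (((2:ℕ):ℝ) * -((ψ x - φ x)/2)) * Real.exp (ψ x - φ x) = 1 := by
        rw [← Real.exp_add]; simp; ring_nf
      linear_combination (η x)^2 * (∑ j, ‖b x j‖^2) * this
    simp only [lhs] at key
    refine key.trans (lintegral_mono fun x => ENNReal.ofReal_le_ofReal ?_)
    have e0 : m x - ∑ j, dz j (cx (fun x => φ x - ψ x)) x * (b x j * (si x * cx η x))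
        = ∑ j, dz j (cx η) x * (b x j * si x) + -(τ x * (((Real.exp (φ x/2) : ℝ) : ℂ) * cx η x)) := by
      have d1 := (h1.differentiable (by norm_num)) x
      have d2 := (p1.differentiable (by norm_num)) x
      simp only [hm, hM1, dz_cx_sub d1 d2, hω, dz_cx_sub d2 d1]
      rw [sub_sub, add_comm (τ x * _), ← sub_sub, ← Finset.sum_sub_distrib, sub_eq_add_neg]
      congr 1
      exact Finset.sum_congr rfl fun j _ => by ring
    rw [e0]
    have s1 := norm_add_sq_le (∑ j, dz j (cx η) x * (b x j * si x))
      (-(τ x * (((Real.exp (φ x/2) : ℝ) : ℂ) * cx η x)))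
    have s2 := norm_sum_mul_sq_le (fun j => dz j (cx η) x) (fun j => b x j * si x)
    set e := ∑ j, ‖dz j (cx η) x‖^2 with he
    have wsi : ‖si x‖^2 * Real.exp (-φ x) = Real.exp (-ψ x) := by
      simp only [hsi, Complex.norm_real, Real.norm_eq_abs, sq_abs, ← Real.exp_nat_mul]
      rw [← Real.exp_add]; push_cast; ring_nf
    have wt : ‖τ x * (((Real.exp (φ x/2) : ℝ) : ℂ) * cx η x)‖^2 * Real.exp (-φ x)
        = (η x)^2 * ‖τ x‖^2 := by
      simp only [norm_mul, mul_pow, cx, Complex.norm_real, Real.norm_eq_abs, sq_abs, ← Real.exp_nat_mul]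
      have : Real.exp (((2:ℕ):ℝ) * (φ x/2)) * Real.exp (-φ x) = 1 := by
        rw [← Real.exp_add]; simp; ring_nf
      linear_combination (η x)^2 * ‖τ x‖^2 * this
    have nb : ∑ j, ‖b x j * si x‖^2 = ‖b x‖^2 * ‖si x‖^2 := by
      rw [EuclideanSpace.norm_sq_eq]; simp only [norm_mul, mul_pow, ← Finset.sum_mul]
    rw [norm_neg] at s1
    simp only [nb] at s2
    have s3 : ∑ j, ∑ k, ‖b x k * (si x * dzb j (cx η) x) - b x j * (si x * dzb k (cx η) x)‖^2
        ≤ 4 * (e * (‖b x‖^2 * ‖si x‖^2)) := by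
      have t : ∀ j k, ‖b x k * (si x * dzb j (cx η) x) - b x j * (si x * dzb k (cx η) x)‖^2 ≤
          2 * (‖dz j (cx η) x‖^2 * ‖b x k * si x‖^2) + 2 * (‖dz k (cx η) x‖^2 * ‖b x j * si x‖^2) := by
        intro j k
        have := norm_add_sq_le (b x k * (si x * dzb j (cx η) x)) (-(b x j * (si x * dzb k (cx η) x)))
        rw [← sub_eq_add_neg, norm_neg] at this
        simp only [norm_mul, norm_dzb_cx] at this ⊢
        refine this.trans (le_of_eq (by ring))
      refine (Finset.sum_le_sum fun j _ => Finset.sum_le_sum fun k _ => t j k).trans (le_of_eq ?_)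
      simp only [Finset.sum_add_distrib, ← Finset.mul_sum, ← Finset.sum_mul, nb, ← he]
      ring
    have w0 := (Real.exp_pos (-φ x)).le
    have v1 := mul_le_mul_of_nonneg_right s1 w0
    have v2 := mul_le_mul_of_nonneg_right s2 w0
    have v3 := mul_le_mul_of_nonneg_right s3 w0
    have q : e * (‖b x‖^2 * ‖si x‖^2) * Real.exp (-φ x) = e * Real.exp (-ψ x) * ‖b x‖^2 := by
      rw [← wsi]; ring
    linarith
  · intro g hg hgc
    have hg1 : ContDiff ℝ 1 g := hg.of_le (by norm_num)
    have dg : ∀ j, Continuous (dz j g) := fun j =>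
      (contDiff_dz (n := 1) (m := 0) hg1 (by norm_num) j).continuous
    have hex : ContDiff ℝ 2 (ex ω) := contDiff_ex (n := 2) hω2
    have hG := hT (fun x => (cx η x * g x) * ex ω x) ((cη2.mul hg).mul hex) (hgc.mul_left.mul_right)
      ((closure_mono (t := Function.support (cx η)) (by
        intro x hx h; exact hx (by simp [h]))).trans (tη.trans hηU))
    have e1 : ∀ j x, b x j * sb x * dz j (fun x => (cx η x * g x) * ex ω x) x
        = b x j * (si x * cx η x) * dz j g x + b x j * (si x * M1 j x) * g x := by
      intro j x
      rw [dz_mul_ex ((hω1.differentiable (by norm_num)) x) j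
        (((cη1.mul hg1).differentiable (by norm_num)) x), dl,
        dz_mul j ((cη1.differentiable (by norm_num)) x) ((hg1.differentiable (by norm_num)) x), ← eq1 x]
      simp only [hM1]; ring
    have i1 : ∀ j, Integrable (fun x => b x j * (si x * cx η x) * dz j g x) μ := fun j => by
      have := int_mul_cc μ (bj j) ((csi.mul cη).mul (dg j)) (cηc.mul_left (f := si)).mul_right
      simpa only [mul_assoc, Pi.mul_apply] using this
    have i2 : ∀ j, Integrable (fun x => b x j * (si x * M1 j x) * g x) μ := fun j => by
      have := int_mul_cc μ (bj j) ((csi.mul (M1c j)).mul hg1.continuous)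
        ((M1k j).mul_left (f := si)).mul_right
      simpa only [mul_assoc, Pi.mul_apply] using this
    have i3 : Integrable (fun x => τ x * (((Real.exp (φ x/2) : ℝ) : ℂ) * cx η x) * g x) μ := by
      have := int_mul_cc μ hτ ((ce.mul cη).mul hg1.continuous)
        (cηc.mul_left (f := fun x => ((Real.exp (φ x/2) : ℝ) : ℂ))).mul_right
      simpa only [mul_assoc, Pi.mul_apply] using this
    have l1 : ∀ j, ∫ x, b x j * sb x * dz j (fun x => (cx η x * g x) * ex ω x) x ∂μ
        = ∫ x, b x j * (si x * cx η x) * dz j g x ∂μ + ∫ x, b x j * (si x * M1 j x) * g x ∂μ := by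
      intro j
      simp only [e1]; exact integral_add (i1 j) (i2 j)
    have l2 : ∫ x, m x * g x ∂μ = ∑ j, ∫ x, b x j * (si x * M1 j x) * g x ∂μ
        - ∫ x, τ x * (((Real.exp (φ x/2) : ℝ) : ℂ) * cx η x) * g x ∂μ := by
      rw [← integral_finsetSum _ fun j _ => i2 j, ← integral_sub (integrable_finsetSum _ fun j _ => i2 j) i3]
      congr 1; ext x
      simp only [hm, sub_mul, Finset.sum_mul]
    have l3 : ∫ x, τ x * sa x * ((cx η x * g x) * ex ω x) ∂μ =
        ∫ x, τ x * (((Real.exp (φ x/2) : ℝ) : ℂ) * cx η x) * g x ∂μ := by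
      congr 1; ext x; rw [← eq2 x]; ring
    change ∑ j, ∫ x, b x j * sb x * dz j (fun x => (cx η x * g x) * ex ω x) x ∂μ
      = ∫ x, τ x * sa x * ((cx η x * g x) * ex ω x) ∂μ at hG
    rw [l3] at hG
    simp only [l1, Finset.sum_add_distrib] at hG
    rw [l2]
    linear_combination hG
  · intro g hg hgc j k
    have hg1 : ContDiff ℝ 1 g := hg.of_le (by norm_num)
    have dg : ∀ j, Continuous (dzb j g) := fun j =>
      (contDiff_dzb (n := 1) (m := 0) hg1 (by norm_num) j).continuous
    have hG := hR (fun x => cx η x * g x) (cη2.mul hg) (hgc.mul_left)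
      ((closure_mono (t := Function.support (cx η)) (by
        intro x hx h; exact hx (by simp [h]))).trans (tη.trans hηU)) j k
    have i1 : ∀ k j, Integrable (fun x => b x k * (si x * cx η x) * dzb j g x) μ := fun k j => by
      have := int_mul_cc μ (bj k) ((csi.mul cη).mul (dg j)) (cηc.mul_left (f := si)).mul_right
      simpa only [mul_assoc, Pi.mul_apply] using this
    have i2 : ∀ k j, Integrable (fun x => b x k * (si x * dzb j (cx η) x) * g x) μ := fun k j => by
      have := int_mul_cc μ (bj k) ((csi.mul (dbη j)).mul hg1.continuous)
        ((kbη j).mul_left (f := si)).mul_right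
      simpa only [mul_assoc, Pi.mul_apply] using this
    have l1 : ∀ k j, ∫ x, b x k * si x * dzb j (fun x => cx η x * g x) x ∂μ
        = ∫ x, b x k * (si x * cx η x) * dzb j g x ∂μ
          + ∫ x, b x k * (si x * dzb j (cx η) x) * g x ∂μ := by
      intro k j
      rw [← integral_add (i1 k j) (i2 k j)]
      congr 1; ext x
      rw [dzb_mul j ((cη1.differentiable (by norm_num)) x) ((hg1.differentiable (by norm_num)) x)]
      ring
    have l2 : ∫ x, (b x k * (si x * dzb j (cx η) x) - b x j * (si x * dzb k (cx η) x)) * g x ∂μ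
        = ∫ x, b x k * (si x * dzb j (cx η) x) * g x ∂μ
        - ∫ x, b x j * (si x * dzb k (cx η) x) * g x ∂μ := by
      rw [← integral_sub (i2 k j) (i2 j k)]
      congr 1; ext x; ring
    change ∫ x, b x k * si x * dzb j (fun x => cx η x * g x) x ∂μ
      = ∫ x, b x j * si x * dzb k (fun x => cx η x * g x) x ∂μ at hG
    rw [l1, l1] at hG
    rw [l2]
    linear_combination hG

end WB

open Set Filter Topology Metric MeasureTheory
open scoped ENNReal NNReal InnerProductSpace ComplexConjugate

namespace WB

section abstract
variable {X H1 H2 : Type*} [AddCommGroup X] [Module ℂ X]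
  [NormedAddCommGroup H1] [InnerProductSpace ℂ H1] [CompleteSpace H1]
  [NormedAddCommGroup H2] [InnerProductSpace ℂ H2] [CompleteSpace H2]

set_option maxHeartbeats 1000000 in
theorem tikh (A : X →ₗ[ℂ] H1) (B : X →ₗ[ℂ] H2) {C : ℝ} (hC : 0 ≤ C)
    (h : ∀ b ∈ closure (range B), ∀ τ, (∀ x, ⟪b, B x⟫_ℂ = ⟪τ, A x⟫_ℂ) → ‖b‖ ≤ C * ‖τ‖)
    (x0 : X) {ε : ℝ} (hε : 0 < ε) : ∃ x, ‖B x - B x0‖ ≤ ε ∧ ‖A x‖ ≤ C * ‖B x0‖ + ε := by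
  set a := B x0 with ha
  obtain ⟨δ, δ0, δ1, hδ⟩ : ∃ δ : ℝ, 0 < δ ∧ δ ≤ 1 ∧ C * δ * (C * δ * ‖a‖) ≤ ε / 2 := by
    have : Tendsto (fun δ : ℝ => C * δ * (C * δ * ‖a‖)) (𝓝[>] 0) (𝓝 0) := by
      have : ContinuousAt (fun δ : ℝ => C * δ * (C * δ * ‖a‖)) 0 := by fun_prop
      have := this.tendsto; simp at this
      exact this.mono_left nhdsWithin_le_nhds
    have e1 := this.eventually_le_const (show (0:ℝ) < ε/2 by linarith)
    have e2 : ∀ᶠ δ in 𝓝[>] (0:ℝ), δ ∈ Ioc (0:ℝ) 1 := Ioc_mem_nhdsGT one_pos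
    obtain ⟨δ, d1, d2⟩ := (e1.and e2).exists
    exact ⟨δ, d2.1, d2.2, d1⟩
  let L : X →ₗ[ℂ] WithLp 2 (H2 × H1) :=
    (WithLp.linearEquiv 2 ℂ (H2 × H1)).symm.toLinearMap ∘ₗ (B.prod ((δ : ℂ) • A))
  have L1 : ∀ x, (L x).fst = B x := fun x => rfl
  have L2 : ∀ x, (L x).snd = (δ : ℂ) • A x := fun x => rfl
  set G := (LinearMap.range L).topologicalClosure with hG
  have : CompleteSpace G := (Submodule.isClosed_topologicalClosure _).completeSpace_coe
  set v : WithLp 2 (H2 × H1) := WithLp.toLp 2 (a, (0:H1)) with hv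
  set P : WithLp 2 (H2 × H1) := G.starProjection v with hP
  have PG : P ∈ G := by rw [hP]; exact Submodule.starProjection_apply_mem _ _
  have orth : ∀ w ∈ G, ⟪v - P, w⟫_ℂ = 0 := fun w hw => by
    rw [← inner_conj_symm, (Submodule.sub_starProjection_mem_orthogonal (K := G) v) w hw, map_zero]
  set p := P.fst with hp
  set q := P.snd with hq
  have in1 : ∀ w ∈ G, ⟪a - p, w.fst⟫_ℂ = ⟪q, w.snd⟫_ℂ := fun w hw => by
    have := orth w hw
    rw [WithLp.prod_inner_apply] at this
    simp only [hv, WithLp.ofLp_sub, Prod.fst_sub, Prod.snd_sub] at this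
    change ⟪a - p, w.fst⟫_ℂ + ⟪0 - q, w.snd⟫_ℂ = 0 at this
    rw [zero_sub, inner_neg_left] at this
    linear_combination this
  have pcl : p ∈ closure (range B) := by
    have : P ∈ closure (range L) := by
      have := PG; rwa [hG, ← SetLike.mem_coe, Submodule.topologicalClosure_coe, LinearMap.coe_range] at this
    have h2 := image_closure_subset_closure_image (f := fun w : WithLp 2 (H2 × H1) => w.fst)
      (WithLp.prod_continuous_ofLp 2 H2 H1).fst ⟨P, this, rfl⟩
    refine closure_mono ?_ h2
    rintro _ ⟨_, ⟨x, rfl⟩, rfl⟩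
    exact ⟨x, rfl⟩
  have bcl : a - p ∈ closure (range B) := by
    have : (LinearMap.range B).topologicalClosure.carrier = closure (range B) := by
      rfl
    rw [← this] at pcl ⊢
    exact Submodule.sub_mem _ (Submodule.le_topologicalClosure _ ⟨x0, rfl⟩) pcl
  have b1 : ‖a - p‖ ≤ C * (δ * ‖q‖) := by
    have := h _ bcl ((δ : ℂ) • q) (fun x => by
      have := in1 (L x) (Submodule.le_topologicalClosure _ ⟨x, rfl⟩)
      rw [L1, L2, inner_smul_right] at this
      rw [this, inner_smul_left]; simp)
    rwa [norm_smul, Complex.norm_real, Real.norm_eq_abs, abs_of_pos δ0] at this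
  have np : ‖p‖ ≤ ‖a‖ := by
    have h1 : ‖P‖ ≤ ‖v‖ := by rw [hP]; exact Submodule.norm_starProjection_apply_le _ _
    have h2 : ‖v‖ = ‖a‖ := by rw [hv]; simp
    have h3 : ‖p‖ ≤ ‖P‖ := WithLp.norm_fst_le H2 P
    linarith
  have q1 : ‖q‖ ≤ C * δ * ‖a‖ := by
    have e : ‖q‖^2 ≤ ‖a - p‖ * ‖p‖ := by
      have := in1 P PG
      have h2 := norm_inner_le_norm (𝕜 := ℂ) (a - p) p
      rw [← hp, ← hq] at this
      rw [this, inner_self_eq_norm_sq_to_K] at h2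
      simpa using h2
    by_cases hq0 : ‖q‖ = 0
    · rw [hq0]; positivity
    have q0 : 0 < ‖q‖ := lt_of_le_of_ne (norm_nonneg _) (Ne.symm hq0)
    have : ‖a - p‖ * ‖p‖ ≤ C * (δ * ‖q‖) * ‖a‖ := mul_le_mul b1 np (norm_nonneg _) (by positivity)
    have : ‖q‖ * ‖q‖ ≤ (C * δ * ‖a‖) * ‖q‖ := by nlinarith
    exact le_of_mul_le_mul_right this q0
  obtain ⟨w, ⟨x, rfl⟩, hw⟩ : ∃ w ∈ range L, dist P w < δ * ε / 2 := by
    have : P ∈ closure (range L) := by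
      have := PG; rwa [hG, ← SetLike.mem_coe, Submodule.topologicalClosure_coe, LinearMap.coe_range] at this
    exact Metric.mem_closure_iff.1 this _ (by positivity)
  rw [dist_eq_norm] at hw
  have w1 : ‖p - B x‖ ≤ δ * ε / 2 := by
    have t : (P - L x).fst = p - B x := by rw [WithLp.sub_fst, L1]
    rw [← t]; exact (WithLp.norm_fst_le _ _).trans hw.le
  have w2 : ‖q - (δ : ℂ) • A x‖ ≤ δ * ε / 2 := by
    have t : (P - L x).snd = q - (δ : ℂ) • A x := by rw [WithLp.sub_snd, L2]
    rw [← t]; exact (WithLp.norm_snd_le _ _).trans hw.le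
  refine ⟨x, ?_, ?_⟩
  · have : B x - a = -(p - B x) - (a - p) := by abel
    rw [this]
    refine (norm_sub_le _ _).trans ?_
    rw [norm_neg]
    have : C * (δ * ‖q‖) ≤ C * δ * (C * δ * ‖a‖) := by
      rw [← mul_assoc]; exact mul_le_mul_of_nonneg_left q1 (by positivity)
    nlinarith
  · have e1 : ‖(δ : ℂ) • A x‖ = δ * ‖A x‖ := by
      rw [norm_smul, Complex.norm_real, Real.norm_eq_abs, abs_of_pos δ0]
    have e2 : ‖(δ : ℂ) • A x‖ ≤ ‖q‖ + ‖q - (δ : ℂ) • A x‖ := by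
      have := norm_sub_le q (q - (δ : ℂ) • A x); simpa using this
    have : δ * ‖A x‖ ≤ δ * (C * ‖a‖ + ε) := by nlinarith
    exact le_of_mul_le_mul_left this δ0

theorem tikh_seq (A : X →ₗ[ℂ] H1) (B : X →ₗ[ℂ] H2) {C : ℝ} (hC : 0 ≤ C)
    (h : ∀ b ∈ closure (range B), ∀ τ, (∀ x, ⟪b, B x⟫_ℂ = ⟪τ, A x⟫_ℂ) → ‖b‖ ≤ C * ‖τ‖)
    (x0 : X) {ε : ℝ} (hε : 0 < ε) : ∃ x : ℕ → X, Tendsto (fun n => ‖B (x n) - B x0‖) atTop (𝓝 0) ∧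
      (∀ n, ‖A (x n)‖ ≤ C * ‖B x0‖ + ε) ∧ (∀ n, ‖A (x (n+1)) - A (x n)‖ ≤ ε / 2^n) := by
  set θ := ε / (4 * (C+1)) with hθ
  have θ0 : 0 < θ := by positivity
  have hθC : (C+1) * θ = ε/4 := by rw [hθ]; field_simp
  have ex : ∀ (y : X) (n : ℕ), ∃ z, ‖B z - B (x0 - y)‖ ≤ θ / 2^(n+1) ∧
      ‖A z‖ ≤ C * ‖B (x0 - y)‖ + θ / 2^(n+1) := fun y n => tikh A B hC h _ (by positivity)
  choose z hz1 hz2 using ex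
  obtain ⟨y0, y1, y2⟩ := tikh A B hC h x0 θ0
  let x : ℕ → X := fun n => Nat.rec y0 (fun n y => y + z y n) n
  have xs : ∀ n, x (n+1) = x n + z (x n) n := fun n => rfl
  have hB : ∀ n, ‖B (x n) - B x0‖ ≤ θ / 2^n := by
    intro n
    cases n with
    | zero => rw [pow_zero, div_one]; exact y1
    | succ n =>
      have := hz1 (x n) n
      rw [xs, map_add]; rw [map_sub] at this
      convert this using 2; abel
  have hA : ∀ n, ‖A (x (n+1)) - A (x n)‖ ≤ ε/4/2^n := by
    intro n
    have h1 := hz2 (x n) n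
    have h2 : ‖B (x0 - x n)‖ ≤ θ/2^n := by
      rw [map_sub, norm_sub_rev]; exact hB n
    rw [xs, map_add, add_sub_cancel_left]
    have h3 : θ / 2^(n+1) ≤ θ / 2^n := by
      apply div_le_div_of_nonneg_left θ0.le (by positivity)
      exact pow_le_pow_right₀ (by norm_num) (by omega)
    have h4 := mul_le_mul_of_nonneg_left h2 hC
    rw [← hθC]
    have : (C+1)*θ/2^n = C * (θ/2^n) + θ/2^n := by ring
    linarith
  refine ⟨x, ?_, ?_, fun n => (hA n).trans ?_⟩
  · refine squeeze_zero (fun n => norm_nonneg _) hB ?_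
    have := (tendsto_pow_atTop_nhds_zero_of_lt_one (r := (1/2:ℝ)) (by norm_num) (by norm_num)).const_mul θ
    simpa [div_eq_mul_inv] using this
  · intro n
    have : ‖A (x n)‖ ≤ C * ‖B x0‖ + ε - ε/2/2^n := by
      induction n with
      | zero =>
        have : θ ≤ ε/4 := by nlinarith
        have : ‖A (x 0)‖ ≤ _ := y2
        simp; linarith
      | succ n ih =>
        have h1 := hA n
        have h2 : ‖A (x (n+1))‖ ≤ ‖A (x (n+1)) - A (x n)‖ + ‖A (x n)‖ := by
          have := norm_add_le (A (x (n+1)) - A (x n)) (A (x n)); simpa using this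
        have h3 : ε/2/2^(n+1) = ε/2/2^n - ε/4/2^n := by rw [pow_succ]; field_simp; ring
        linarith
    have : 0 < ε/2/2^n := by positivity
    linarith
  · gcongr; linarith

end abstract

end WB

open Set Filter Topology Metric MeasureTheory
open scoped ENNReal NNReal InnerProductSpace ComplexConjugate

namespace WB

variable {N : ℕ}

lemma exists_cutoff {K D : Set (EN N)} (hK : IsCompact K) (hD : IsOpen D) (hKD : K ⊆ D) :
    ∃ χ : EN N → ℝ, ContDiff ℝ 2 χ ∧ HasCompactSupport χ ∧ tsupport χ ⊆ D ∧
      (∀ x, χ x ∈ Icc (0:ℝ) 1) ∧ ∃ U, IsOpen U ∧ K ⊆ U ∧ ∀ x ∈ U, χ x = 1 := by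
  obtain ⟨L, hL, hKL, hLD⟩ := exists_compact_between hK hD hKD
  obtain ⟨f, f1, f0, f01⟩ := exists_contMDiffMap_one_nhds_of_subset_interior (n := 2)
    (I := modelWithCornersSelf ℝ (EN N)) hK.isClosed hKL
  have ts : tsupport (f : EN N → ℝ) ⊆ L := closure_minimal (fun x hx => by
    by_contra h; exact hx (f0 x h)) hL.isClosed
  refine ⟨f, f.contMDiff.contDiff, hL.of_isClosed_subset (isClosed_tsupport _) ts, ts.trans hLD, f01, ?_⟩
  obtain ⟨U, hU, hKU, h⟩ := mem_nhdsSet_iff_exists.1 f1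
  exact ⟨U, hU, hKU, fun x hx => h hx⟩

lemma contDiff_cut_mul {D : Set (EN N)} (hD : IsOpen D) {n : WithTop ℕ∞}
    {F : Type*} [NormedAddCommGroup F] [NormedSpace ℝ F] {χ : EN N → ℝ} {φ : EN N → F}
    (hχ : ContDiff ℝ n χ) (hs : tsupport χ ⊆ D) (hφ : ContDiffOn ℝ n φ D) :
    ContDiff ℝ n (fun x => χ x • φ x) := by
  rw [contDiff_iff_contDiffAt]
  intro x
  by_cases hx : x ∈ D
  · exact hχ.contDiffAt.smul (hφ.contDiffAt (hD.mem_nhds hx))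
  · have : (fun x => χ x • φ x) =ᶠ[𝓝 x] fun _ => 0 := by
      filter_upwards [notMem_tsupport_iff_eventuallyEq.1 fun h => hx (hs h)] with y hy
      simp [hy]
    exact contDiffAt_const.congr_of_eventuallyEq this

lemma exists_global {K D : Set (EN N)} (hK : IsCompact K) (hD : IsOpen D) (hKD : K ⊆ D)
    {φ ψ : EN N → ℝ} (hφ : ContDiffOn ℝ 2 φ D) (hψ : ContDiffOn ℝ 2 ψ D) :
    ∃ φ' ψ' : EN N → ℝ, ∃ U, IsOpen U ∧ K ⊆ U ∧ U ⊆ D ∧ ContDiff ℝ 2 φ' ∧ ContDiff ℝ 2 ψ' ∧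
      (∀ x ∈ U, φ' x = φ x) ∧ (∀ x ∈ U, ψ' x = ψ x) := by
  obtain ⟨χ, h1, h2, h3, h4, U, hU, hKU, h⟩ := exists_cutoff hK hD hKD
  refine ⟨fun x => χ x • φ x, fun x => χ x • ψ x, U, hU, hKU, ?_, contDiff_cut_mul hD h1 h3 hφ,
    contDiff_cut_mul hD h1 h3 hψ, fun x hx => by simp [h x hx], fun x hx => by simp [h x hx]⟩
  intro x hx
  exact h3 (subset_tsupport _ (by simp [h x hx]))

lemma LeviForm_congr {φ φ' : EN N → ℝ} {z : EN N} (h : φ =ᶠ[𝓝 z] φ') (b : EN N) :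
    LeviForm φ z b = LeviForm φ' z b := by
  simp only [LeviForm, Hess, (h.fderiv (𝕜 := ℝ)).fderiv_eq]

lemma LeviCond_congr {φ φ' ψ ψ' : EN N → ℝ} {z : EN N} (h : φ =ᶠ[𝓝 z] φ') (k : ψ =ᶠ[𝓝 z] ψ')
    (hL : LeviCond φ ψ z) : LeviCond φ' ψ' z := by
  intro b
  have : cx ψ =ᶠ[𝓝 z] cx ψ' := by filter_upwards [k] with x hx; simp [cx, hx]
  rw [← LeviForm_congr h, ← k.eq_of_nhds]
  simp only [← dz_congr _ this]
  exact hL b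

lemma lint_sq {E : Type*} [NormedAddCommGroup E] {μ : Measure (EN N)} {f : EN N → E} (hf : MemLp f 2 μ) :
    ∫⁻ x, ENNReal.ofReal (‖f x‖^2) ∂μ = ENNReal.ofReal (‖hf.toLp f‖^2) := by
  have h1 : eLpNorm f 2 μ ^ 2 = ∫⁻ x, ENNReal.ofReal (‖f x‖^2) ∂μ := by
    rw [eLpNorm_eq_lintegral_rpow_enorm_toReal (by norm_num) (by norm_num), ← ENNReal.rpow_natCast,
      ← ENNReal.rpow_mul]
    norm_num
  rw [← h1, Lp.norm_toLp, ENNReal.ofReal_pow ENNReal.toReal_nonneg, ENNReal.ofReal_toReal hf.2.ne]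

/-- test functions -/
def Test (D : Set (EN N)) : Submodule ℂ (EN N → ℂ) where
  carrier := {g | ContDiff ℝ 2 g ∧ HasCompactSupport g ∧ tsupport g ⊆ D}
  add_mem' := by
    rintro f g ⟨f1, f2, f3⟩ ⟨g1, g2, g3⟩
    exact ⟨f1.add g1, f2.add g2, (tsupport_add f g).trans (union_subset f3 g3)⟩
  zero_mem' := ⟨contDiff_const, HasCompactSupport.zero, by simp [tsupport]⟩
  smul_mem' := by
    rintro c f ⟨f1, f2, f3⟩
    have : tsupport (c • f) ⊆ tsupport f := closure_mono fun x hx h => hx (by simp [h])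
    exact ⟨contDiff_const.smul f1, f2.of_isClosed_subset (isClosed_tsupport _) this, this.trans f3⟩

/-- the vector of antiholomorphic derivatives -/
noncomputable def dbv (g : EN N → ℂ) (x : EN N) : EN N := WithLp.toLp 2 (fun j => dzb j g x)

lemma dbv_apply (g : EN N → ℂ) (x : EN N) (j : Fin N) : dbv g x j = dzb j g x := rfl

lemma norm_dbv_sq (g : EN N → ℂ) (x : EN N) : ‖dbv g x‖^2 = ∑ j, ‖dzb j g x‖^2 := by
  rw [EuclideanSpace.norm_sq_eq]; rfl

lemma continuous_dbv {g : EN N → ℂ} (hg : ContDiff ℝ 1 g) : Continuous (dbv g) := by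
  refine (PiLp.continuous_toLp 2 _).comp (continuous_pi fun j => ?_)
  exact (contDiff_dzb (n := 1) (m := 0) hg (by norm_num) j).continuous

lemma dbv_eq_zero {g : EN N → ℂ} {x : EN N} (h : x ∉ tsupport g) : dbv g x = 0 := by
  ext j; simp [dbv_apply, dzb_eq_zero j h]

lemma dbv_add {f g : EN N → ℂ} (hf : ContDiff ℝ 2 f) (hg : ContDiff ℝ 2 g) (x : EN N) :
    dbv (f + g) x = dbv f x + dbv g x := by
  ext j
  exact dzb_add j ((hf.differentiable (by norm_num)) x) ((hg.differentiable (by norm_num)) x)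

lemma dbv_smul {f : EN N → ℂ} (hf : ContDiff ℝ 2 f) (c : ℂ) (x : EN N) :
    dbv (c • f) x = c • dbv f x := by
  ext j
  simp only [dbv_apply, PiLp.smul_apply, dzb, fderiv_const_smul ((hf.differentiable (by norm_num)) x) c]
  simp; ring

lemma cont_smul_tsupport {F G : Type*} [NormedAddCommGroup F] [NormedSpace ℝ F] [Zero G]
    {D : Set (EN N)} (hD : IsOpen D)
    {s : EN N → ℝ} (hs : ContinuousOn s D) {f : EN N → F} (hf : Continuous f) {g : EN N → G}
    (hg : tsupport g ⊆ D) (h0 : ∀ x ∉ tsupport g, f x = 0) :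
    Continuous (fun x => s x • f x) := by
  rw [continuous_iff_continuousAt]
  intro x
  by_cases hx : x ∈ D
  · exact (hs.continuousAt (hD.mem_nhds hx)).smul hf.continuousAt
  · have : (fun x => s x • f x) =ᶠ[𝓝 x] fun _ => 0 := by
      filter_upwards [(isClosed_tsupport g).isOpen_compl.mem_nhds fun h => hx (hg h)] with y hy
      simp [h0 y hy]
    exact continuousAt_const.congr this.symm

end WB

open Set Filter Topology Metric MeasureTheory
open scoped ENNReal NNReal InnerProductSpace ComplexConjugate

namespace WB

variable {N : ℕ}

noncomputable def sB (φ ψ : EN N → ℝ) (x : EN N) : ℝ := Real.exp ((ψ x - φ x)/2)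
noncomputable def sA (φ ψ : EN N → ℝ) (x : EN N) : ℝ := Real.exp (ψ x - φ x/2)

/-- The standing assumptions for the L2 theory. -/
structure Setup (D : Set (EN N)) (φ ψ : EN N → ℝ) (η : ℕ → EN N → ℝ) (K : ℕ → Set (EN N)) : Prop where
  hD : IsOpen D
  hφ : ContDiffOn ℝ 2 φ D
  hψ : ContDiffOn ℝ 2 ψ D
  hL : ∀ z ∈ D, LeviCond φ ψ z
  hη : ∀ n, ContDiff ℝ 2 (η n)
  hηc : ∀ n, HasCompactSupport (η n)
  hηD : ∀ n, tsupport (η n) ⊆ D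
  η01 : ∀ n x, η n x ∈ Icc (0:ℝ) 1
  hη1 : ∀ n, ∀ x ∈ K n, η n x = 1
  dη0 : ∀ n, ∀ x ∈ K n, ∀ j, dz j (cx (η n)) x = 0
  dηb : ∀ n, ∀ x ∈ D, ∑ j, ‖dz j (cx (η n)) x‖^2 ≤ Real.exp (ψ x)
  Km : ∀ n, MeasurableSet (K n)
  Kmono : Monotone K
  KU : ⋃ n, K n = D

variable {D : Set (EN N)} {φ ψ : EN N → ℝ} {η : ℕ → EN N → ℝ} {K : ℕ → Set (EN N)}

section
variable (S : Setup D φ ψ η K) (μ : Measure (EN N)) [μ.IsAddHaarMeasure]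
include S

lemma Setup.cA : ContinuousOn (sA φ ψ) D := by
  have h1 := S.hφ.continuousOn
  have h2 := S.hψ.continuousOn
  unfold sA; fun_prop

lemma Setup.cB : ContinuousOn (sB φ ψ) D := by
  have h1 := S.hφ.continuousOn
  have h2 := S.hψ.continuousOn
  unfold sB; fun_prop

lemma Setup.mA {g : EN N → ℂ} (hg : g ∈ Test D) : MemLp (fun x => sA φ ψ x • g x) 2 μ :=
  (cont_smul_tsupport S.hD S.cA hg.1.continuous hg.2.2 (fun x hx =>
    image_eq_zero_of_notMem_tsupport hx)).memLp_of_hasCompactSupport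
    (hg.2.1.smul_left (f := sA φ ψ))

lemma Setup.mB {g : EN N → ℂ} (hg : g ∈ Test D) : MemLp (fun x => sB φ ψ x • dbv g x) 2 μ :=
  (cont_smul_tsupport S.hD S.cB (continuous_dbv (hg.1.of_le (by norm_num))) hg.2.2 (fun x hx =>
    dbv_eq_zero hx)).memLp_of_hasCompactSupport
    (HasCompactSupport.intro hg.2.1 fun x hx => by simp [dbv_eq_zero hx])

/-- the weighted embedding of test functions -/
noncomputable def Setup.A : Test D →ₗ[ℂ] Lp ℂ 2 μ where
  toFun g := (S.mA μ g.2).toLp _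
  map_add' f g := by
    rw [← MemLp.toLp_add]; congr 1; ext x
    change sA φ ψ x • (f.1 x + g.1 x) = sA φ ψ x • f.1 x + sA φ ψ x • g.1 x
    simp [mul_add]
  map_smul' c f := by
    rw [RingHom.id_apply, ← MemLp.toLp_const_smul]; congr 1; ext x
    change sA φ ψ x • (c * f.1 x) = c * (sA φ ψ x • f.1 x)
    simp [mul_left_comm]

/-- the weighted dbar operator on test functions -/
noncomputable def Setup.B : Test D →ₗ[ℂ] Lp (EN N) 2 μ where
  toFun g := (S.mB μ g.2).toLp _
  map_add' f g := by
    rw [← MemLp.toLp_add]; congr 1; ext1 x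
    change sB φ ψ x • dbv (f.1 + g.1) x = sB φ ψ x • dbv f.1 x + sB φ ψ x • dbv g.1 x
    rw [dbv_add f.2.1 g.2.1, smul_add]
  map_smul' c f := by
    rw [RingHom.id_apply, ← MemLp.toLp_const_smul]; congr 1; ext1 x
    change sB φ ψ x • dbv (c • f.1) x = c • (sB φ ψ x • dbv f.1 x)
    rw [dbv_smul f.2.1, smul_comm]

lemma Setup.lint_B (g : Test D) :
    ∫⁻ x, ENNReal.ofReal (Real.exp (ψ x - φ x) * ∑ j, ‖dzb j g.1 x‖^2) ∂μ
      = ENNReal.ofReal (‖S.B μ g‖^2) := by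
  change _ = ENNReal.ofReal (‖(S.mB μ g.2).toLp _‖^2)
  rw [← lint_sq (S.mB μ g.2)]
  congr 1; ext x
  rw [norm_smul, mul_pow, norm_dbv_sq, Real.norm_eq_abs, sq_abs, sB, ← Real.exp_nat_mul]
  congr 3; push_cast; ring

lemma Setup.lint_A (g : Test D) :
    ∫⁻ x, ENNReal.ofReal (Real.exp (2 * ψ x - φ x) * ‖g.1 x‖^2) ∂μ
      = ENNReal.ofReal (‖S.A μ g‖^2) := by
  change _ = ENNReal.ofReal (‖(S.mA μ g.2).toLp _‖^2)
  rw [← lint_sq (S.mA μ g.2)]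
  congr 1; ext x
  rw [norm_smul, mul_pow, Real.norm_eq_abs, sq_abs, sA, ← Real.exp_nat_mul]
  congr 3; push_cast; ring

/-- zero off D -/
lemma Setup.off (b : Lp (EN N) 2 μ) (hb : b ∈ closure (range (S.B μ))) :
    ∫⁻ x in Dᶜ, ENNReal.ofReal (‖b x‖^2) ∂μ = 0 := by
  have hDm : MeasurableSet Dᶜ := S.hD.measurableSet.compl
  have hm := (Lp.memLp b).indicator hDm
  set c := hm.toLp _ with hc
  have h0 : ∀ y ∈ closure (range (S.B μ)), ⟪c, y⟫_ℂ = 0 := by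
    have hcl : IsClosed {y : Lp (EN N) 2 μ | ⟪c, y⟫_ℂ = 0} :=
      isClosed_eq (by fun_prop) continuous_const
    refine fun y hy => closure_minimal ?_ hcl hy
    rintro _ ⟨g, rfl⟩
    change ⟪c, S.B μ g⟫_ℂ = 0
    rw [L2.inner_def]
    refine integral_eq_zero_of_ae ?_
    filter_upwards [hm.coeFn_toLp, (S.mB μ g.2).coeFn_toLp] with x h1 h2
    change ⟪c x, (S.mB μ g.2).toLp _ x⟫_ℂ = 0
    rw [h1, h2]
    by_cases hx : x ∈ D
    · simp [hx]
    · rw [dbv_eq_zero (fun h => hx (g.2.2.2 h))]; simp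
  have h1 := h0 b hb
  have h2 : ‖c‖^2 = 0 := by
    have e : ⟪c, b⟫_ℂ = ⟪c, c⟫_ℂ := by
      rw [L2.inner_def, L2.inner_def]
      refine integral_congr_ae ?_
      filter_upwards [hm.coeFn_toLp] with x h1
      rw [h1]
      by_cases hx : x ∈ D
      · simp [hx]
      · simp [hx]
    rw [e, inner_self_eq_zero] at h1
    simp [h1]
  rw [← lintegral_indicator hDm]
  have := lint_sq hm
  rw [← hc, h2] at this
  simp only [ENNReal.ofReal_zero] at this
  rw [← this]
  congr 1; ext x
  by_cases hx : x ∈ D <;> simp [hx]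

/-- curl-free -/
lemma Setup.curl (b : Lp (EN N) 2 μ) (hb : b ∈ closure (range (S.B μ))) (g : EN N → ℂ)
    (hg : g ∈ Test D) (j k : Fin N) :
    ∫ x, b x k * ((Real.exp (-((ψ x - φ x)/2)) : ℝ) : ℂ) * dzb j g x ∂μ =
        ∫ x, b x j * ((Real.exp (-((ψ x - φ x)/2)) : ℝ) : ℂ) * dzb k g x ∂μ := by
  have cs : ContinuousOn (fun x => Real.exp (-((ψ x - φ x)/2))) D := by
    have h1 := S.hφ.continuousOn
    have h2 := S.hψ.continuousOn
    fun_prop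
  have g1 : ContDiff ℝ 1 g := hg.1.of_le (by norm_num)
  have dg : ∀ j, Continuous (dzb j g) := fun j =>
    (contDiff_dzb (n := 1) (m := 0) g1 (by norm_num) j).continuous
  set p : Fin N → EN N → ℂ := fun j x => (Real.exp (-((ψ x - φ x)/2))) • dzb j g x with hp
  have cp : ∀ j, Continuous (p j) := fun j => cont_smul_tsupport S.hD cs (dg j) hg.2.2
    (fun x hx => dzb_eq_zero j hx)
  have kp : ∀ j, HasCompactSupport (p j) := fun j => HasCompactSupport.intro hg.2.1 fun x hx => by
    simp [hp, dzb_eq_zero j hx]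
  have hm : MemLp (fun x => conj (p j x) • eb k - conj (p k x) • (eb j : EN N)) 2 μ := by
    refine Continuous.memLp_of_hasCompactSupport ?_ ?_
    · exact ((Complex.continuous_conj.comp (cp j)).smul continuous_const).sub
        ((Complex.continuous_conj.comp (cp k)).smul continuous_const)
    · exact HasCompactSupport.intro hg.2.1 fun x hx => by
        simp [hp, dzb_eq_zero _ hx]
  have int : ∀ y : Lp (EN N) 2 μ, ⟪hm.toLp _, y⟫_ℂ = ∫ x, y x k * p j x ∂μ - ∫ x, y x j * p k x ∂μ := by
    intro y
    rw [L2.inner_def, ← integral_sub (int_mul_cc μ (memLp_coord μ (Lp.memLp y) k) (cp j) (kp j))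
      (int_mul_cc μ (memLp_coord μ (Lp.memLp y) j) (cp k) (kp k))]
    refine integral_congr_ae ?_
    filter_upwards [hm.coeFn_toLp] with x h1
    rw [h1, inner_sub_left, inner_smul_left, inner_smul_left]
    simp [eb, EuclideanSpace.inner_single_left]; ring
  have h0 : ∀ y ∈ closure (range (S.B μ)), ⟪hm.toLp _, y⟫_ℂ = 0 := by
    have hcl : IsClosed {y : Lp (EN N) 2 μ | ⟪hm.toLp _, y⟫_ℂ = 0} :=
      isClosed_eq (by fun_prop) continuous_const
    refine fun y hy => closure_minimal ?_ hcl hy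
    rintro _ ⟨f, rfl⟩
    change ⟪hm.toLp _, S.B μ f⟫_ℂ = 0
    rw [int]
    have f2 := f.2.1
    have df : ∀ k, ContDiff ℝ 1 (dzb k f.1) := fun k => contDiff_dzb (n := 2) (m := 1) f2 (by norm_num) k
    have dgg : ∀ k, ContDiff ℝ 1 (dzb k g) := fun k => contDiff_dzb (n := 2) (m := 1) hg.1 (by norm_num) k
    have e : ∀ k j, ∫ x, S.B μ f x k * p j x ∂μ = ∫ x, dzb k f.1 x * dzb j g x ∂μ := by
      intro k j
      refine integral_congr_ae ?_
      filter_upwards [(S.mB μ f.2).coeFn_toLp] with x h2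
      have : S.B μ f x = sB φ ψ x • dbv f.1 x := h2
      rw [this]
      simp only [hp, PiLp.smul_apply, dbv_apply, sB]
      have : ((Real.exp ((ψ x - φ x)/2) : ℝ) : ℂ) * ((Real.exp (-((ψ x - φ x)/2)) : ℝ) : ℂ) = 1 := by
        rw [← Complex.ofReal_mul, ← Real.exp_add]; simp
      rw [Complex.real_smul, Complex.real_smul]
      linear_combination dzb k f.1 x * dzb j g x * this
    rw [e, e, ibp_dzb μ (f2.of_le (by norm_num)) (dgg j) f.2.2.1,
      ibp_dzb μ (f2.of_le (by norm_num)) (dgg k) f.2.2.1, sub_eq_zero]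
    congr 2; ext x; rw [dzb_dzb hg.1]
  have := h0 b hb
  rw [int, sub_eq_zero] at this
  simpa only [hp, Complex.real_smul, mul_assoc] using this

/-- the basic estimate -/
theorem Setup.est (b : Lp (EN N) 2 μ) (hb : b ∈ closure (range (S.B μ))) (τ : Lp ℂ 2 μ)
    (h : ∀ g, ⟪b, S.B μ g⟫_ℂ = ⟪τ, S.A μ g⟫_ℂ) : ‖b‖ ≤ 4 * ‖τ‖ := by
  -- weak adjoint identity
  have hT : ∀ g : EN N → ℂ, g ∈ Test D →
      ∑ j, ∫ x, b x j * (sB φ ψ x • dz j g x) ∂μ = ∫ x, τ x * (sA φ ψ x • g x) ∂μ := by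
    intro g hg
    have hcg : (fun x => conj (g x)) ∈ Test D := by
      have t : tsupport (fun x => conj (g x)) ⊆ tsupport g := closure_mono fun x hx h => hx (by simp [h])
      refine ⟨(Complex.conjCLE.contDiff).comp hg.1, hcs_of_tsupport hg.2.1 t, t.trans hg.2.2⟩
    have dg : ∀ j, Continuous (dz j g) := fun j =>
      (contDiff_dz (n := 1) (m := 0) (hg.1.of_le (by norm_num)) (by norm_num) j).continuous
    have e := h ⟨_, hcg⟩
    rw [L2.inner_def, L2.inner_def] at e
    have e1 : ∫ x, ⟪b x, S.B μ ⟨_, hcg⟩ x⟫_ℂ ∂μ = conj (∑ j, ∫ x, b x j * (sB φ ψ x • dz j g x) ∂μ) := by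
      rw [← integral_finsetSum, ← integral_conj]
      · refine integral_congr_ae ?_
        filter_upwards [(S.mB μ hcg).coeFn_toLp] with x h2
        have : S.B μ ⟨_, hcg⟩ x = sB φ ψ x • dbv (fun x => conj (g x)) x := h2
        rw [this, PiLp.inner_apply, map_sum]
        refine Finset.sum_congr rfl fun j _ => ?_
        simp only [PiLp.smul_apply, dbv_apply, dzb_conj, Complex.real_smul, RCLike.inner_apply, map_mul,
          Complex.conj_ofReal]
        ring
      · intro j _
        exact int_mul_cc μ (memLp_coord μ (Lp.memLp b) j) (cont_smul_tsupport S.hD S.cB (dg j) hg.2.2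
          (fun x hx => dz_eq_zero j hx)) (HasCompactSupport.intro hg.2.1 fun x hx => by
            simp [dz_eq_zero j hx])
    have e2 : ∫ x, ⟪τ x, S.A μ ⟨_, hcg⟩ x⟫_ℂ ∂μ = conj (∫ x, τ x * (sA φ ψ x • g x) ∂μ) := by
      rw [← integral_conj]
      refine integral_congr_ae ?_
      filter_upwards [(S.mA μ hcg).coeFn_toLp] with x h2
      have : S.A μ ⟨_, hcg⟩ x = sA φ ψ x • conj (g x) := h2
      rw [this]
      simp only [Complex.real_smul, RCLike.inner_apply, map_mul, Complex.conj_ofReal]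
      ring
    rw [e1, e2] at e
    exact (starRingEnd ℂ).injective e
  set ν := μ.withDensity (fun x => ENNReal.ofReal (‖b x‖^2)) with hν
  have νa : ∀ s, MeasurableSet s → ν s = ∫⁻ x in s, ENNReal.ofReal (‖b x‖^2) ∂μ := fun s hs =>
    withDensity_apply _ hs
  have νu : ν univ = ENNReal.ofReal (‖b‖^2) := by
    rw [νa _ MeasurableSet.univ, setLIntegral_univ, lint_sq (Lp.memLp b), Lp.toLp_coeFn]
  have : IsFiniteMeasure ν := ⟨by rw [νu]; exact ENNReal.ofReal_lt_top⟩
  have hDm := S.hD.measurableSet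
  have νD : ν D = ENNReal.ofReal (‖b‖^2) := by
    have h1 := measure_add_measure_compl (μ := ν) hDm
    rw [νa _ hDm.compl, S.off μ b hb, add_zero, νu] at h1
    exact h1
  have main : ∀ n, ν (K n) ≤ ENNReal.ofReal (16 * ‖τ‖^2) + 32 * ν (D \ K n) := by
    intro n
    obtain ⟨φ', ψ', U, hU, hKU, hUD, hφ', hψ', eφ, eψ⟩ := exists_global (S.hηc n) S.hD (S.hηD n) S.hφ S.hψ
    have key := est_eta μ hφ' hψ' hU (fun z hz => LeviCond_congr
      (Filter.eventually_of_mem (hU.mem_nhds hz) fun x hx => (eφ x hx).symm)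
      (Filter.eventually_of_mem (hU.mem_nhds hz) fun x hx => (eψ x hx).symm) (S.hL z (hUD hz)))
      (S.hη n) (S.hηc n) hKU (Lp.memLp b) (Lp.memLp τ) ?_ ?_
    · have c1 : ν (K n) ≤ ∫⁻ x, ENNReal.ofReal ((η n x)^2 * ‖b x‖^2) ∂μ := by
        rw [νa _ (S.Km n)]
        rw [← lintegral_indicator (S.Km n)]
        refine lintegral_mono fun x => ?_
        by_cases hx : x ∈ K n
        · simp [hx, S.hη1 n x hx]
        · simp [hx]
      refine c1.trans (key.trans ?_)
      have c2 : ∀ x, ENNReal.ofReal (16 * (η n x)^2 * ‖τ x‖^2 +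
          32 * ((∑ j, ‖dz j (cx (η n)) x‖^2) * Real.exp (- ψ' x)) * ‖b x‖^2) ≤
          ENNReal.ofReal 16 * ENNReal.ofReal (‖τ x‖^2) +
            32 * (D \ K n).indicator (fun x => ENNReal.ofReal (‖b x‖^2)) x := by
        intro x
        rw [ENNReal.ofReal_add (by positivity) (by positivity)]
        refine add_le_add ?_ ?_
        · rw [← ENNReal.ofReal_mul (by norm_num)]
          refine ENNReal.ofReal_le_ofReal ?_
          have := S.η01 n x
          have : (η n x)^2 ≤ 1 := by nlinarith [this.1, this.2]
          nlinarith [sq_nonneg ‖τ x‖]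
        · by_cases hx : x ∈ tsupport (cx (η n))
          · have hxs : x ∈ tsupport (η n) := closure_mono (s := Function.support (cx (η n)))
              (t := Function.support (η n)) (by intro y hy h; exact hy (by simp [cx, h])) hx
            have hxU := hKU hxs
            have hxD := hUD hxU
            by_cases hk : x ∈ K n
            · simp [S.dη0 n x hk]
            · have hmem : x ∈ D \ K n := ⟨hxD, hk⟩
              rw [indicator_of_mem hmem, mul_assoc,
                ENNReal.ofReal_mul (by norm_num), ENNReal.ofReal_ofNat]
              refine mul_le_mul' le_rfl (ENNReal.ofReal_le_ofReal ?_)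
              rw [eψ x hxU]
              have h1 : (∑ j, ‖dz j (cx (η n)) x‖^2) * Real.exp (- ψ x) ≤ 1 := by
                have := mul_le_mul_of_nonneg_right (S.dηb n x hxD) (Real.exp_pos (-ψ x)).le
                rwa [← Real.exp_add, add_neg_cancel, Real.exp_zero] at this
              nlinarith [sq_nonneg ‖b x‖]
          · simp [dz_eq_zero _ hx]
      refine (lintegral_mono c2).trans (le_of_eq ?_)
      have mm : AEMeasurable (fun x => ENNReal.ofReal (‖τ x‖^2)) μ :=
        ((Lp.memLp τ).1.aemeasurable.norm.pow_const 2).ennreal_ofReal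
      rw [lintegral_add_left' (mm.const_mul _), lintegral_const_mul'' _ mm,
        lintegral_const_mul' _ _ (by norm_num), lintegral_indicator (hDm.diff (S.Km n)),
        νa _ (hDm.diff (S.Km n)), lint_sq (Lp.memLp τ), Lp.toLp_coeFn,
        ← ENNReal.ofReal_mul (by norm_num)]
    · intro g hg hgc hgU
      have := hT g ⟨hg, hgc, hgU.trans hUD⟩
      convert this using 2
      · rename_i j _
        congr 1; ext x
        by_cases hx : x ∈ tsupport g
        · simp only [sB, eφ x (hgU hx), eψ x (hgU hx), Complex.real_smul]; ring
        · simp [dz_eq_zero j hx]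
      · ext x
        by_cases hx : x ∈ tsupport g
        · simp only [sA, eφ x (hgU hx), eψ x (hgU hx), Complex.real_smul]; ring
        · simp [image_eq_zero_of_notMem_tsupport hx]
    · intro g hg hgc hgU j k
      have := S.curl μ b hb g ⟨hg, hgc, hgU.trans hUD⟩ j k
      convert this using 2
      · ext x
        by_cases hx : x ∈ tsupport g
        · simp only [eφ x (hgU hx), eψ x (hgU hx)]
        · simp [dzb_eq_zero j hx]
      · ext x
        by_cases hx : x ∈ tsupport g
        · simp only [eφ x (hgU hx), eψ x (hgU hx)]
        · simp [dzb_eq_zero k hx]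
  have l1 : Tendsto (fun n => ν (K n)) atTop (𝓝 (ν D)) := by
    have := tendsto_measure_iUnion_atTop (μ := ν) S.Kmono
    rwa [S.KU] at this
  have l2 : Tendsto (fun n => ν (D \ K n)) atTop (𝓝 0) := by
    have := tendsto_measure_iInter_atTop (μ := ν) (s := fun n => D \ K n)
      (fun n => (hDm.diff (S.Km n)).nullMeasurableSet)
      (fun m n hmn => diff_subset_diff_right (S.Kmono hmn)) ⟨0, measure_ne_top _ _⟩
    rw [← diff_iUnion, S.KU, diff_self, measure_empty] at this
    exact this
  have l3 := le_of_tendsto_of_tendsto' l1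
    ((ENNReal.Tendsto.const_mul l2 (Or.inr (by norm_num : (32:ℝ≥0∞) ≠ ⊤))).const_add
      (ENNReal.ofReal (16 * ‖τ‖^2))) main
  rw [νD, mul_zero, add_zero, ENNReal.ofReal_le_ofReal_iff (by positivity)] at l3
  nlinarith [norm_nonneg b, norm_nonneg τ]

theorem Setup.approx (g0 : EN N → ℂ) (hg0 : g0 ∈ Test D) {ε : ℝ} (hε : 0 < ε) :
    ∃ x : ℕ → Test D, Tendsto (fun n => ‖S.B μ (x n - ⟨g0, hg0⟩)‖) atTop (𝓝 0) ∧
      (∀ n, ‖S.A μ (x n)‖ ≤ 4 * ‖S.B μ ⟨g0, hg0⟩‖ + ε) ∧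
      ∀ n, ‖S.A μ (x (n+1) - x n)‖ ≤ ε/2^n := by
  obtain ⟨x, h1, h2, h3⟩ := tikh_seq (S.A μ) (S.B μ) (by norm_num) (S.est μ) ⟨g0, hg0⟩ hε
  refine ⟨x, ?_, h2, fun n => ?_⟩
  · simpa only [map_sub] using h1
  · rw [map_sub]; exact h3 n

end

end WB

open Set Filter Topology Metric MeasureTheory
open scoped ENNReal NNReal InnerProductSpace ComplexConjugate

namespace WB

variable {N : ℕ}

/-- vanishing `∂/∂z̄_j` derivatives give complex differentiability -/
lemma diff_of_dzb {f : EN N → ℂ} {x : EN N} (hf : DifferentiableAt ℝ f x)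
    (h : ∀ j, dzb j f x = 0) : DifferentiableAt ℂ f x := by
  rw [differentiableAt_iff_restrictScalars ℝ hf]
  set L := fderiv ℝ f x with hL
  have hI : ∀ j, L (Complex.I • eb j) = Complex.I * L (eb j) := by
    intro j
    have := h j
    simp only [dzb, ← hL] at this
    have h2 : L (eb j) + Complex.I * L (Complex.I • eb j) = 0 := by
      simpa using this
    linear_combination -Complex.I * h2 + L (Complex.I • eb j) * Complex.I_mul_I
  have hc : ∀ (c : ℂ) j, L (c • eb j) = c * L (eb j) := by
    intro c j
    have e : c • eb (N := N) j = c.re • eb j + c.im • (Complex.I • eb j) := by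
      conv_lhs => rw [← Complex.re_add_im c]
      rw [add_smul, mul_smul]
      rfl
    rw [e, map_add, map_smul, map_smul, hI]
    conv_rhs => rw [← Complex.re_add_im c]
    simp only [Complex.real_smul]; ring
  have hv : ∀ v : EN N, v = ∑ j, v j • eb j := by
    intro v
    ext i
    simp [eb, Pi.single_apply]
  have hs : ∀ (c : ℂ) (v : EN N), L (c • v) = c • L v := by
    intro c v
    conv_lhs => rw [hv v]
    conv_rhs => rw [hv v]
    rw [Finset.smul_sum, map_sum, map_sum, Finset.smul_sum]
    refine Finset.sum_congr rfl fun j _ => ?_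
    rw [smul_smul, hc, hc, smul_eq_mul, mul_assoc]
  refine ⟨⟨⟨⟨L, map_add L⟩, hs⟩, L.continuous⟩, rfl⟩

/-- Cauchy estimate -/
lemma norm_fderiv_le_sup {f : EN N → ℂ} {x : EN N} {r C : ℝ} (hr : 0 < r)
    (hf : DifferentiableOn ℂ f (ball x (2*r))) (hC0 : 0 ≤ C) (hC : ∀ y ∈ ball x (2*r), ‖f y‖ ≤ C) :
    ‖fderiv ℂ f x‖ ≤ C / r := by
  refine ContinuousLinearMap.opNorm_le_bound _ (by positivity) fun v => ?_
  by_cases hv : v = 0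
  · simp [hv]
  have hvn : 0 < ‖v‖ := norm_pos_iff.2 hv
  have hm : ∀ t ∈ closedBall (0:ℂ) (r/‖v‖), x + t • v ∈ ball x (2*r) := by
    intro t ht
    rw [mem_closedBall_zero_iff, le_div_iff₀ hvn] at ht
    rw [mem_ball_iff_norm, add_sub_cancel_left, norm_smul]; linarith
  have hd : DifferentiableOn ℂ (fun t : ℂ => f (x + t • v)) (closedBall 0 (r/‖v‖)) :=
    hf.comp (by fun_prop) hm
  have h1 := Complex.norm_deriv_le_of_forall_mem_sphere_norm_le (c := 0) (R := r/‖v‖) (C := C)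
    (f := fun t : ℂ => f (x + t • v)) (by positivity)
    (hd.diffContOnCl_ball subset_rfl) (fun z hz => hC _ (hm z (sphere_subset_closedBall hz)))
  have hfx : HasFDerivAt f (fderiv ℂ f x) (x + (0:ℂ) • v) := by
    rw [zero_smul, add_zero]
    exact (hf.differentiableAt (ball_mem_nhds _ (by positivity))).hasFDerivAt
  have h2 : HasDerivAt (fun t : ℂ => f (x + t • v)) (fderiv ℂ f x v) 0 := by
    have h3 : HasDerivAt (fun t : ℂ => x + t • v) v 0 := by
      simpa using ((hasDerivAt_id (0:ℂ)).smul_const v).const_add x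
    exact hfx.comp_hasDerivAt (0:ℂ) h3
  rw [h2.deriv] at h1
  rw [div_div_eq_mul_div] at h1
  calc _ ≤ C * ‖v‖ / r := h1
    _ = _ := by ring

lemma hol_lim {f : ℕ → EN N → ℂ} {g : EN N → ℂ} {z : EN N} {r : ℝ} (hr : 0 < r)
    (hf : ∀ n, DifferentiableOn ℂ (f n) (ball z (2*r)))
    (hU : UniformCauchySeqOn f atTop (ball z (2*r)))
    (hg : ∀ x ∈ ball z r, Tendsto (fun n => f n x) atTop (𝓝 (g x))) :
    DifferentiableOn ℂ g (ball z r) := by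
  have sub : ∀ x ∈ ball z r, ball x (2*(r/2)) ⊆ ball z (2*r) := fun x hx =>
    ball_subset_ball' (by rw [mem_ball] at hx; linarith)
  have hC : UniformCauchySeqOn (fun n x => fderiv ℂ (f n) x) atTop (ball z r) := by
    rw [Metric.uniformCauchySeqOn_iff] at hU ⊢
    intro ε hε
    obtain ⟨M, hM⟩ := hU (ε * r/4) (by positivity)
    refine ⟨M, fun m hm n hn x hx => ?_⟩
    have hmem : ball x (2*(r/2)) ∈ 𝓝 x := ball_mem_nhds _ (by positivity)
    have d1 := ((hf m).mono (sub x hx)); have d2 := ((hf n).mono (sub x hx))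
    rw [dist_eq_norm, ← fderiv_fun_sub (d1.differentiableAt hmem) (d2.differentiableAt hmem)]
    have := norm_fderiv_le_sup (C := ε * r/4) (by positivity : 0 < r/2) (d1.fun_sub d2) (by positivity)
      (fun y hy => by
        have := (hM m hm n hn y (sub x hx hy)).le
        rwa [dist_eq_norm] at this)
    refine this.trans_lt ?_
    have : ε * r / 4 / (r/2) = ε/2 := by field_simp; norm_num
    rw [this]; linarith
  have hl : ∀ x ∈ ball z r, ∃ l, Tendsto (fun n => fderiv ℂ (f n) x) atTop (𝓝 l) := fun x hx =>
    cauchySeq_tendsto_of_complete (hC.cauchySeq hx)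
  choose! g' hg' using hl
  have hT := hC.tendstoUniformlyOn_of_tendsto hg'
  intro x hx
  refine (hasFDerivAt_of_tendstoUniformlyOn isOpen_ball hT (fun n y hy => ?_) hg hx).differentiableAt.differentiableWithinAt
  exact (((hf n).mono (sub y hy)).differentiableAt (ball_mem_nhds _ (by positivity))).hasFDerivAt

section
variable (μ : Measure (EN N)) [μ.IsAddHaarMeasure]

lemma map_rot (c : ℂ) (hc : ‖c‖ = 1) : Measure.map (fun t : EN N => c • t) μ = μ := by
  have hc0 : c ≠ 0 := by intro h; simp [h] at hc
  have cc : Continuous (fun t : EN N => c • t) := continuous_const_smul c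
  have hH : (Measure.map (fun t : EN N => c • t) μ).IsAddHaarMeasure :=
    Measure.isAddHaarMeasure_map μ (DistribSMul.toAddMonoidHom (EN N) c) cc
      (fun y => ⟨c⁻¹ • y, smul_inv_smul₀ hc0 y⟩)
      ((Homeomorph.smulOfNeZero c hc0).isClosedEmbedding.tendsto_cocompact)
  set ν := Measure.map (fun t : EN N => c • t) μ with hν
  have h1 := Measure.isAddLeftInvariant_eq_smul ν μ
  have hb : ν (ball 0 1) = μ (ball 0 1) := by
    rw [hν, Measure.map_apply cc.measurable measurableSet_ball]
    congr 1
    ext x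
    simp [norm_smul, hc]
  have hp : μ (ball (0:EN N) 1) ≠ 0 := (measure_ball_pos μ _ one_pos).ne'
  have ht : μ (ball (0:EN N) 1) ≠ ⊤ := measure_ball_lt_top.ne
  have h2 : ν.addHaarScalarFactor μ = 1 := by
    have h3 : ((ν.addHaarScalarFactor μ : ℝ≥0) : ℝ≥0∞) * μ (ball (0:EN N) 1)
      = 1 * μ (ball (0:EN N) 1) := by
      rw [one_mul]
      conv_rhs => rw [← hb, h1]
      rfl
    have := (ENNReal.mul_left_inj hp ht).1 h3
    exact_mod_cast this
  rw [h1, h2, one_smul]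

lemma mv1 {f : EN N → ℂ} {x : EN N} {r : ℝ} (hf : DifferentiableOn ℂ f (ball x r))
    {t : EN N} (ht : t ∈ ball (0:EN N) r) :
    ENNReal.ofReal (2 * Real.pi) * ENNReal.ofReal ‖f x‖ ≤ ∫⁻ θ in Ioc (0:ℝ) (2*Real.pi),
      ENNReal.ofReal ‖f (x + Complex.exp (θ * Complex.I) • t)‖ := by
  have hm : ∀ s ∈ closedBall (0:ℂ) 1, x + s • t ∈ ball x r := by
    intro s hs
    rw [mem_closedBall_zero_iff] at hs
    rw [mem_ball_zero_iff] at ht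
    rw [mem_ball_iff_norm, add_sub_cancel_left, norm_smul]
    nlinarith [norm_nonneg t]
  have hd : DifferentiableOn ℂ (fun s : ℂ => f (x + s • t)) (closedBall 0 1) :=
    hf.comp (by fun_prop) hm
  have h1 := DiffContOnCl.circleAverage (c := 0) (R := 1) (f := fun s : ℂ => f (x + s • t))
    (by rw [abs_one]; exact hd.diffContOnCl_ball subset_rfl)
  simp only [zero_smul, add_zero, Real.circleAverage_def, circleMap, Complex.ofReal_one, one_mul, zero_add] at h1
  have h2 : (2 * Real.pi) * ‖f x‖ = ‖∫ θ in (0:ℝ)..(2*Real.pi), f (x + Complex.exp (θ * Complex.I) • t)‖ := by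
    rw [← h1, norm_smul, norm_inv, Real.norm_of_nonneg (by positivity)]
    rw [← mul_assoc, mul_inv_cancel₀ (by positivity), one_mul]
  rw [← ENNReal.ofReal_mul (by positivity), h2]
  rw [intervalIntegral.integral_of_le (by positivity), ofReal_norm_eq_enorm]
  refine (enorm_integral_le_lintegral_enorm _).trans (le_of_eq ?_)
  simp_rw [ofReal_norm_eq_enorm]

lemma mv2 {f : EN N → ℂ} {x : EN N} {r : ℝ} (hf : DifferentiableOn ℂ f (ball x r)) :
    μ (ball x r) * ENNReal.ofReal ‖f x‖ ≤ ∫⁻ t in ball x r, ENNReal.ofReal ‖f t‖ ∂μ := by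
  have hpi : ENNReal.ofReal (2 * Real.pi) ≠ 0 := by
    rw [ne_eq, ENNReal.ofReal_eq_zero, not_le]; positivity
  have h1 : ∫⁻ t in ball (0:EN N) r, ENNReal.ofReal (2 * Real.pi) * ENNReal.ofReal ‖f x‖ ∂μ ≤
      ∫⁻ t in ball (0:EN N) r, ∫⁻ θ in Ioc (0:ℝ) (2*Real.pi),
      ENNReal.ofReal ‖f (x + Complex.exp (θ * Complex.I) • t)‖ ∂volume ∂μ :=
    setLIntegral_mono' measurableSet_ball fun t ht => mv1 hf ht
  have hmem : ∀ (θ : ℝ) (t : EN N), t ∈ ball (0:EN N) r ↔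
      x + Complex.exp (θ * Complex.I) • t ∈ ball x r := by
    intro θ t
    rw [mem_ball_iff_norm (a := x), add_sub_cancel_left, norm_smul, Complex.norm_exp_ofReal_mul_I, one_mul, mem_ball_zero_iff]
  have h2 : ∀ θ : ℝ, ∫⁻ t in ball (0:EN N) r,
      ENNReal.ofReal ‖f (x + Complex.exp (θ * Complex.I) • t)‖ ∂μ
      = ∫⁻ t in ball x r, ENNReal.ofReal ‖f t‖ ∂μ := by
    intro θ
    have mp : MeasurePreserving (fun t : EN N => x + Complex.exp (θ * Complex.I) • t) μ μ :=
      (measurePreserving_add_left μ x).comp ⟨(continuous_const_smul _).measurable,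
        map_rot μ _ (Complex.norm_exp_ofReal_mul_I θ)⟩
    have me : MeasurableEmbedding (fun t : EN N => x + Complex.exp (θ * Complex.I) • t) :=
      ((Homeomorph.smulOfNeZero _ (Complex.exp_ne_zero (θ * Complex.I))).trans
        (Homeomorph.addLeft x)).measurableEmbedding
    have := mp.setLIntegral_comp_preimage_emb me (fun t => ENNReal.ofReal ‖f t‖) (ball x r)
    rw [← this]
    congr 2
    ext t; exact hmem θ t
  rw [lintegral_lintegral_swap] at h1
  · simp_rw [h2] at h1
    simp only [lintegral_const, Measure.restrict_apply MeasurableSet.univ, univ_inter, Real.volume_Ioc, sub_zero] at h1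
    rw [mul_comm (ENNReal.ofReal (2 * Real.pi)) (ENNReal.ofReal ‖f x‖), mul_assoc, mul_comm (ENNReal.ofReal (2 * Real.pi)), ← mul_assoc] at h1
    have h3 := (ENNReal.mul_le_mul_iff_left hpi ENNReal.ofReal_ne_top).1 h1
    rw [mul_comm]
    convert h3 using 2
    exact Measure.addHaar_ball_center μ x r
  · rw [Function.uncurry_def, Measure.prod_restrict]
    have : ContinuousOn (fun p : EN N × ℝ => ‖f (x + Complex.exp (p.2 * Complex.I) • p.1)‖)
        (ball (0:EN N) r ×ˢ Ioc 0 (2*Real.pi)) := by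
      refine (hf.continuousOn.comp (Continuous.continuousOn ?_) ?_).norm
      · fun_prop
      · rintro ⟨t, θ⟩ ⟨ht, _⟩
        exact (hmem θ t).1 ht
    exact (this.aemeasurable (measurableSet_ball.prod measurableSet_Ioc)).ennreal_ofReal

lemma mv_sq {f : EN N → ℂ} {x : EN N} {r : ℝ} (hf : DifferentiableOn ℂ f (ball x r)) :
    μ (ball x r) * ENNReal.ofReal (‖f x‖^2) ≤ ∫⁻ t in ball x r, ENNReal.ofReal (‖f t‖^2) ∂μ := by
  simpa only [norm_pow] using mv2 μ (hf.fun_pow 2)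
end

end WB

open Set Filter Topology Metric MeasureTheory
open scoped ENNReal NNReal InnerProductSpace ComplexConjugate

namespace WB

variable {N : ℕ}

section
variable (μ : Measure (EN N)) [μ.IsAddHaarMeasure]

lemma tsupport_kx (n : ℕ) (x : EN N) : tsupport (kx μ n x) ⊆ closedBall x (1/((n:ℝ)+1)) := by
  refine closure_minimal ?_ isClosed_closedBall
  intro t ht
  have h1 : x - t ∈ Function.support ((bmp (N := N) n).normed μ) := by
    intro h; exact ht (by simp [kx, h])
  rw [ContDiffBump.support_normed_eq, bmp_rOut, mem_ball_zero_iff] at h1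
  rw [mem_closedBall, dist_comm, dist_eq_norm]; exact h1.le

/-- Weyl's lemma, local form -/
lemma weyl {v : EN N → ℂ} (hv : MemLp v 2 μ) {z : EN N} {r : ℝ} (hr : 0 < r)
    (hw : ∀ g : EN N → ℂ, ContDiff ℝ 2 g → HasCompactSupport g → tsupport g ⊆ ball z (4*r) →
      ∀ j, ∫ x, v x * dzb j g x ∂μ = 0) :
    ∃ H : EN N → ℂ, DifferentiableOn ℂ H (ball z r) ∧
      (∀ x ∈ ball z r, Tendsto (fun m => moll μ m v x) atTop (𝓝 (H x))) ∧
      ∀ᵐ x ∂μ, x ∈ ball z r → v x = H x := by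
  have li : LocallyIntegrable v μ := hv.locallyIntegrable (by norm_num)
  obtain ⟨n0, hn0⟩ := (eventually_atTop.1 (tendsto_rOut.eventually (gt_mem_nhds hr)))
  set f : ℕ → EN N → ℂ := fun n => moll μ (n + n0) v with hf
  have fhol : ∀ n, ∀ x ∈ ball z (3*r), DifferentiableAt ℂ (f n) x := by
    intro n x hx
    refine diff_of_dzb (((moll_contDiff μ (n+n0) li).differentiable (by norm_num)) x) fun j => ?_
    rw [dzb_moll μ _ li, hw _ (kx_contDiff μ _ x) (kx_hcs μ _ x), neg_zero]
    refine (tsupport_kx μ _ x).trans (closedBall_subset_ball' ?_)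
    have := hn0 (n+n0) (by omega)
    rw [mem_ball] at hx
    linarith
  set a : ℕ → ℝ≥0∞ := fun n => ∫⁻ x, ENNReal.ofReal (‖f n x - v x‖^2) ∂μ with ha
  have ha0 : Tendsto a atTop (𝓝 0) := (lint_moll_tendsto μ hv).comp (tendsto_add_atTop_nat n0)
  set c := μ (ball (0:EN N) r) with hc
  have c0 : c ≠ 0 := (measure_ball_pos μ _ hr).ne'
  have ct : c ≠ ⊤ := measure_ball_lt_top.ne
  have key : ∀ m n, ∀ x ∈ ball z (2*r), c * ENNReal.ofReal (‖f m x - f n x‖^2) ≤ 2 * a m + 2 * a n := by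
    intro m n x hx
    have hs : ball x r ⊆ ball z (3*r) := ball_subset_ball' (by rw [mem_ball] at hx; linarith)
    have h1 := mv_sq μ (f := fun y => f m y - f n y) (x := x) (r := r) (fun y hy =>
      ((fhol m y (hs hy)).fun_sub (fhol n y (hs hy))).differentiableWithinAt)
    rw [Measure.addHaar_ball_center μ x r] at h1
    refine h1.trans ?_
    refine (setLIntegral_le_lintegral _ _).trans ?_
    have m1 : ∀ k, AEMeasurable (fun x => ENNReal.ofReal (‖f k x - v x‖^2)) μ := fun k =>
      ((((moll_contDiff μ (k+n0) li).continuous.aestronglyMeasurable.sub hv.1).aemeasurable.norm.pow_const 2).ennreal_ofReal)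
    rw [ha]
    simp only
    rw [← lintegral_const_mul'' _ (m1 m), ← lintegral_const_mul'' _ (m1 n),
      ← lintegral_add_left' ((m1 m).const_mul 2)]
    refine lintegral_mono fun y => ?_
    rw [← ENNReal.ofReal_ofNat, ← ENNReal.ofReal_mul (by norm_num), ← ENNReal.ofReal_mul (by norm_num),
      ← ENNReal.ofReal_add (by positivity) (by positivity)]
    refine ENNReal.ofReal_le_ofReal ?_
    have h2 : ‖f m y - f n y‖ ≤ ‖f m y - v y‖ + ‖f n y - v y‖ := by
      rw [← norm_neg (f n y - v y)]
      calc _ = ‖(f m y - v y) + -(f n y - v y)‖ := by congr 1; ring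
        _ ≤ _ := norm_add_le _ _
    nlinarith [norm_nonneg (f m y - f n y), sq_nonneg (‖f m y - v y‖ - ‖f n y - v y‖)]
  have UC : UniformCauchySeqOn f atTop (ball z (2*r)) := by
    rw [Metric.uniformCauchySeqOn_iff]
    intro ε hε
    have hpos : 0 < c * ENNReal.ofReal (ε^2) / 4 := by
      refine ENNReal.div_pos (mul_ne_zero c0 ?_) (by norm_num)
      rw [ne_eq, ENNReal.ofReal_eq_zero, not_le]; positivity
    obtain ⟨M, hM⟩ := eventually_atTop.1 (ha0.eventually (gt_mem_nhds hpos))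
    refine ⟨M, fun m hm n hn x hx => ?_⟩
    have k1 := key m n x hx
    have k2 : 2 * a m + 2 * a n < c * ENNReal.ofReal (ε^2) := by
      calc 2 * a m + 2 * a n < 2 * (c * ENNReal.ofReal (ε^2) / 4) + 2 * (c * ENNReal.ofReal (ε^2) / 4) :=
            ENNReal.add_lt_add ((ENNReal.mul_lt_mul_iff_right (by norm_num) (by norm_num)).2 (hM m hm))
              ((ENNReal.mul_lt_mul_iff_right (by norm_num) (by norm_num)).2 (hM n hn))
        _ = 4 * (c * ENNReal.ofReal (ε^2) / 4) := by ring
        _ = _ := ENNReal.mul_div_cancel (by norm_num) (by norm_num)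
    have k3 := (ENNReal.mul_lt_mul_iff_right c0 ct).1 (k1.trans_lt k2)
    rw [ENNReal.ofReal_lt_ofReal_iff (by positivity)] at k3
    rw [dist_eq_norm]
    exact lt_of_pow_lt_pow_left₀ 2 hε.le k3
  have lim : ∀ x ∈ ball z (2*r), ∃ l, Tendsto (fun n => f n x) atTop (𝓝 l) := fun x hx =>
    cauchySeq_tendsto_of_complete (UC.cauchySeq hx)
  choose! H hH using lim
  have sub : ball z r ⊆ ball z (2*r) := ball_subset_ball (by linarith)
  refine ⟨H, hol_lim hr (fun n x hx => (fhol n x (ball_subset_ball (by linarith) hx)).differentiableWithinAt)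
    UC (fun x hx => hH x (sub hx)), fun x hx => (tendsto_add_atTop_iff_nat n0).1 (hH x (sub hx)), ?_⟩
  have tm : TendstoInMeasure μ (fun n => moll μ n v) atTop v :=
    tendstoInMeasure_of_tendsto_eLpNorm (by norm_num : (2:ℝ≥0∞) ≠ 0)
      (fun n => (moll_contDiff μ n li).continuous.aestronglyMeasurable) hv.1 (moll_tendsto μ hv)
  obtain ⟨ns, hns, hae⟩ := tm.exists_seq_tendsto_ae
  filter_upwards [hae] with x hx hxb
  have h9 : Tendsto (fun m => moll μ m v x) atTop (𝓝 (H x)) :=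
    (tendsto_add_atTop_iff_nat n0).1 (hH x (sub hxb))
  exact tendsto_nhds_unique hx (h9.comp hns.tendsto_atTop)

lemma moll_local {v w : EN N → ℂ} {n : ℕ} {x : EN N}
    (h : ∀ t ∈ ball x (1/((n:ℝ)+1)), v t = w t) : moll μ n v x = moll μ n w x := by
  rw [moll_swap, moll_swap]
  congr 1; ext t
  by_cases ht : t ∈ ball x (1/((n:ℝ)+1))
  · rw [h t ht]
  · have : (bmp (N := N) n).normed μ (x - t) = 0 := by
      rw [← Function.notMem_support, ContDiffBump.support_normed_eq, bmp_rOut, mem_ball_zero_iff,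
        ← dist_eq_norm, dist_comm]
      exact ht
    simp [this]

/-- Weyl's lemma on an open set. -/
lemma weyl_open {D : Set (EN N)} (hD : IsOpen D) {v : EN N → ℂ}
    (hv : ∀ K ⊆ D, IsCompact K → MemLp (K.indicator v) 2 μ)
    (hw : ∀ g ∈ Test D, ∀ j, ∫ x, v x * dzb j g x ∂μ = 0) :
    ∃ H : EN N → ℂ, DifferentiableOn ℂ H D ∧ ∀ᵐ x ∂μ, x ∈ D → v x = H x := by
  set H : EN N → ℂ := fun x => limUnder atTop (fun m => moll μ m v x) with hH
  have loc : ∀ z ∈ D, ∃ r > 0, DifferentiableOn ℂ H (ball z r) ∧ ∀ᵐ x ∂μ, x ∈ ball z r → v x = H x := by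
    intro z hz
    obtain ⟨R, hR, hRD⟩ := Metric.isOpen_iff.1 hD z hz
    set r := R/5 with hr
    have hr0 : 0 < r := by positivity
    have hcD : closedBall z (4*r) ⊆ D := (closedBall_subset_ball (by rw [hr]; linarith)).trans hRD
    obtain ⟨G, hG1, hG2, hG3⟩ := weyl μ (hv _ hcD (isCompact_closedBall z (4*r))) hr0 (fun g hg hgc hgs j => by
      rw [← hw g ⟨hg, hgc, hgs.trans (ball_subset_closedBall.trans hcD)⟩ j]
      congr 1; ext x
      by_cases hx : x ∈ tsupport g
      · rw [indicator_of_mem (ball_subset_closedBall (hgs hx))]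
      · simp [dzb_eq_zero j hx])
    have e : ∀ x ∈ ball z r, H x = G x := by
      intro x hx
      refine Tendsto.limUnder_eq ((hG2 x hx).congr' ?_)
      filter_upwards [tendsto_rOut.eventually (gt_mem_nhds hr0)] with n hn
      refine moll_local μ fun t ht => ?_
      rw [indicator_of_mem]
      rw [mem_ball] at ht hx
      rw [mem_closedBall]
      linarith [dist_triangle t x z]
    refine ⟨r, hr0, hG1.congr e, ?_⟩
    filter_upwards [hG3] with x hx hxb
    rw [e x hxb, ← hx hxb, indicator_of_mem]
    exact ball_subset_closedBall (ball_subset_ball (by linarith) hxb)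
  refine ⟨H, ?_, ?_⟩
  · intro z hz
    obtain ⟨r, hr, h1, -⟩ := loc z hz
    exact (h1.differentiableAt (ball_mem_nhds z hr)).differentiableWithinAt
  · have : μ (D ∩ {x | v x ≠ H x}) = 0 := by
      refine measure_null_of_locally_null _ fun x hx => ?_
      obtain ⟨r, hr, -, h2⟩ := loc x hx.1
      refine ⟨_, inter_mem_nhdsWithin _ (ball_mem_nhds x hr), ?_⟩
      rw [ae_iff] at h2
      refine measure_mono_null ?_ h2
      rintro y ⟨⟨-, hy⟩, hyb⟩ h
      exact hy (h hyb)
    rw [ae_iff]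
    refine measure_mono_null ?_ this
    intro y hy
    simp only [mem_setOf_eq, Classical.not_imp] at hy
    exact ⟨hy.1, hy.2⟩

end

end WB

open Set Filter Topology Metric MeasureTheory
open scoped ENNReal NNReal InnerProductSpace ComplexConjugate

namespace WB

variable {N : ℕ}
variable {D : Set (EN N)} {φ ψ : EN N → ℝ} {η : ℕ → EN N → ℝ} {K : ℕ → Set (EN N)}

section
variable (S : Setup D φ ψ η K) (μ : Measure (EN N)) [μ.IsAddHaarMeasure]
include S

lemma Setup.pairB {g : EN N → ℂ} (hg : g ∈ Test D) (j : Fin N) : ∃ C : ℝ, ∀ y : Test D,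
    ‖∫ x, dzb j y.1 x * g x ∂μ‖ ≤ C * ‖S.B μ y‖ := by
  have cB' : ContinuousOn (fun x => (sB φ ψ x)⁻¹) D := S.cB.inv₀ fun x _ => (Real.exp_pos _).ne'
  have m : MemLp (fun x => (sB φ ψ x)⁻¹ • (conj (g x) • eb (N := N) j)) 2 μ :=
    (cont_smul_tsupport (g := g) S.hD cB' (by
      have := hg.1.continuous
      exact (Complex.continuous_conj.comp this).smul continuous_const) hg.2.2
      (fun x hx => by simp [image_eq_zero_of_notMem_tsupport hx])).memLp_of_hasCompactSupport
    (HasCompactSupport.intro hg.2.1 fun x hx => by simp [image_eq_zero_of_notMem_tsupport hx])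
  refine ⟨‖m.toLp _‖, fun y => ?_⟩
  have e : ∫ x, dzb j y.1 x * g x ∂μ = ⟪m.toLp _, S.B μ y⟫_ℂ := by
    rw [L2.inner_def]
    refine integral_congr_ae ?_
    filter_upwards [(S.mB μ y.2).coeFn_toLp, m.coeFn_toLp] with x h2 h3
    have h4 : S.B μ y x = sB φ ψ x • dbv y.1 x := h2
    have hne : ((sB φ ψ x : ℝ) : ℂ) ≠ 0 := by exact_mod_cast (Real.exp_pos _).ne'
    have hsm : ∀ (a : ℝ) (w : EN N), a • w = (a : ℂ) • w := fun a w => rfl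
    rw [h4, h3, hsm, hsm, inner_smul_left, inner_smul_left, inner_smul_right]
    have h5 : ⟪eb j, dbv y.1 x⟫_ℂ = dzb j y.1 x := by
      rw [eb, EuclideanSpace.inner_single_left, map_one, one_mul, dbv_apply]
    rw [h5]
    simp only [Complex.conj_conj, Complex.conj_ofReal, Complex.ofReal_inv, map_inv₀]
    field_simp
  rw [e]
  exact norm_inner_le_norm _ _

theorem Setup.holo {g0 : EN N → ℂ} (hg0 : g0 ∈ Test D) {ε : ℝ} (hε : 0 < ε) :
    ∃ H : EN N → ℂ, DifferentiableOn ℂ H D ∧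
      ∫⁻ x in D, ENNReal.ofReal (Real.exp (2 * ψ x - φ x) * ‖H x - g0 x‖^2) ∂μ ≤
        ENNReal.ofReal ((4 * ‖S.B μ ⟨g0, hg0⟩‖ + ε)^2) := by
  obtain ⟨x, h1, h2, h3⟩ := S.approx μ g0 hg0 hε
  obtain ⟨V, hV⟩ := cauchySeq_tendsto_of_complete
    (cauchySeq_of_le_geometric_two (f := fun n => S.A μ (x n)) (C := 2 * ε) (fun n => by
      rw [dist_comm, dist_eq_norm, ← map_sub]
      refine (h3 n).trans (le_of_eq ?_)
      ring))
  have hVn : ‖V‖ ≤ 4 * ‖S.B μ ⟨g0, hg0⟩‖ + ε := le_of_tendsto' hV.norm h2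
  have sA0 : ∀ x, sA φ ψ x ≠ 0 := fun x => (Real.exp_pos _).ne'
  have sA0' : ∀ x, ((sA φ ψ x : ℝ) : ℂ) ≠ 0 := fun x => by exact_mod_cast sA0 x
  have cA' : ContinuousOn (fun x => (sA φ ψ x)⁻¹) D := S.cA.inv₀ fun x _ => sA0 x
  set v : EN N → ℂ := fun z => g0 z - (sA φ ψ z)⁻¹ • V z with hv
  have hv1 : ∀ K ⊆ D, IsCompact K → MemLp (K.indicator v) 2 μ := by
    intro C hC hCc
    obtain ⟨M, hM⟩ := hCc.exists_bound_of_continuousOn (cA'.mono hC)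
    have i1 : MemLp (C.indicator g0) 2 μ :=
      (hg0.1.continuous.memLp_of_hasCompactSupport hg0.2.1).indicator hCc.measurableSet
    have i2 : MemLp (fun z => C.indicator (fun z => (sA φ ψ z)⁻¹) z • V z) 2 μ := by
      refine MemLp.of_le_mul (c := max M 0) (Lp.memLp V) ?_ (Eventually.of_forall fun z => ?_)
      · refine AEStronglyMeasurable.smul (f := C.indicator (fun z => (sA φ ψ z)⁻¹)) ?_ (Lp.memLp V).1
        exact (aestronglyMeasurable_indicator_iff hCc.measurableSet).2
          ((cA'.mono hC).aestronglyMeasurable hCc.measurableSet)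
      · rw [norm_smul]
        by_cases hz : z ∈ C
        · rw [indicator_of_mem hz]
          exact mul_le_mul_of_nonneg_right ((hM z hz).trans (le_max_left _ _)) (norm_nonneg _)
        · rw [indicator_of_notMem hz, norm_zero, zero_mul]
          exact mul_nonneg (le_max_right _ _) (norm_nonneg _)
    convert i1.sub i2 using 1
    ext z
    by_cases hz : z ∈ C
    · simp [hz, hv]
    · simp [hz]
  have hv2 : ∀ g ∈ Test D, ∀ j, ∫ x, v x * dzb j g x ∂μ = 0 := by
    intro g hg j
    have dg : Continuous (dzb j g) :=
      (contDiff_dzb (n := 1) (m := 0) (hg.1.of_le (by norm_num)) (by norm_num) j).continuous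
    have dgc : HasCompactSupport (dzb j g) := HasCompactSupport.intro hg.2.1 fun x hx => dzb_eq_zero j hx
    have cw : Continuous (fun x => (sA φ ψ x)⁻¹ • dzb j g x) :=
      cont_smul_tsupport S.hD cA' dg hg.2.2 (fun x hx => dzb_eq_zero j hx)
    have wc : HasCompactSupport (fun x => (sA φ ψ x)⁻¹ • dzb j g x) :=
      HasCompactSupport.intro hg.2.1 fun x hx => by simp [dzb_eq_zero j hx]
    have m : MemLp (fun x => conj ((sA φ ψ x)⁻¹ • dzb j g x)) 2 μ :=
      (Complex.continuous_conj.comp cw).memLp_of_hasCompactSupport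
        (wc.comp_left (g := fun z : ℂ => conj z) (map_zero _))
    have eI : ∀ W : Lp ℂ 2 μ, ∫ x, W x * ((sA φ ψ x)⁻¹ • dzb j g x) ∂μ = ⟪m.toLp _, W⟫_ℂ := by
      intro W
      rw [L2.inner_def]
      refine integral_congr_ae ?_
      filter_upwards [m.coeFn_toLp] with x h3
      rw [h3, RCLike.inner_apply, Complex.conj_conj]
    have i1 : Integrable (fun x => g0 x * dzb j g x) μ :=
      (hg0.1.continuous.mul dg).integrable_of_hasCompactSupport dgc.mul_left
    have i2 : Integrable (fun x => V x * ((sA φ ψ x)⁻¹ • dzb j g x)) μ := int_mul_cc μ (Lp.memLp V) cw wc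
    have e1 : ∫ x, v x * dzb j g x ∂μ = ∫ x, g0 x * dzb j g x ∂μ - ⟪m.toLp _, V⟫_ℂ := by
      rw [← eI, ← integral_sub i1 i2]
      congr 1; ext x
      simp only [hv, Complex.real_smul]; ring
    have t1 : Tendsto (fun n => ∫ x, g0 x * dzb j g x ∂μ - ⟪m.toLp _, S.A μ (x n)⟫_ℂ) atTop
        (𝓝 (∫ x, v x * dzb j g x ∂μ)) := by
      rw [e1]
      exact tendsto_const_nhds.sub ((tendsto_const_nhds).inner hV)
    have e2 : ∀ n, ∫ x, g0 x * dzb j g x ∂μ - ⟪m.toLp _, S.A μ (x n)⟫_ℂ =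
        ∫ y, dzb j (x n - ⟨g0, hg0⟩ : Test D).1 y * g y ∂μ := by
      intro n
      have e3 : ⟪m.toLp _, S.A μ (x n)⟫_ℂ = ∫ y, (x n).1 y * dzb j g y ∂μ := by
        rw [← eI]
        refine integral_congr_ae ?_
        filter_upwards [(S.mA μ (x n).2).coeFn_toLp] with y h2
        have h4 : S.A μ (x n) y = sA φ ψ y • (x n).1 y := h2
        rw [h4]
        have := sA0' y
        simp only [Complex.real_smul, Complex.ofReal_inv]
        field_simp
      have i3 : Integrable (fun y => (x n).1 y * dzb j g y) μ :=
        ((x n).2.1.continuous.mul dg).integrable_of_hasCompactSupport dgc.mul_left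
      have tn := (x n - ⟨g0, hg0⟩ : Test D).2
      rw [ibp_dzb μ (tn.1.of_le (by norm_num)) (hg.1.of_le (by norm_num)) tn.2.1, e3,
        ← integral_sub i1 i3, ← integral_neg]
      congr 1; ext y
      change _ = -(((x n).1 y - g0 y) * _)
      ring
    simp_rw [e2] at t1
    obtain ⟨C, hC⟩ := S.pairB μ hg j
    have t2 : Tendsto (fun n => ∫ y, dzb j (x n - ⟨g0, hg0⟩ : Test D).1 y * g y ∂μ) atTop (𝓝 0) := by
      refine squeeze_zero_norm (fun n => hC _) ?_
      simpa using h1.const_mul C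
    exact tendsto_nhds_unique t1 t2
  obtain ⟨H, hH, hae⟩ := weyl_open μ S.hD (v := v) hv1 hv2
  · refine ⟨H, hH, ?_⟩
    have : ENNReal.ofReal (‖V‖^2) ≤ ENNReal.ofReal ((4 * ‖S.B μ ⟨g0, hg0⟩‖ + ε)^2) :=
      ENNReal.ofReal_le_ofReal (pow_le_pow_left₀ (norm_nonneg _) hVn 2)
    refine le_trans ?_ this
    have e := lint_sq (Lp.memLp V)
    rw [Lp.toLp_coeFn] at e
    rw [← e]
    refine le_trans ?_ (setLIntegral_le_lintegral D _)
    refine lintegral_mono_ae ?_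
    filter_upwards [(ae_restrict_iff' S.hD.measurableSet).2 hae] with z hz
    refine ENNReal.ofReal_le_ofReal (le_of_eq ?_)
    rw [← hz, hv]
    simp only [sub_sub_cancel_left, norm_neg, norm_smul, norm_inv, Real.norm_eq_abs, mul_pow]
    have e2 : Real.exp (2 * ψ z - φ z) = (sA φ ψ z)^2 := by
      rw [sA, ← Real.exp_nat_mul]; congr 1; push_cast; ring
    rw [e2, inv_pow, sq_abs, ← mul_assoc, mul_inv_cancel₀ (pow_ne_zero 2 (sA0 z)), one_mul]

end

end WB

open Set Filter Topology Metric MeasureTheory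
open scoped ENNReal NNReal InnerProductSpace ComplexConjugate

namespace WB

variable {N : ℕ}

/-- a smooth strictly plurisubharmonic exhaustion -/
structure Exh (D : Set (EN N)) (ρ : EN N → ℝ) : Prop where
  hD : IsOpen D
  hρ : ContDiffOn ℝ 2 ρ D
  pos : ∀ z ∈ D, 0 ≤ ρ z
  levi : ∀ z ∈ D, ∀ b : EN N, b ≠ 0 → 0 < LeviForm ρ z b
  cpt : ∀ c : ℝ, IsCompact {z ∈ D | ρ z ≤ c}

lemma fderiv_comp_real {F : ℝ → ℝ} {ρ : EN N → ℝ} {z : EN N} (hF : ContDiff ℝ 2 F)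
    (hρ : DifferentiableAt ℝ ρ z) :
    fderiv ℝ (fun x => F (ρ x)) z = deriv F (ρ z) • fderiv ℝ ρ z := by
  have h1 : HasDerivAt F (deriv F (ρ z)) (ρ z) := (hF.differentiable (by norm_num) _).hasDerivAt
  exact (h1.comp_hasFDerivAt z hρ.hasFDerivAt).fderiv

lemma contDiff_deriv {F : ℝ → ℝ} (hF : ContDiff ℝ 2 F) : ContDiff ℝ 1 (deriv F) :=
  ((contDiff_succ_iff_deriv (n := 1)).1 (hF.of_le (by norm_num))).2.2

lemma hess_comp {F : ℝ → ℝ} {ρ : EN N → ℝ} {z : EN N} (hF : ContDiff ℝ 2 F)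
    (hρ : ContDiffAt ℝ 2 ρ z) (v : EN N) :
    Hess (fun x => F (ρ x)) z v v =
      deriv F (ρ z) * Hess ρ z v v + deriv (deriv F) (ρ z) * (fderiv ℝ ρ z v)^2 := by
  have h1 : fderiv ℝ (fun x => F (ρ x)) =ᶠ[𝓝 z] fun x => deriv F (ρ x) • fderiv ℝ ρ x := by
    filter_upwards [hρ.eventually (by norm_num)] with x hx
    exact fderiv_comp_real hF (hx.differentiableAt (by norm_num))
  have hd : DifferentiableAt ℝ ρ z := hρ.differentiableAt (by norm_num)
  have h2 : HasDerivAt (deriv F) (deriv (deriv F) (ρ z)) (ρ z) :=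
    ((contDiff_deriv hF).differentiable (by norm_num) _).hasDerivAt
  have h3 : HasFDerivAt (fun x => deriv F (ρ x)) _ z := h2.comp_hasFDerivAt z hd.hasFDerivAt
  have h4 : HasFDerivAt (fderiv ℝ ρ) (fderiv ℝ (fderiv ℝ ρ) z) z :=
    ((hρ.fderiv_right (m := 1) (by norm_num)).differentiableAt (by norm_num)).hasFDerivAt
  have h5 := h3.smul h4
  unfold Hess
  rw [h1.fderiv_eq]
  erw [h5.fderiv]
  simp only [ContinuousLinearMap.add_apply, ContinuousLinearMap.smul_apply,
    ContinuousLinearMap.smulRight_apply, smul_eq_mul]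
  ring

lemma levi_comp_ge {F : ℝ → ℝ} {ρ : EN N → ℝ} {z : EN N} (hF : ContDiff ℝ 2 F)
    (hρ : ContDiffAt ℝ 2 ρ z) (h2 : 0 ≤ deriv (deriv F) (ρ z)) (b : EN N) :
    deriv F (ρ z) * LeviForm ρ z b ≤ LeviForm (fun x => F (ρ x)) z b := by
  unfold LeviForm
  rw [hess_comp hF hρ, hess_comp hF hρ]
  nlinarith [mul_nonneg h2 (sq_nonneg (fderiv ℝ ρ z b)),
    mul_nonneg h2 (sq_nonneg (fderiv ℝ ρ z (Complex.I • b)))]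

lemma norm_dz_cx_le {ρ : EN N → ℝ} {z : EN N} (h : DifferentiableAt ℝ ρ z) (j : Fin N) :
    ‖dz j (cx ρ) z‖ ≤ ‖fderiv ℝ ρ z‖ := by
  have h1 : ∀ v : EN N, ‖v‖ = 1 → ‖fderiv ℝ (cx ρ) z v‖ ≤ ‖fderiv ℝ ρ z‖ := by
    intro v hv
    rw [fderiv_cx h, Complex.norm_real]
    simpa [hv] using (fderiv ℝ ρ z).le_opNorm v
  have e1 : ‖eb (N := N) j‖ = 1 := by simp [eb]
  have e2 : ‖Complex.I • eb (N := N) j‖ = 1 := by rw [norm_smul, e1]; simp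
  have := norm_sub_le (fderiv ℝ (cx ρ) z (eb j)) (Complex.I * fderiv ℝ (cx ρ) z (Complex.I • eb j))
  rw [norm_mul, Complex.norm_I, one_mul] at this
  unfold dz
  rw [norm_mul]
  have h3 := h1 _ e1; have h4 := h1 _ e2
  norm_num
  linarith

lemma sum_dz_comp_le {F : ℝ → ℝ} {ρ : EN N → ℝ} {z : EN N} (hF : ContDiff ℝ 2 F)
    (hρ : DifferentiableAt ℝ ρ z) :
    ∑ j, ‖dz j (cx (fun x => F (ρ x))) z‖^2 ≤ N * (|deriv F (ρ z)| * ‖fderiv ℝ ρ z‖)^2 := by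
  have hd : DifferentiableAt ℝ (fun x => F (ρ x)) z :=
    (hF.differentiable (by norm_num) _).comp z hρ
  have : ∀ j ∈ (Finset.univ : Finset (Fin N)), ‖dz j (cx (fun x => F (ρ x))) z‖^2 ≤ (|deriv F (ρ z)| * ‖fderiv ℝ ρ z‖)^2 := by
    intro j _
    have h := norm_dz_cx_le hd j
    rw [fderiv_comp_real hF hρ, norm_smul, Real.norm_eq_abs] at h
    exact pow_le_pow_left₀ (norm_nonneg _) h 2
  simpa using Finset.sum_le_card_nsmul _ _ _ this

section
variable {D : Set (EN N)} {ρ : EN N → ℝ} (E : Exh D ρ)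
include E

lemma Exh.cda {z : EN N} (hz : z ∈ D) : ContDiffAt ℝ 2 ρ z := E.hρ.contDiffAt (E.hD.mem_nhds hz)

lemma Exh.cont_fderiv : ContinuousOn (fderiv ℝ ρ) D := fun z hz =>
  (((E.cda hz).fderiv_right (m := 1) (by norm_num)).continuousAt).continuousWithinAt

lemma Exh.cont_fderiv2 : ContinuousOn (fderiv ℝ (fderiv ℝ ρ)) D := fun z hz =>
  ((((E.cda hz).fderiv_right (m := 1) (by norm_num)).fderiv_right (m := 0)
    (by norm_num)).continuousAt).continuousWithinAt

lemma Exh.bdd_fderiv (c : ℝ) : ∃ C, 0 ≤ C ∧ ∀ z ∈ D, ρ z ≤ c → ‖fderiv ℝ ρ z‖ ≤ C := by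
  obtain ⟨C, hC⟩ := (E.cpt c).exists_bound_of_continuousOn (E.cont_fderiv.mono fun z hz => hz.1)
  exact ⟨max C 0, le_max_right _ _, fun z hz h => (hC z ⟨hz, h⟩).trans (le_max_left _ _)⟩

lemma Exh.levi_lower (c : ℝ) : ∃ m > 0, ∀ z ∈ D, ρ z ≤ c → ∀ b, m * ‖b‖^2 ≤ LeviForm ρ z b := by
  have hc : IsCompact ({z ∈ D | ρ z ≤ c} ×ˢ sphere (0:EN N) 1) := (E.cpt c).prod (isCompact_sphere 0 1)
  have c2 : ContinuousOn (fun p : EN N × EN N => fderiv ℝ (fderiv ℝ ρ) p.1)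
      ({z ∈ D | ρ z ≤ c} ×ˢ sphere (0:EN N) 1) :=
    E.cont_fderiv2.comp continuousOn_fst (fun p hp => hp.1.1)
  have cont : ContinuousOn (fun p : EN N × EN N => LeviForm ρ p.1 p.2)
      ({z ∈ D | ρ z ≤ c} ×ˢ sphere (0:EN N) 1) := by
    unfold LeviForm Hess
    have a1 : ContinuousOn (fun p : EN N × EN N => p.2) ({z ∈ D | ρ z ≤ c} ×ˢ sphere (0:EN N) 1) :=
      continuousOn_snd
    have a2 : ContinuousOn (fun p : EN N × EN N => Complex.I • p.2) ({z ∈ D | ρ z ≤ c} ×ˢ sphere (0:EN N) 1) :=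
      a1.fun_const_smul _
    exact (((c2.clm_apply a1).clm_apply a1).add ((c2.clm_apply a2).clm_apply a2)).div_const _
  obtain ⟨m, hm, h⟩ := hc.exists_forall_le' cont (a := 0) (fun p hp => E.levi p.1 hp.1.1 p.2
    (by intro h0; have := hp.2; simp [h0] at this))
  refine ⟨m, hm, fun z hz hzc b => ?_⟩
  by_cases hb : b = 0
  · simp [hb, LeviForm, Hess]
  have hbn : 0 < ‖b‖ := norm_pos_iff.2 hb
  have h1 := h (z, (‖b‖⁻¹ : ℝ) • b) ⟨⟨hz, hzc⟩, by
    rw [mem_sphere_zero_iff_norm, norm_smul, norm_inv, norm_norm, inv_mul_cancel₀ hbn.ne']⟩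
  have h2 : LeviForm ρ z ((‖b‖⁻¹ : ℝ) • b) = (‖b‖⁻¹)^2 * LeviForm ρ z b := by
    unfold LeviForm Hess
    rw [smul_comm Complex.I]
    simp only [map_smul, ContinuousLinearMap.smul_apply, smul_eq_mul]
    ring
  simp only [h2] at h1
  rw [inv_pow, inv_mul_eq_div, le_div_iff₀ (by positivity)] at h1
  exact h1

end

end WB

open Set Filter Topology Metric MeasureTheory
open scoped ENNReal NNReal InnerProductSpace ComplexConjugate

namespace WB

variable {N : ℕ}

lemma hasDerivAt_pp (k : ℕ) (t : ℝ) :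
    HasDerivAt (fun t : ℝ => (max t 0)^(k+2)) ((k+2) * (max t 0)^(k+1)) t := by
  rcases lt_trichotomy t 0 with h | h | h
  · have e : (fun t : ℝ => (max t 0)^(k+2)) =ᶠ[𝓝 t] fun _ => 0 := by
      filter_upwards [gt_mem_nhds h] with s hs
      simp [max_eq_right hs.le]
    rw [max_eq_right h.le]
    simpa using (hasDerivAt_const t (0:ℝ)).congr_of_eventuallyEq e
  · subst h
    simp only [max_self]
    rw [hasDerivAt_iff_isLittleO]
    simp only [max_self, sub_zero]
    have : (fun x : ℝ => (max x 0)^(k+2)) =o[𝓝 0] fun x => x := by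
      have h1 : (fun x : ℝ => x^(k+2)) =o[𝓝 0] fun x => x := by
        simpa using Asymptotics.isLittleO_pow_pow (𝕜 := ℝ) (m := 1) (n := k+2) (by omega)
      refine (Asymptotics.IsBigO.of_bound 1 (Eventually.of_forall fun x => ?_)).trans_isLittleO h1
      rw [one_mul, norm_pow, norm_pow]
      refine pow_le_pow_left₀ (norm_nonneg _) ?_ _
      rw [Real.norm_eq_abs, Real.norm_eq_abs, abs_of_nonneg (le_max_right _ _)]
      exact max_le (le_abs_self _) (abs_nonneg _)
    simpa using this
  · have e : (fun t : ℝ => (max t 0)^(k+2)) =ᶠ[𝓝 t] fun t => t^(k+2) := by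
      filter_upwards [lt_mem_nhds h] with s hs
      simp [max_eq_left (le_of_lt hs)]
    rw [max_eq_left h.le]
    simpa using (hasDerivAt_pow (k+2) t).congr_of_eventuallyEq e

/-- the C2 function max(t,0)^3 -/
noncomputable def X3 (t : ℝ) : ℝ := (max t 0)^3

lemma X3_deriv (t : ℝ) : HasDerivAt X3 (3 * (max t 0)^2) t := by
  have := hasDerivAt_pp 1 t
  norm_num at this
  exact this

lemma X3_deriv2 (t : ℝ) : HasDerivAt (fun t : ℝ => 3 * (max t 0)^2) (6 * max t 0) t := by
  have := (hasDerivAt_pp 0 t).const_mul 3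
  norm_num at this
  refine this.congr_deriv ?_
  ring

lemma X3_contDiff : ContDiff ℝ 2 X3 := by
  have e1 : deriv X3 = fun t => 3 * (max t 0)^2 := funext fun t => (X3_deriv t).deriv
  have e2 : deriv (fun t : ℝ => 3 * (max t 0)^2) = fun t => 6 * max t 0 := funext fun t => (X3_deriv2 t).deriv
  have h1 : ContDiff ℝ 1 (fun t : ℝ => 3 * (max t 0)^2) := by
    rw [contDiff_one_iff_deriv]
    refine ⟨fun t => (X3_deriv2 t).differentiableAt, ?_⟩
    rw [e2]; fun_prop
  have := (contDiff_succ_iff_deriv (n := 1) (f := X3)).2 ⟨fun t => (X3_deriv t).differentiableAt, by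
    intro h; simp at h, by rw [e1]; exact h1⟩
  exact this.of_le (by norm_num)

lemma X3_nonneg (t : ℝ) : 0 ≤ X3 t := pow_nonneg (le_max_right _ _) _

lemma X3_zero {t : ℝ} (h : t ≤ 0) : X3 t = 0 := by simp [X3, max_eq_right h]

lemma X3_one_le {t : ℝ} (h : 1 ≤ t) : 1 ≤ X3 t := one_le_pow₀ (h.trans (le_max_left _ _))

lemma exists_conv (a : ℕ → ℝ) : ∃ F : ℝ → ℝ, ContDiff ℝ 2 F ∧
    (∀ t, 0 ≤ F t ∧ 0 ≤ deriv F t ∧ 0 ≤ deriv (deriv F) t) ∧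
    ∀ t, 0 ≤ t → a ⌊t⌋₊ ≤ F t ∧ a ⌊t⌋₊ ≤ deriv F t := by
  set S : ℕ → ℝ → ℝ := fun M t => ∑ n ∈ Finset.range (M+1), |a n| * X3 (t + 1 - n) with hS
  have Sc : ∀ M, ContDiff ℝ 2 (S M) := by
    intro M
    refine ContDiff.sum fun n _ => contDiff_const.mul (X3_contDiff.comp ?_)
    fun_prop
  have S1 : ∀ (M : ℕ) (t : ℝ), HasDerivAt (S M) (∑ n ∈ Finset.range (M+1), |a n| * (3 * (max (t+1-n) 0)^2)) t := by
    intro M t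
    refine HasDerivAt.fun_sum fun n _ => HasDerivAt.const_mul _ ?_
    have := (X3_deriv (t+1-n)).comp t (((hasDerivAt_id t).add_const 1).sub_const (n:ℝ))
    simpa [Function.comp_def] using this
  have S2 : ∀ (M : ℕ) (t : ℝ), HasDerivAt (deriv (S M)) (∑ n ∈ Finset.range (M+1), |a n| * (6 * (max (t+1-n) 0))) t := by
    intro M t
    have e : deriv (S M) = fun t : ℝ => ∑ n ∈ Finset.range (M+1), |a n| * (3 * (max (t+1-n) 0)^2) :=
      funext fun t => (S1 M t).deriv
    rw [e]
    refine HasDerivAt.fun_sum fun n _ => HasDerivAt.const_mul _ ?_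
    have := (X3_deriv2 (t+1-n)).comp t (((hasDerivAt_id t).add_const 1).sub_const (n:ℝ))
    simpa [Function.comp_def] using this
  have mono : ∀ {M M' : ℕ} {t : ℝ}, M ≤ M' → t ≤ M → S M t = S M' t := by
    intro M M' t hM ht
    refine Finset.sum_subset (Finset.range_mono (by omega)) fun n _ hn => ?_
    rw [Finset.mem_range, not_lt] at hn
    have : (M:ℝ) + 1 ≤ n := by exact_mod_cast hn
    rw [X3_zero (by linarith), mul_zero]
  set F : ℝ → ℝ := fun t => S ⌈t⌉₊ t with hF
  have FS : ∀ (M : ℕ) (t : ℝ), t ≤ M → F t = S M t := fun M t ht =>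
    mono (Nat.ceil_le.2 ht) (Nat.le_ceil t)
  have FE : ∀ (M : ℕ) (t : ℝ), t < M → F =ᶠ[𝓝 t] S M := fun M t ht => by
    filter_upwards [gt_mem_nhds ht] with s hs using FS M s (le_of_lt hs)
  have ex : ∀ t : ℝ, ∃ M : ℕ, t < M := fun t => exists_nat_gt t
  refine ⟨F, contDiff_iff_contDiffAt.2 fun t => ?_, fun t => ?_, fun t ht => ?_⟩
  · obtain ⟨M, hM⟩ := ex t
    exact (Sc M).contDiffAt.congr_of_eventuallyEq (FE M t hM)
  · obtain ⟨M, hM⟩ := ex t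
    have e := FE M t hM
    rw [e.eq_of_nhds, e.deriv_eq, e.deriv.deriv_eq, (S1 M t).deriv, (S2 M t).deriv]
    refine ⟨Finset.sum_nonneg fun n _ => mul_nonneg (abs_nonneg _) (X3_nonneg _),
      Finset.sum_nonneg fun n _ => by positivity, Finset.sum_nonneg fun n _ => by positivity⟩
  · obtain ⟨M, hM⟩ := ex t
    have e := FE M t hM
    have hn : ⌊t⌋₊ ∈ Finset.range (M+1) := by
      rw [Finset.mem_range]
      have : ⌊t⌋₊ < M := (Nat.floor_lt ht).2 hM
      omega
    have h1 : 1 ≤ t + 1 - ⌊t⌋₊ := by linarith [Nat.floor_le ht]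
    rw [e.eq_of_nhds, e.deriv_eq, (S1 M t).deriv]
    constructor
    · refine le_trans ?_ (Finset.single_le_sum (f := fun n : ℕ => |a n| * X3 (t + 1 - n))
        (fun n _ => mul_nonneg (abs_nonneg _) (X3_nonneg _)) hn)
      nlinarith [le_abs_self (a ⌊t⌋₊), abs_nonneg (a ⌊t⌋₊), X3_one_le h1]
    · refine le_trans ?_ (Finset.single_le_sum (f := fun n : ℕ => |a n| * (3 * (max (t+1-n) 0)^2))
        (fun n _ => by positivity) hn)
      have : 1 ≤ (max (t+1-⌊t⌋₊) 0)^2 := one_le_pow₀ (h1.trans (le_max_left _ _))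
      nlinarith [le_abs_self (a ⌊t⌋₊), abs_nonneg (a ⌊t⌋₊)]

end WB

open Set Filter Topology Metric MeasureTheory
open scoped ENNReal NNReal InnerProductSpace ComplexConjugate

namespace WB

variable {N : ℕ}

/-- smooth cutoff: 1 for t ≤ 0, 0 for t ≥ 1 -/
noncomputable def Th (t : ℝ) : ℝ := Real.smoothTransition (1 - t)

lemma Th_contDiff : ContDiff ℝ 2 Th :=
  Real.smoothTransition.contDiff.comp (contDiff_const.sub contDiff_id)

lemma Th_mem (t : ℝ) : Th t ∈ Icc (0:ℝ) 1 :=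
  ⟨Real.smoothTransition.nonneg _, Real.smoothTransition.le_one _⟩

lemma Th_one {t : ℝ} (h : t ≤ 0) : Th t = 1 := Real.smoothTransition.one_of_one_le (by linarith)

lemma Th_zero {t : ℝ} (h : 1 ≤ t) : Th t = 0 := Real.smoothTransition.zero_of_nonpos (by linarith)

lemma Th_deriv_one {t : ℝ} (h : t ≤ 0) : deriv Th t = 0 := by
  refine IsLocalMax.deriv_eq_zero (Eventually.of_forall fun s => ?_)
  rw [Th_one h]; exact (Th_mem s).2

lemma Th_deriv_zero {t : ℝ} (h : 1 ≤ t) : deriv Th t = 0 := by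
  refine IsLocalMin.deriv_eq_zero (Eventually.of_forall fun s => ?_)
  rw [Th_zero h]; exact (Th_mem s).1

lemma Th_deriv_bdd : ∃ C, 0 ≤ C ∧ ∀ t, |deriv Th t| ≤ C := by
  obtain ⟨C, hC⟩ := (isCompact_Icc (a := (0:ℝ)) (b := 1)).exists_bound_of_continuousOn
    ((contDiff_deriv Th_contDiff).continuous.continuousOn)
  refine ⟨max C 0, le_max_right _ _, fun t => ?_⟩
  rcases le_total t 0 with h | h
  · simp [Th_deriv_one h]
  rcases le_total 1 t with h' | h'
  · simp [Th_deriv_zero h']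
  · exact (hC t ⟨h, h'⟩).trans (le_max_left _ _)

section
variable {D : Set (EN N)} {ρ : EN N → ℝ} (E : Exh D ρ)
include E

open Classical in
lemma setup_of_exh : ∃ (a : ℕ → ℝ) (G : ℝ → ℝ) (η : ℕ → EN N → ℝ) (K : ℕ → Set (EN N)), ContDiff ℝ 2 G ∧
    ∀ F : ℝ → ℝ, ContDiff ℝ 2 F → (∀ t, 0 ≤ t → a ⌊t⌋₊ ≤ deriv F t ∧ 0 ≤ deriv (deriv F) t) →
      Setup D (fun x => F (ρ x)) (fun x => G (ρ x)) η K := by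
  obtain ⟨C, hC0, hC⟩ := Th_deriv_bdd
  choose P hP0 hP using fun k : ℕ => E.bdd_fderiv (k+1)
  choose m hm0 hm using fun k : ℕ => E.levi_lower (k+1)
  obtain ⟨G, hG, hG0, hGa⟩ := exists_conv (fun k => Real.log (1 + N * (C * P k)^2))
  have hGd : ∀ k : ℕ, ∃ B, ∀ t ∈ Icc (0:ℝ) (k+1), ‖deriv G t‖ ≤ B := fun k =>
    (isCompact_Icc).exists_bound_of_continuousOn ((contDiff_deriv hG).continuous.continuousOn)
  have hGe : ∀ k : ℕ, ∃ B, ∀ t ∈ Icc (0:ℝ) (k+1), ‖Real.exp (G t)‖ ≤ B := fun k =>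
    (isCompact_Icc).exists_bound_of_continuousOn ((Real.continuous_exp.comp hG.continuous).continuousOn)
  choose Gd hGd using hGd
  choose Ge hGe using hGe
  set η : ℕ → EN N → ℝ := fun n x => if x ∈ D then Th (ρ x - n) else 0 with hη
  have fl : ∀ z ∈ D, ρ z ∈ Icc (0:ℝ) (⌊ρ z⌋₊ + 1) := fun z hz => ⟨E.pos z hz, (Nat.lt_floor_add_one _).le⟩
  have ηloc : ∀ n, ∀ z ∈ D, η n =ᶠ[𝓝 z] fun x => (fun t => Th (t - n)) (ρ x) := by
    intro n z hz
    filter_upwards [E.hD.mem_nhds hz] with x hx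
    simp [hη, hx]
  have ηsupp : ∀ n, Function.support (η n) ⊆ {z ∈ D | ρ z ≤ n+1} := by
    intro n x hx
    by_contra h
    apply hx
    by_cases hxD : x ∈ D
    · have : ¬ ρ x ≤ n + 1 := fun h' => h ⟨hxD, h'⟩
      simp only [hη, hxD, if_true]
      exact Th_zero (by linarith)
    · simp [hη, hxD]
  have ηts : ∀ n, tsupport (η n) ⊆ {z ∈ D | ρ z ≤ n+1} := fun n =>
    closure_minimal (ηsupp n) (E.cpt _).isClosed
  have Thn : ∀ n : ℕ, ContDiff ℝ 2 (fun t => Th (t - n)) := fun n =>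
    Th_contDiff.comp (contDiff_id.sub contDiff_const)
  have dThn : ∀ (n : ℕ) (t : ℝ), deriv (fun t => Th (t - n)) t = deriv Th (t - n) := fun n t =>
    deriv_comp_sub_const ..
  have dη : ∀ n, ∀ z ∈ D, ∑ j, ‖dz j (cx (η n)) z‖^2 ≤ N * (|deriv Th (ρ z - n)| * ‖fderiv ℝ ρ z‖)^2 := by
    intro n z hz
    have h1 := sum_dz_comp_le (Thn n) ((E.cda hz).differentiableAt (by norm_num))
    rw [dThn] at h1
    refine le_of_eq_of_le (Finset.sum_congr rfl fun j _ => ?_) h1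
    have e : cx (η n) =ᶠ[𝓝 z] cx (fun x => Th (ρ x - n)) :=
      (ηloc n z hz).fun_comp (fun t : ℝ => (t:ℂ))
    rw [dz_congr j e]
  refine ⟨fun k => (2 * (N * (Gd k * P k)^2) + Ge k) / m k, G, η, fun n => {z ∈ D | ρ z ≤ n}, hG, fun F hF hFa => ?_⟩
  refine ⟨E.hD, hF.comp_contDiffOn E.hρ, hG.comp_contDiffOn E.hρ, ?_, ?_, ?_, ?_, ?_, ?_, ?_, ?_, ?_, ?_, ?_⟩
  · intro z hz b
    set k := ⌊ρ z⌋₊ with hk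
    have hz1 := (fl z hz)
    obtain ⟨h1, h2⟩ := hFa (ρ z) (E.pos z hz)
    have h3 := levi_comp_ge hF (E.cda hz) h2 b
    have h4 := hm k z hz hz1.2 b
    have h5 := sum_dz_comp_le hG ((E.cda hz).differentiableAt (by norm_num))
    have h6 : (|deriv G (ρ z)| * ‖fderiv ℝ ρ z‖)^2 ≤ (Gd k * P k)^2 := by
      have a1 := hGd k _ hz1
      have a2 := hP k z hz hz1.2
      rw [Real.norm_eq_abs] at a1
      exact pow_le_pow_left₀ (by positivity) (mul_le_mul a1 a2 (norm_nonneg _) ((abs_nonneg _).trans a1)) 2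
    have h7 := hGe k _ hz1
    rw [Real.norm_eq_abs, abs_of_pos (Real.exp_pos _)] at h7
    have h8 : 0 ≤ Ge k := (Real.exp_pos _).le.trans h7
    rw [← hk, div_le_iff₀ (hm0 k)] at h1
    have h9 : 0 ≤ deriv F (ρ z) := by
      by_contra hneg
      push Not at hneg
      have : 0 ≤ 2 * (N * (Gd k * P k)^2) + Ge k := by positivity
      nlinarith [hm0 k]
    refine le_trans ?_ h3
    refine le_trans ?_ (mul_le_mul_of_nonneg_left h4 h9)
    rw [← mul_assoc]
    refine mul_le_mul_of_nonneg_right ?_ (by positivity)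
    have : (N:ℝ) * (|deriv G (ρ z)| * ‖fderiv ℝ ρ z‖)^2 ≤ N * (Gd k * P k)^2 := by gcongr
    linarith
  · intro n
    refine contDiff_iff_contDiffAt.2 fun z => ?_
    by_cases hz : z ∈ D
    · exact ((Thn n).contDiffAt.comp z (E.cda hz)).congr_of_eventuallyEq (ηloc n z hz)
    · have : z ∉ tsupport (η n) := fun h => hz (ηts n h).1
      exact contDiffAt_const.congr_of_eventuallyEq (notMem_tsupport_iff_eventuallyEq.1 this)
  · exact fun n => (E.cpt (n+1)).of_isClosed_subset (isClosed_tsupport _) (ηts n)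
  · exact fun n x hx => (ηts n hx).1
  · intro n x
    simp only [hη]
    split_ifs
    · exact Th_mem _
    · simp
  · intro n x hx
    simp only [hη, hx.1, if_true]
    exact Th_one (by linarith [hx.2])
  · intro n x hx j
    have h1 := dη n x hx.1
    rw [Th_deriv_one (by linarith [hx.2])] at h1
    have h2 := (Finset.single_le_sum (f := fun j => ‖dz j (cx (η n)) x‖^2) (fun j _ => by positivity) (Finset.mem_univ j)).trans h1
    simp only [abs_zero, zero_mul, ne_eq, OfNat.ofNat_ne_zero, not_false_eq_true, zero_pow, mul_zero] at h2
    have := pow_eq_zero_iff (two_ne_zero) |>.1 (le_antisymm h2 (by positivity))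
    exact norm_eq_zero.1 this
  · intro n x hx
    refine (dη n x hx).trans ?_
    have hx1 := fl x hx
    have h1 := (hGa (ρ x) (E.pos x hx)).1
    have h2 : 1 + N * (C * P ⌊ρ x⌋₊)^2 ≤ Real.exp (G (ρ x)) := by
      rw [← Real.log_le_iff_le_exp (by positivity)]; exact h1
    have h3 : (|deriv Th (ρ x - n)| * ‖fderiv ℝ ρ x‖)^2 ≤ (C * P ⌊ρ x⌋₊)^2 :=
      pow_le_pow_left₀ (by positivity) (mul_le_mul (hC _) (hP _ x hx hx1.2) (norm_nonneg _) hC0) 2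
    have : (N:ℝ) * (|deriv Th (ρ x - n)| * ‖fderiv ℝ ρ x‖)^2 ≤ N * (C * P ⌊ρ x⌋₊)^2 := by gcongr
    linarith
  · exact fun n => (E.cpt n).isClosed.measurableSet
  · intro n n' h z hz
    exact ⟨hz.1, hz.2.trans (by exact_mod_cast h)⟩
  · ext z
    simp only [mem_iUnion]
    exact ⟨fun ⟨n, h⟩ => h.1, fun h => (exists_nat_ge (ρ z)).imp fun n hn => ⟨h, hn⟩⟩

end

end WB

open Set Filter Topology Metric MeasureTheory
open scoped ENNReal NNReal InnerProductSpace ComplexConjugate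

namespace WB

variable {N : ℕ}

section
variable {D : Set (EN N)} {ρ : EN N → ℝ} (E : Exh D ρ) (μ : Measure (EN N)) [μ.IsAddHaarMeasure]
include E

/-- approximate solution of the d-bar equation on sublevel sets -/
lemma Exh.approx {c c' : ℝ} (hc : c < c') : ∃ C, 0 < C ∧ ∀ g ∈ Test D, ∀ ε > 0,
    (∀ z ∈ D, ρ z ≤ c' → ∑ j, ‖dzb j g z‖^2 ≤ ε^2) →
    ∃ H : EN N → ℂ, DifferentiableOn ℂ H D ∧
      ∫⁻ x in {z ∈ D | ρ z < c}, ENNReal.ofReal (‖H x - g x‖^2) ∂μ ≤ ENNReal.ofReal (C * ε^2) := by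
  obtain ⟨a, G, η, K, hG, hS⟩ := setup_of_exh E
  obtain ⟨F, hF, hF0, hFa⟩ := exists_conv a
  have hρc : ContinuousOn ρ D := E.hρ.continuousOn
  have cn : ∀ (A : ℝ → ℝ), Continuous A → ∀ d : ℝ, ∃ M, 0 < M ∧ ∀ z ∈ D, ρ z ≤ d → A (ρ z) ≤ M := by
    intro A hA d
    obtain ⟨M, hM⟩ := (isCompact_Icc (a := 0) (b := d)).exists_bound_of_continuousOn hA.continuousOn
    refine ⟨max M 1, lt_max_of_lt_right one_pos, fun z hz h => ?_⟩
    exact (le_abs_self _).trans ((hM _ ⟨E.pos z hz, h⟩).trans (le_max_left _ _))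
  obtain ⟨M, hM0, hM⟩ := cn (fun t => Real.exp (G t - F t)) (Real.continuous_exp.comp (hG.continuous.sub hF.continuous)) c'
  obtain ⟨m, hm0, hm⟩ := cn (fun t => Real.exp (F t - 2 * G t))
    (Real.continuous_exp.comp (hF.continuous.sub (continuous_const.mul hG.continuous))) c
  set Kc := {z ∈ D | ρ z ≤ c'} with hKc
  have hKfin : μ Kc ≠ ⊤ := (E.cpt c').measure_lt_top.ne
  set V := (μ Kc).toReal with hV
  have hV0 : 0 ≤ V := ENNReal.toReal_nonneg
  set Q := (4 * Real.sqrt (M * V + 1) + 1)^2 with hQ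
  refine ⟨m * Q, by positivity, fun g hg ε hε hgε => ?_⟩
  set Ft : ℝ → ℝ → ℝ := fun t s => F s + t * X3 (s - c) with hFt
  have hFtc : ∀ t, ContDiff ℝ 2 (Ft t) := fun t =>
    hF.add (contDiff_const.mul (X3_contDiff.comp (contDiff_id.sub contDiff_const)))
  have d1 : ∀ t s, HasDerivAt (Ft t) (deriv F s + t * (3 * (max (s - c) 0)^2)) s := by
    intro t s
    have h1 := (hF.differentiable (by norm_num) s).hasDerivAt
    have h2 := (X3_deriv (s - c)).comp s ((hasDerivAt_id s).sub_const c)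
    simp only [mul_one] at h2
    exact h1.add (h2.const_mul t)
  have d2 : ∀ t s, HasDerivAt (deriv (Ft t)) (deriv (deriv F) s + t * (6 * (max (s - c) 0))) s := by
    intro t s
    have e : deriv (Ft t) = fun s => deriv F s + t * (3 * (max (s - c) 0)^2) := funext fun s => (d1 t s).deriv
    rw [e]
    have h1 := ((contDiff_deriv hF).differentiable (by norm_num) s).hasDerivAt
    have h2 := (X3_deriv2 (s - c)).comp s ((hasDerivAt_id s).sub_const c)
    simp only [mul_one] at h2
    exact h1.add (h2.const_mul t)
  have St : ∀ t, 0 ≤ t → Setup D (fun x => Ft t (ρ x)) (fun x => G (ρ x)) η K := by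
    intro t ht
    refine hS _ (hFtc t) fun s hs => ?_
    rw [(d1 t s).deriv, (d2 t s).deriv]
    have b1 := (hFa s hs).2
    have b2 := (hF0 s).2.2
    have b3 : 0 ≤ max (s - c) 0 := le_max_right _ _
    exact ⟨by have : 0 ≤ t * (3 * (max (s - c) 0)^2) := by positivity
              linarith, by positivity⟩
  have S0 : Setup D (fun x => F (ρ x)) (fun x => G (ρ x)) η K :=
    hS _ hF fun s hs => ⟨(hFa s hs).2, (hF0 s).2.2⟩
  set J := ‖S0.B μ ⟨g, hg⟩‖^2 with hJ
  have hJ0 : 0 ≤ J := by positivity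
  set x0 := X3 (c' - c) with hx0
  have hx0p : 0 < x0 := by
    simp only [hx0, X3]; exact pow_pos (lt_max_of_lt_left (by linarith)) _
  obtain ⟨t, ht0, ht⟩ : ∃ t, 0 ≤ t ∧ Real.exp (-(t * x0)) * J ≤ ε^2 := by
    have h1 : Tendsto (fun t : ℝ => Real.exp (-(t * x0)) * J) atTop (𝓝 (0 * J)) :=
      (Real.tendsto_exp_neg_atTop_nhds_zero.comp (tendsto_id.atTop_mul_const hx0p)).mul_const J
    rw [zero_mul] at h1
    have h2 := (h1.eventually (gt_mem_nhds (show (0:ℝ) < ε^2 by positivity))).and (eventually_ge_atTop 0)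
    obtain ⟨t, h3, h4⟩ := h2.exists
    exact ⟨t, h4, h3.le⟩
  have hB : ‖(St t ht0).B μ ⟨g, hg⟩‖^2 ≤ (M * V + 1) * ε^2 := by
    have h1 := (St t ht0).lint_B μ ⟨g, hg⟩
    have h0 := S0.lint_B μ ⟨g, hg⟩
    have h2 : ∀ x, ENNReal.ofReal (Real.exp (G (ρ x) - Ft t (ρ x)) * ∑ j, ‖dzb j g x‖^2) ≤
        Kc.indicator (fun _ => ENNReal.ofReal (M * ε^2)) x + ENNReal.ofReal (Real.exp (-(t * x0))) *
          ENNReal.ofReal (Real.exp (G (ρ x) - F (ρ x)) * ∑ j, ‖dzb j g x‖^2) := by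
      intro x
      by_cases hx : x ∈ D
      · have hsum : 0 ≤ ∑ j, ‖dzb j g x‖^2 := Finset.sum_nonneg fun j _ => by positivity
        by_cases hxc : ρ x ≤ c'
        · rw [indicator_of_mem (show x ∈ Kc from ⟨hx, hxc⟩)]
          refine le_trans (ENNReal.ofReal_le_ofReal ?_) le_self_add
          refine mul_le_mul ?_ (hgε x hx hxc) hsum hM0.le
          refine le_trans (Real.exp_le_exp.2 ?_) (hM x hx hxc)
          have := mul_nonneg ht0 (X3_nonneg (ρ x - c))
          simp only [hFt]; linarith
        · push Not at hxc
          refine le_trans ?_ le_add_self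
          rw [← ENNReal.ofReal_mul (Real.exp_pos _).le, ← mul_assoc, ← Real.exp_add]
          refine ENNReal.ofReal_le_ofReal (mul_le_mul_of_nonneg_right (Real.exp_le_exp.2 ?_) hsum)
          have : x0 ≤ X3 (ρ x - c) :=
            pow_le_pow_left₀ (le_max_right _ _) (max_le_max_right _ (by linarith)) _
          have := mul_le_mul_of_nonneg_left this ht0
          simp only [hFt]; linarith
      · have : ∀ j, dzb j g x = 0 := fun j => dzb_eq_zero j fun h => hx (hg.2.2 h)
        simp [this]
    have h3 := lintegral_mono (μ := μ) h2
    rw [lintegral_add_left (measurable_const.indicator (E.cpt c').isClosed.measurableSet),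
      lintegral_const_mul' _ _ ENNReal.ofReal_ne_top,
      lintegral_indicator_const (E.cpt c').isClosed.measurableSet] at h3
    have h1' : ∫⁻ x, ENNReal.ofReal (Real.exp (G (ρ x) - Ft t (ρ x)) * ∑ j, ‖dzb j g x‖^2) ∂μ = _ := h1
    have h0' : ∫⁻ x, ENNReal.ofReal (Real.exp (G (ρ x) - F (ρ x)) * ∑ j, ‖dzb j g x‖^2) ∂μ = _ := h0
    rw [h1', h0', ← ENNReal.ofReal_toReal hKfin, ← ENNReal.ofReal_mul (by positivity),
      ← ENNReal.ofReal_mul (by positivity), ← ENNReal.ofReal_add (by positivity) (by positivity),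
      ENNReal.ofReal_le_ofReal_iff (by positivity)] at h3
    rw [← hV, ← hJ] at h3
    nlinarith
  obtain ⟨H, hH, hHi⟩ := (St t ht0).holo μ hg hε
  refine ⟨H, hH, ?_⟩
  have hB' : (4 * ‖(St t ht0).B μ ⟨g, hg⟩‖ + ε)^2 ≤ Q * ε^2 := by
    have h1 : ‖(St t ht0).B μ ⟨g, hg⟩‖ ≤ Real.sqrt (M * V + 1) * ε := by
      rw [← Real.sqrt_sq hε.le, ← Real.sqrt_mul (by positivity)]
      exact Real.le_sqrt_of_sq_le hB
    rw [hQ, ← mul_pow]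
    exact pow_le_pow_left₀ (by positivity) (by nlinarith) 2
  have hm' : MeasurableSet {z ∈ D | ρ z < c} := by
    have : {z ∈ D | ρ z < c} = D ∩ ρ ⁻¹' (Iio c) := rfl
    rw [this]
    exact (hρc.isOpen_inter_preimage E.hD isOpen_Iio).measurableSet
  calc ∫⁻ x in {z ∈ D | ρ z < c}, ENNReal.ofReal (‖H x - g x‖^2) ∂μ
      ≤ ∫⁻ x in {z ∈ D | ρ z < c}, ENNReal.ofReal m *
          ENNReal.ofReal (Real.exp (2 * G (ρ x) - Ft t (ρ x)) * ‖H x - g x‖^2) ∂μ := by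
        refine setLIntegral_mono' hm' fun x hx => ?_
        rw [← ENNReal.ofReal_mul hm0.le, ← mul_assoc]
        refine ENNReal.ofReal_le_ofReal (le_mul_of_one_le_left (by positivity) ?_)
        have h1 := hm x hx.1 hx.2.le
        have h2 : Ft t (ρ x) = F (ρ x) := by
          simp only [hFt, X3_zero (show ρ x - c ≤ 0 by linarith [hx.2]), mul_zero, add_zero]
        rw [h2]
        calc (1:ℝ) = Real.exp (F (ρ x) - 2 * G (ρ x)) * Real.exp (2 * G (ρ x) - F (ρ x)) := by
              rw [← Real.exp_add]; simp
          _ ≤ _ := mul_le_mul_of_nonneg_right h1 (Real.exp_pos _).le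
    _ = ENNReal.ofReal m * ∫⁻ x in {z ∈ D | ρ z < c},
          ENNReal.ofReal (Real.exp (2 * G (ρ x) - Ft t (ρ x)) * ‖H x - g x‖^2) ∂μ :=
        lintegral_const_mul' _ _ ENNReal.ofReal_ne_top
    _ ≤ ENNReal.ofReal m * ENNReal.ofReal ((4 * ‖(St t ht0).B μ ⟨g, hg⟩‖ + ε)^2) := by
        gcongr
        refine le_trans (lintegral_mono_set (s := {z ∈ D | ρ z < c}) (t := D) (fun x hx => hx.1)) hHi
    _ ≤ ENNReal.ofReal (m * Q * ε^2) := by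
        rw [← ENNReal.ofReal_mul hm0.le, mul_assoc]
        exact ENNReal.ofReal_le_ofReal (mul_le_mul_of_nonneg_left hB' hm0.le)

lemma Exh.approx_sup {c c' δ : ℝ} (hc : c < c') (hδ : 0 < δ) : ∃ C, 0 < C ∧ ∀ g ∈ Test D, ∀ ε > 0,
    (∀ z ∈ D, ρ z ≤ c' → ∑ j, ‖dzb j g z‖^2 ≤ ε^2) →
    ∃ H : EN N → ℂ, DifferentiableOn ℂ H D ∧ ∀ x k, (∀ y ∈ ball x δ, y ∈ D ∧ ρ y < c ∧ ‖g y - k‖ ≤ ε) →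
      ‖H x - k‖ ≤ C * ε := by
  obtain ⟨μ, hμ⟩ : ∃ μ : Measure (EN N), μ.IsAddHaarMeasure := ⟨Measure.addHaar, inferInstance⟩
  obtain ⟨C, hC, h⟩ := E.approx μ hc
  set v := (μ (ball (0 : EN N) δ)).toReal with hv
  have hvf : μ (ball (0 : EN N) δ) ≠ ⊤ := measure_ball_lt_top.ne
  have hv0 : 0 < v := ENNReal.toReal_pos (measure_ball_pos μ _ hδ).ne' hvf
  refine ⟨Real.sqrt ((2 * C + 2 * v) / v), by positivity, fun g hg ε hε hgε => ?_⟩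
  obtain ⟨H, hH, hHi⟩ := h g hg ε hε hgε
  refine ⟨H, hH, fun x k hx => ?_⟩
  have e : μ (ball x δ) = ENNReal.ofReal v := by
    rw [Measure.addHaar_ball_center, hv, ENNReal.ofReal_toReal hvf]
  have h1 := mv_sq μ (f := fun y => H y - k) (x := x) (r := δ)
    ((hH.mono fun y hy => (hx y hy).1).sub_const k)
  have h2 : ∫⁻ t in ball x δ, ENNReal.ofReal (‖H t - k‖^2) ∂μ ≤
      ∫⁻ t in ball x δ, (2 * ENNReal.ofReal (‖H t - g t‖^2) + ENNReal.ofReal (2 * ε^2)) ∂μ := by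
    refine setLIntegral_mono' measurableSet_ball fun y hy => ?_
    rw [← ENNReal.ofReal_ofNat 2, ← ENNReal.ofReal_mul (by norm_num), ← ENNReal.ofReal_add (by positivity) (by positivity)]
    refine ENNReal.ofReal_le_ofReal ?_
    have a1 : ‖H y - k‖ ≤ ‖H y - g y‖ + ‖g y - k‖ := by
      have := norm_add_le (H y - g y) (g y - k); simpa using this
    have a2 := (hx y hy).2.2
    have a3 : ‖H y - k‖^2 ≤ (‖H y - g y‖ + ε)^2 := pow_le_pow_left₀ (norm_nonneg _) (by linarith) 2
    nlinarith [sq_nonneg (‖H y - g y‖ - ε)]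
  rw [lintegral_add_right _ measurable_const, lintegral_const_mul' _ _ (by norm_num), lintegral_const,
    Measure.restrict_apply_univ, e] at h2
  have h3 : ∫⁻ t in ball x δ, ENNReal.ofReal (‖H t - g t‖^2) ∂μ ≤ ENNReal.ofReal (C * ε^2) :=
    (lintegral_mono_set (s := ball x δ) (t := {z ∈ D | ρ z < c}) (fun y hy => ⟨(hx y hy).1, (hx y hy).2.1⟩)).trans hHi
  have h4 : ENNReal.ofReal v * ENNReal.ofReal (‖H x - k‖^2) ≤
      2 * ENNReal.ofReal (C * ε^2) + ENNReal.ofReal (2 * ε^2) * ENNReal.ofReal v := by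
    rw [← e]
    refine h1.trans (h2.trans ?_)
    rw [e]
    gcongr
  rw [← ENNReal.ofReal_ofNat 2, ← ENNReal.ofReal_mul hv0.le, ← ENNReal.ofReal_mul (by norm_num),
    ← ENNReal.ofReal_mul (by positivity), ← ENNReal.ofReal_add (by positivity) (by positivity),
    ENNReal.ofReal_le_ofReal_iff (by positivity)] at h4
  refine le_of_sq_le_sq ?_ (by positivity)
  rw [mul_pow, Real.sq_sqrt (by positivity), div_mul_eq_mul_div, le_div_iff₀ hv0]
  nlinarith

end

end WB

open Set Filter Topology Metric MeasureTheory
open scoped ENNReal NNReal InnerProductSpace ComplexConjugate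

namespace WB

variable {N : ℕ}

lemma taylor2 {f : EN N → ℝ} {p : EN N} {r ε : ℝ} (hr : 0 < r) (hf : ∀ x ∈ ball p r, ContDiffAt ℝ 2 f x)
    (hε : ∀ x ∈ ball p r, ‖fderiv ℝ (fderiv ℝ f) x - fderiv ℝ (fderiv ℝ f) p‖ ≤ ε) {z : EN N} (hz : z ∈ ball p r) :
    |f z - f p - fderiv ℝ f p (z - p) - Hess f p (z - p) (z - p) / 2| ≤ ε * ‖z - p‖^2 := by
  have hp : p ∈ ball p r := mem_ball_self hr
  set A := fderiv ℝ (fderiv ℝ f) p with hA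
  have ε0 : 0 ≤ ε := by
    exact (ContinuousLinearMap.opNorm_nonneg _).trans (hε p hp)
  have sym : ∀ v w, A v w = A w v := (hf p hp).isSymmSndFDerivAt (by simp)
  have d1 : ∀ x ∈ ball p r, ‖fderiv ℝ f x - fderiv ℝ f p - A (x - p)‖ ≤ ε * ‖x - p‖ := by
    intro x hx
    refine Convex.norm_image_sub_le_of_norm_fderiv_le' (s := ball p r) (𝕜 := ℝ) (fun y hy => ?_) hε
      (convex_ball _ _) hp hx
    exact ((hf y hy).fderiv_right (m := 1) (by norm_num)).differentiableAt (by norm_num)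
  set g : EN N → ℝ := fun x => f x - fderiv ℝ f p (x - p) - A (x - p) (x - p) / 2 with hg
  have dg : ∀ x ∈ ball p r, HasFDerivAt g (fderiv ℝ f x - fderiv ℝ f p - A (x - p)) x := by
    intro x hx
    have h1 : HasFDerivAt (fun x : EN N => x - p) (ContinuousLinearMap.id ℝ (EN N)) x :=
      (hasFDerivAt_id x).sub_const p
    have h2 := (fderiv ℝ f p).hasFDerivAt.comp x h1
    have h3 := (A.hasFDerivAt.comp x h1).clm_apply h1
    have h4 := (((hf x hx).differentiableAt (by norm_num)).hasFDerivAt.sub h2).sub (h3.mul_const (1/2))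
    refine (h4.congr_fderiv ?_).congr_of_eventuallyEq (Eventually.of_forall fun y => ?_)
    · ext v
      simp
      have s1 := sym v x
      have s2 := sym v p
      linarith
    · simp [hg]; ring
  have hz' : ‖z - p‖ < r := by rwa [mem_ball, dist_eq_norm] at hz
  have key := Convex.norm_image_sub_le_of_norm_hasFDerivWithin_le (f := g) (𝕜 := ℝ) (C := ε * ‖z - p‖)
    (s := closedBall p ‖z - p‖) (x := p) (y := z)
    (fun x hx => (dg x (closedBall_subset_ball hz' hx)).hasFDerivWithinAt)
    (fun x hx => (d1 x (closedBall_subset_ball hz' hx)).trans (by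
      rw [mem_closedBall, dist_eq_norm] at hx; gcongr)) (convex_closedBall _ _)
    (mem_closedBall_self (norm_nonneg _)) (by rw [mem_closedBall, dist_eq_norm])
  have e : g z - g p = f z - f p - fderiv ℝ f p (z - p) - Hess f p (z - p) (z - p) / 2 := by
    simp [hg, Hess, hA]; ring
  rw [e, Real.norm_eq_abs] at key
  refine key.trans (le_of_eq (by ring))

lemma levi_nonneg {f : EN N → ℝ} (hf : ContDiff ℝ 2 f) {z b : EN N} {r0 : ℝ} (hr0 : 0 < r0)
    (h : ∀ r, 0 < r → r < r0 → f z ≤ (2 * Real.pi)⁻¹ *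
      ∫ θ in (0:ℝ)..(2 * Real.pi), f (z + ((r:ℂ) * Complex.exp (θ * Complex.I)) • b)) :
    0 ≤ LeviForm f z b := by
  have hpi := Real.pi_pos
  have c2 : Continuous (fderiv ℝ (fderiv ℝ f)) :=
    ((hf.fderiv_right (m := 1) (by norm_num)).fderiv_right (m := 0) (by norm_num)).continuous
  refine le_of_forall_pos_le_add fun ε hε => ?_
  obtain ⟨ε', hε', hεb⟩ : ∃ ε' > 0, ε' * ‖b‖^2 ≤ ε := by
    refine ⟨ε / (‖b‖^2 + 1), by positivity, ?_⟩
    rw [div_mul_eq_mul_div, div_le_iff₀ (by positivity)]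
    nlinarith
  obtain ⟨δ, hδ, hδ'⟩ := (Metric.continuous_iff (α := EN N) (β := EN N →L[ℝ] EN N →L[ℝ] ℝ) (f := fderiv ℝ (fderiv ℝ f))).1 c2 z ε' hε'
  obtain ⟨r, hr, hrr0, hrb⟩ : ∃ r, 0 < r ∧ r < r0 ∧ r * ‖b‖ < δ := by
    refine ⟨min (r0/2) (δ / (‖b‖ + 1) / 2), by positivity, by linarith [min_le_left (r0/2) (δ / (‖b‖ + 1) / 2)], ?_⟩
    have h1 := min_le_right (r0/2) (δ / (‖b‖ + 1) / 2)
    have h2 : δ / (‖b‖ + 1) / 2 * (‖b‖+1) = δ / 2 := by field_simp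
    have h3 : 0 < min (r0/2) (δ / (‖b‖ + 1) / 2) := by positivity
    nlinarith [norm_nonneg b]
  have hh := h r hr hrr0
  set e : ℝ → EN N := fun θ => ((r:ℂ) * Complex.exp (θ * Complex.I)) • b with he
  have hnorm : ∀ θ, ‖e θ‖ = r * ‖b‖ := by
    intro θ
    simp only [he]
    rw [norm_smul, norm_mul, Complex.norm_exp_ofReal_mul_I, mul_one, Complex.norm_real, Real.norm_eq_abs, abs_of_pos hr]
  have hexp : ∀ θ, e θ = (r * Real.cos θ) • b + (r * Real.sin θ) • (Complex.I • b) := by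
    intro θ
    simp only [he, Complex.exp_mul_I, ← Complex.ofReal_cos, ← Complex.ofReal_sin]
    ext i
    simp
    ring
  set A := fderiv ℝ f z b with hA
  set A' := fderiv ℝ f z (Complex.I • b) with hA'
  set B := Hess f z b b with hB
  set B1 := Hess f z b (Complex.I • b) with hB1
  set B2 := Hess f z (Complex.I • b) b with hB2
  set B' := Hess f z (Complex.I • b) (Complex.I • b) with hB'
  have bound : ∀ θ, f (z + e θ) ≤ (f z + ε' * (r * ‖b‖)^2) + (r * A) * Real.cos θ + (r * A') * Real.sin θ
      + (r^2 * B / 2) * (Real.cos θ)^2 + (r^2 * (B1 + B2) / 2) * (Real.sin θ * Real.cos θ) + (r^2 * B' / 2) * (Real.sin θ)^2 := by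
    intro θ
    have h1 := taylor2 (f := f) (p := z) (r := δ) (ε := ε') hδ (fun x _ => hf.contDiffAt)
      (fun x hx => by have := hδ' x hx; exact (le_of_eq (dist_eq_norm (fderiv ℝ (fderiv ℝ f) x) _).symm).trans this.le)
      (z := z + e θ) (by rw [mem_ball, dist_eq_norm]; simpa [hnorm] using hrb)
    rw [add_sub_cancel_left, hnorm] at h1
    have h2 := (le_abs_self _).trans h1
    have h3 : fderiv ℝ f z (e θ) = (r * Real.cos θ) * A + (r * Real.sin θ) * A' := by
      rw [hexp, map_add, map_smul, map_smul]; rfl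
    have h4 : Hess f z (e θ) (e θ) = (r * Real.cos θ)^2 * B + (r * Real.cos θ) * (r * Real.sin θ) * (B1 + B2) + (r * Real.sin θ)^2 * B' := by
      simp only [hexp, hB, hB1, hB2, hB', Hess, map_add, map_smul, ContinuousLinearMap.add_apply, ContinuousLinearMap.smul_apply, smul_eq_mul]
      ring
    rw [h3, h4] at h2
    nlinarith
  have ce : Continuous e := by simp only [he]; fun_prop
  have int : ∫ θ in (0:ℝ)..(2 * Real.pi), f (z + e θ) ≤ 2 * Real.pi * (f z + ε' * (r * ‖b‖)^2) + Real.pi * (r^2 * (B + B') / 2) := by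
    refine (intervalIntegral.integral_mono_on (by positivity)
      ((hf.continuous.comp (continuous_const.add ce)).intervalIntegrable _ _)
      (Continuous.intervalIntegrable (by fun_prop) _ _) (fun θ _ => bound θ)).trans (le_of_eq ?_)
    have ii : ∀ g : ℝ → ℝ, Continuous g → IntervalIntegrable g volume 0 (2 * Real.pi) := fun g hg => hg.intervalIntegrable _ _
    rw [intervalIntegral.integral_add (ii _ (by fun_prop)) (ii _ (by fun_prop)),
      intervalIntegral.integral_add (ii _ (by fun_prop)) (ii _ (by fun_prop)),
      intervalIntegral.integral_add (ii _ (by fun_prop)) (ii _ (by fun_prop)),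
      intervalIntegral.integral_add (ii _ (by fun_prop)) (ii _ (by fun_prop)),
      intervalIntegral.integral_add (ii _ (by fun_prop)) (ii _ (by fun_prop))]
    simp only [intervalIntegral.integral_const_mul, intervalIntegral.integral_const, integral_cos, integral_sin, integral_cos_sq, integral_sin_sq, integral_sin_mul_cos₁]
    simp
    ring
  have h5 : f z * (2 * Real.pi) ≤ 2 * Real.pi * (f z + ε' * (r * ‖b‖)^2) + Real.pi * (r^2 * (B + B') / 2) := by
    rw [inv_mul_eq_div, le_div_iff₀ (by positivity)] at hh
    exact hh.trans int
  have h6 : LeviForm f z b = (B + B') / 4 := rfl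
  rw [h6]
  have h7 : 0 ≤ Real.pi * r^2 * (2 * (ε' * ‖b‖^2) + (B + B') / 2) := by nlinarith
  have h8 : 0 ≤ 2 * (ε' * ‖b‖^2) + (B + B') / 2 := by
    by_contra hneg
    push Not at hneg
    have : 0 < Real.pi * r^2 := by positivity
    nlinarith
  linarith

end WB

open Set Filter Topology Metric MeasureTheory
open scoped ENNReal NNReal InnerProductSpace ComplexConjugate

namespace WB

variable {N : ℕ}

lemma fderiv2_add {f g : EN N → ℝ} {z : EN N} (hf : ContDiffAt ℝ 2 f z) (hg : ContDiffAt ℝ 2 g z) :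
    fderiv ℝ (fderiv ℝ (fun x => f x + g x)) z = fderiv ℝ (fderiv ℝ f) z + fderiv ℝ (fderiv ℝ g) z := by
  have h1 : fderiv ℝ (fun x => f x + g x) =ᶠ[𝓝 z] fun x => fderiv ℝ f x + fderiv ℝ g x := by
    filter_upwards [hf.eventually (by norm_num), hg.eventually (by norm_num)] with x hx hy
    exact fderiv_fun_add (hx.differentiableAt (by norm_num)) (hy.differentiableAt (by norm_num))
  rw [h1.fderiv_eq]
  exact fderiv_fun_add ((hf.fderiv_right (m := 1) (by norm_num)).differentiableAt (by norm_num))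
    ((hg.fderiv_right (m := 1) (by norm_num)).differentiableAt (by norm_num))

lemma levi_add' {f g : EN N → ℝ} {z : EN N} (hf : ContDiffAt ℝ 2 f z) (hg : ContDiffAt ℝ 2 g z) (b : EN N) :
    LeviForm (fun x => f x + g x) z b = LeviForm f z b + LeviForm g z b := by
  simp only [LeviForm, Hess, fderiv2_add hf hg, ContinuousLinearMap.add_apply]
  ring

lemma levi_cmul {f : EN N → ℝ} {z : EN N} (hf : ContDiffAt ℝ 2 f z) (c : ℝ) (b : EN N) :
    LeviForm (fun x => c * f x) z b = c * LeviForm f z b := by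
  have h1 : fderiv ℝ (fun x => c * f x) =ᶠ[𝓝 z] fun x => c • fderiv ℝ f x := by
    filter_upwards [hf.eventually (by norm_num)] with x hx
    exact fderiv_const_mul (hx.differentiableAt (by norm_num)) c
  have h2 : fderiv ℝ (fderiv ℝ (fun x => c * f x)) z = c • fderiv ℝ (fderiv ℝ f) z := by
    rw [h1.fderiv_eq]
    exact fderiv_fun_const_smul ((hf.fderiv_right (m := 1) (by norm_num)).differentiableAt (by norm_num)) c
  simp only [LeviForm, Hess, h2, ContinuousLinearMap.smul_apply, smul_eq_mul]
  ring

lemma levi_normsq (z b : EN N) : LeviForm (fun x : EN N => ‖x‖^2) z b = ‖b‖^2 := by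
  have h1 : fderiv ℝ (fun x : EN N => ‖x‖^2) = fun x => ((2:ℕ) • (innerSL ℝ : EN N →L[ℝ] EN N →L[ℝ] ℝ)) x := by
    funext x
    exact fderiv_norm_sq_apply (F := EN N) x
  have h2 : fderiv ℝ (fderiv ℝ (fun x : EN N => ‖x‖^2)) z = (2:ℕ) • (innerSL ℝ : EN N →L[ℝ] EN N →L[ℝ] ℝ) := by
    rw [h1]
    exact ContinuousLinearMap.fderiv _
  have h3 : ∀ v : EN N, ((2:ℕ) • (innerSL ℝ : EN N →L[ℝ] EN N →L[ℝ] ℝ)) v v = 2 * ‖v‖^2 := by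
    intro v
    have : ⟪v, v⟫_ℝ = ‖v‖^2 := real_inner_self_eq_norm_sq v
    rw [two_nsmul, two_mul, ← this]; rfl
  simp only [LeviForm, Hess, h2, h3, norm_smul, Complex.norm_I, one_mul]
  ring

lemma contDiff_normsq : ContDiff ℝ 2 (fun x : EN N => ‖x‖^2) := contDiff_norm_sq ℝ

/-- sub-mean value property passes to mollification -/
lemma moll_submean (μ : Measure (EN N)) [μ.IsAddHaarMeasure] {w : EN N → ℝ} (hw : Continuous w) (hc : HasCompactSupport w)
    {φ : EN N → ℝ} (hφ : Continuous φ) (hφc : HasCompactSupport φ) (φ0 : ∀ x, 0 ≤ φ x)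
    {e : ℝ → EN N} (he : Continuous e) {z : EN N}
    (h : ∀ t, φ t ≠ 0 → w (z - t) ≤ (2 * Real.pi)⁻¹ * ∫ θ in (0:ℝ)..(2 * Real.pi), w (z - t + e θ)) :
    (∫ t, φ t * w (z - t) ∂μ) ≤ (2 * Real.pi)⁻¹ * ∫ θ in (0:ℝ)..(2 * Real.pi), ∫ t, φ t * w (z + e θ - t) ∂μ := by
  obtain ⟨M, hM⟩ := hc.exists_bound_of_continuous hw
  have iφ : Integrable φ μ := hφ.integrable_of_hasCompactSupport hφc
  have int2 : Integrable (Function.uncurry fun (θ : ℝ) (t : EN N) => φ t * w (z + e θ - t))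
      ((volume.restrict (uIoc 0 (2 * Real.pi))).prod μ) := by
    have : IsFiniteMeasure (volume.restrict (uIoc 0 (2 * Real.pi))) :=
      ⟨by rw [Measure.restrict_apply_univ, uIoc]; exact measure_Ioc_lt_top⟩
    have h1 : Integrable (fun p : ℝ × EN N => (fun _ : ℝ => M) p.1 * φ p.2) ((volume.restrict (uIoc 0 (2 * Real.pi))).prod μ) :=
      Integrable.mul_prod (integrable_const M) iφ
    refine h1.mono ?_ (Eventually.of_forall ?_)
    · apply Continuous.aestronglyMeasurable
      simp only [Function.uncurry_def]
      fun_prop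
    · rintro ⟨θ, t⟩
      simp only [Function.uncurry_apply_pair, norm_mul]
      rw [mul_comm]
      gcongr
      exact (hM _).trans (le_abs_self _)
  rw [intervalIntegral_integral_swap int2, ← integral_const_mul]
  have int3 : Integrable (fun t => ∫ θ in (0:ℝ)..(2 * Real.pi), φ t * w (z + e θ - t)) μ := by
    have := int2.integral_prod_right
    have hpi := Real.pi_pos
    refine this.congr (Eventually.of_forall fun t => ?_)
    simp only [Function.uncurry_apply_pair]
    rw [intervalIntegral.integral_of_le (by positivity), uIoc_of_le (by positivity)]
  refine integral_mono ?_ (int3.const_mul _) (fun t => ?_)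
  · refine Continuous.integrable_of_hasCompactSupport (by fun_prop) (hφc.mul_right)
  · simp only
    rw [intervalIntegral.integral_const_mul]
    by_cases h0 : φ t = 0
    · simp [h0]
    have := mul_le_mul_of_nonneg_left (h t h0) (φ0 t)
    refine this.trans (le_of_eq ?_)
    rw [mul_left_comm]
    simp only [sub_add_eq_add_sub]

lemma smooth_psh {D : Set (EN N)} (hD : IsOpen D) {v : EN N → ℝ} (hv : ContinuousOn v D)
    (psh : PlurisubharmonicOn v D) {K : Set (EN N)} (hK : IsCompact K) (hKD : K ⊆ D) {ε : ℝ} (hε : 0 < ε) :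
    ∃ w : EN N → ℝ, ContDiff ℝ 2 w ∧ ∀ z ∈ K, |w z - v z| ≤ ε ∧ ∀ b, b ≠ 0 → 0 < LeviForm w z b := by
  obtain ⟨μ, hμ⟩ : ∃ μ : Measure (EN N), μ.IsAddHaarMeasure := ⟨Measure.addHaar, inferInstance⟩
  obtain ⟨L, hL, hKL, hLD⟩ := exists_compact_between hK hD hKD
  obtain ⟨χ, χc, χs, χt, χ01, U, hU, hLU, χ1⟩ := exists_cutoff hL hD hLD
  set w : EN N → ℝ := fun x => χ x * v x with hw
  have wL : ∀ x ∈ L, w x = v x := fun x hx => by simp [hw, χ1 x (hLU hx)]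
  have wc : HasCompactSupport w := χs.mul_right
  have wcont : Continuous w := by
    refine continuous_of_tsupport fun x hx => ?_
    have hx' : x ∈ D := χt ((closure_mono (s := Function.support w) (t := Function.support χ)
      (fun y hy => left_ne_zero_of_mul hy)) hx)
    exact χc.continuous.continuousAt.mul (hv.continuousAt (hD.mem_nhds hx'))
  obtain ⟨δ, hδ, hδL⟩ := hK.exists_cthickening_subset_open isOpen_interior hKL
  have uc := wc.uniformContinuous_of_continuous wcont
  obtain ⟨δ', hδ', huc⟩ := Metric.uniformContinuous_iff.1 uc (ε/2) (half_pos hε)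
  obtain ⟨n, hn⟩ := exists_nat_one_div_lt (lt_min (half_pos hδ) hδ')
  have hn1 := lt_of_lt_of_le hn (min_le_left _ _)
  have hn2 := lt_of_lt_of_le hn (min_le_right _ _)
  set φ : EN N → ℝ := (bmp (N := N) n).normed μ with hφ
  set f : EN N → ℝ := fun x => ∫ t, φ t * w (x - t) ∂μ with hf
  have fC : ContDiff ℝ 2 f := HasCompactSupport.contDiff_convolution_left (n := 2) (ContinuousLinearMap.lsmul ℝ ℝ)
    ((bmp n).hasCompactSupport_normed) ((bmp n).contDiff_normed) wcont.locallyIntegrable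
  have fcl : ∀ x, |f x - w x| ≤ ε / 2 := by
    intro x
    exact ContDiffBump.dist_normed_convolution_le (φ := bmp (N := N) n) (μ := μ) (g := w) wcont.aestronglyMeasurable
      (fun y hy => (huc (by rw [bmp_rOut, mem_ball] at hy; exact hy.trans hn2)).le)
  have flev : ∀ z ∈ K, ∀ b, 0 ≤ LeviForm f z b := by
    intro z hz b
    refine levi_nonneg fC (r0 := δ / 2 / (‖b‖ + 1)) (by positivity) fun r hr hr' => ?_
    have hrb : r * ‖b‖ < δ / 2 := by
      rw [lt_div_iff₀ (by positivity)] at hr'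
      nlinarith [norm_nonneg b]
    have inL : ∀ t : EN N, φ t ≠ 0 → ∀ s : ℂ, ‖s‖ ≤ r → z - t + s • b ∈ L := by
      intro t ht s hs
      apply interior_subset
      apply hδL
      have ht' : t ∈ Function.support ((bmp (N := N) n).normed μ) := ht
      rw [ContDiffBump.support_normed_eq, bmp_rOut, mem_ball_zero_iff] at ht'
      refine mem_cthickening_of_dist_le _ z _ _ hz ?_
      rw [dist_eq_norm, show z - t + s • b - z = s • b - t by abel]
      have h1 := norm_sub_le (s • b) t
      rw [norm_smul] at h1
      have h2 : ‖s‖ * ‖b‖ ≤ r * ‖b‖ := by gcongr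
      linarith
    refine moll_submean μ wcont wc ((bmp n).continuous_normed) ((bmp n).hasCompactSupport_normed)
      ((bmp n).nonneg_normed) (e := fun θ : ℝ => ((r:ℂ) * Complex.exp (θ * Complex.I)) • b) (by fun_prop) ?_
    intro t ht
    have h1 := psh.2 (z - t) b 0 r hr (by
      rintro _ ⟨s, hs, rfl⟩
      exact hLD (inL t ht s (by simpa using hs)))
    simp only [zero_smul, add_zero, zero_add] at h1
    have h0 := inL t ht 0 (by simpa using hr.le)
    simp only [zero_smul, add_zero] at h0
    rw [wL _ h0]
    refine h1.trans (le_of_eq ?_)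
    congr 1
    refine intervalIntegral.integral_congr fun θ _ => ?_
    refine (wL _ (inL t ht _ ?_)).symm
    rw [norm_mul, Complex.norm_exp_ofReal_mul_I, mul_one, Complex.norm_real, Real.norm_eq_abs, abs_of_pos hr]
  obtain ⟨R, hR⟩ := hK.isBounded.exists_norm_le
  set τ : ℝ := ε / 2 / (R^2 + 1) with hτ
  have τ0 : 0 < τ := by positivity
  refine ⟨fun x => f x + τ * ‖x‖^2, fC.add (contDiff_const.mul contDiff_normsq), fun z hz => ⟨?_, fun b hb => ?_⟩⟩
  · have h1 := fcl z
    rw [wL z (interior_subset (hKL hz))] at h1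
    have h2 : τ * ‖z‖^2 ≤ ε / 2 := by
      have : ‖z‖^2 ≤ R^2 + 1 := by
        have := pow_le_pow_left₀ (norm_nonneg z) (hR z hz) 2
        linarith
      calc τ * ‖z‖^2 ≤ τ * (R^2+1) := by gcongr
        _ = ε / 2 := by rw [hτ]; field_simp
    have h3 : 0 ≤ τ * ‖z‖^2 := by positivity
    rw [abs_le] at h1 ⊢
    constructor <;> linarith [h1.1, h1.2]
  · rw [levi_add' fC.contDiffAt (contDiff_const.mul contDiff_normsq).contDiffAt,
      levi_cmul contDiff_normsq.contDiffAt, levi_normsq]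
    have := flev z hz b
    have : 0 < ‖b‖ := norm_pos_iff.2 hb
    have : 0 < τ * ‖b‖^2 := by positivity
    linarith

end WB

open Set Filter Topology Metric MeasureTheory
open scoped ENNReal NNReal InnerProductSpace ComplexConjugate

namespace WB

variable {N : ℕ}

lemma levi_continuous {f : EN N → ℝ} (hf : ContDiff ℝ 2 f) :
    Continuous (fun p : EN N × EN N => LeviForm f p.1 p.2) := by
  have c2 : Continuous (fun p : EN N × EN N => fderiv ℝ (fderiv ℝ f) p.1) :=
    (((hf.fderiv_right (m := 1) (by norm_num)).fderiv_right (m := 0) (by norm_num)).continuous).comp continuous_fst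
  unfold LeviForm Hess
  refine Continuous.div_const (Continuous.add ?_ ?_) _
  · exact (c2.clm_apply continuous_snd).clm_apply continuous_snd
  · exact (c2.clm_apply (continuous_snd.const_smul Complex.I)).clm_apply (continuous_snd.const_smul Complex.I)

lemma levi_smul {f : EN N → ℝ} {z : EN N} (t : ℝ) (b : EN N) : LeviForm f z (t • b) = t^2 * LeviForm f z b := by
  unfold LeviForm Hess
  rw [smul_comm Complex.I t b]
  simp only [map_smul, ContinuousLinearMap.smul_apply, smul_eq_mul]
  ring

lemma exists_coef {S τ : EN N → ℝ} (hS : ContDiff ℝ 2 S) (hτ : ContDiff ℝ 2 τ) {C : Set (EN N)} (hC : IsCompact C)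
    (h0 : ∀ z ∈ C, ∀ b, 0 ≤ LeviForm τ z b)
    (h1 : ∀ z ∈ C, (∀ b, b ≠ 0 → 0 < LeviForm S z b) ∨ (∀ b, b ≠ 0 → 0 < LeviForm τ z b)) (A : ℝ) :
    ∃ a, A ≤ a ∧ 0 ≤ a ∧ ∀ z ∈ C, ∀ b, b ≠ 0 → 0 < LeviForm (fun x => S x + a * τ x) z b := by
  have hc : IsCompact (C ×ˢ sphere (0:EN N) 1) := hC.prod (isCompact_sphere 0 1)
  obtain ⟨n, hn⟩ := hc.elim_directed_cover (fun n : ℕ => {p : EN N × EN N | 0 < LeviForm S p.1 p.2 + n * max (LeviForm τ p.1 p.2) 0})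
    (fun n => isOpen_lt continuous_const ((levi_continuous hS).add (continuous_const.mul ((levi_continuous hτ).max continuous_const))))
    (by
      rintro ⟨z, b⟩ ⟨hz, hb⟩
      have hb0 : b ≠ 0 := by rintro rfl; simp at hb
      rw [mem_iUnion]
      rcases h1 z hz with h | h
      · refine ⟨0, ?_⟩
        simpa using h b hb0
      · obtain ⟨n, hn⟩ := exists_nat_gt (- LeviForm S z b / LeviForm τ z b)
        refine ⟨n, ?_⟩
        rw [div_lt_iff₀ (h b hb0)] at hn
        simp only [mem_setOf_eq]
        rw [max_eq_left (h0 z hz b)]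
        linarith)
    (by
      refine Monotone.directed_le fun n m hnm p hp => ?_
      simp only [mem_setOf_eq] at hp ⊢
      have : (n:ℝ) * max (LeviForm τ p.1 p.2) 0 ≤ m * max (LeviForm τ p.1 p.2) 0 := by
        gcongr
      linarith)
  refine ⟨max (n:ℝ) A, le_max_right _ _, (Nat.cast_nonneg n).trans (le_max_left _ _), fun z hz b hb => ?_⟩
  have key : ∀ b : EN N, ‖b‖ = 1 → 0 < LeviForm (fun x => S x + max (n:ℝ) A * τ x) z b := by
    intro b hb
    have := hn (show (z, b) ∈ C ×ˢ sphere (0:EN N) 1 from ⟨hz, by simpa using hb⟩)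
    simp only [mem_setOf_eq] at this
    rw [max_eq_left (h0 z hz b)] at this
    rw [levi_add' hS.contDiffAt (contDiff_const.mul hτ).contDiffAt, levi_cmul hτ.contDiffAt]
    have : (n:ℝ) * LeviForm τ z b ≤ max (n:ℝ) A * LeviForm τ z b :=
      mul_le_mul_of_nonneg_right (le_max_left _ _) (h0 z hz b)
    linarith
  have hb' : 0 < ‖b‖ := norm_pos_iff.2 hb
  have e : b = ‖b‖ • (‖b‖⁻¹ • b) := by rw [smul_smul, mul_inv_cancel₀ hb'.ne', one_smul]
  have := key (‖b‖⁻¹ • b) (by rw [norm_smul, norm_inv, norm_norm, inv_mul_cancel₀ hb'.ne'])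
  rw [e, levi_smul]
  exact mul_pos (by positivity) this

lemma exists_exh {D : Set (EN N)} (hD : Pseudoconvex D) : ∃ ρ, Exh D ρ := by
  obtain ⟨⟨hDo, hDc⟩, u, uc, psh, hex⟩ := hD
  obtain ⟨x0, hx0⟩ := hDc.nonempty
  have cpt : ∀ c, IsCompact {z ∈ D | u z ≤ c} := by
    intro c
    have h1 := hex (c+1)
    have hsub : {z ∈ D | u z ≤ c} ⊆ closure {z ∈ D | u z < c+1} := fun z hz => subset_closure ⟨hz.1, by linarith [hz.2]⟩
    have : {z ∈ D | u z ≤ c} = closure {z ∈ D | u z < c+1} ∩ u ⁻¹' Iic c := by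
      ext z
      exact ⟨fun hz => ⟨hsub hz, hz.2⟩, fun hz => ⟨h1.2 hz.1, hz.2⟩⟩
    rw [this]
    exact h1.1.of_isClosed_subset ((uc.mono h1.2).preimage_isClosed_of_isClosed h1.1.isClosed isClosed_Iic) inter_subset_left
  obtain ⟨m, hm⟩ : ∃ m, ∀ z ∈ D, m ≤ u z := by
    obtain ⟨x, hx, hmin⟩ := (cpt (u x0)).exists_isMinOn ⟨x0, hx0, le_rfl⟩ (uc.mono fun z hz => hz.1)
    refine ⟨u x, fun z hz => ?_⟩
    rcases le_total (u z) (u x0) with h | h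
    · exact hmin ⟨hz, h⟩
    · exact hx.2.trans h
  choose w wC hw using fun j : ℕ => smooth_psh hDo uc psh (cpt (m + j + 2)) (fun z hz => hz.1) (ε := 1/4) (by norm_num)
  set F : ℕ → ℝ → ℝ := fun j t => X3 (t - m + 1 - j) with hF
  set τ : ℕ → EN N → ℝ := fun j x => F j (w j x) with hτ
  have FC : ∀ j, ContDiff ℝ 2 (F j) := fun j => X3_contDiff.comp (by fun_prop)
  have Fd : ∀ j, deriv (F j) = fun t => 3 * (max (t - m + 1 - j) 0)^2 := by
    intro j; funext t
    have h1 : HasDerivAt (fun t : ℝ => t - m + 1 - j) 1 t := by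
      simpa using (((hasDerivAt_id t).sub_const m).add_const 1).sub_const (j:ℝ)
    simpa [hF, Function.comp_def] using ((X3_deriv _).comp t h1).deriv
  have Fdd : ∀ j t, deriv (deriv (F j)) t = 6 * max (t - m + 1 - j) 0 := by
    intro j t
    rw [Fd]
    have h1 : HasDerivAt (fun t : ℝ => t - m + 1 - j) 1 t := by
      simpa using (((hasDerivAt_id t).sub_const m).add_const 1).sub_const (j:ℝ)
    simpa [Function.comp_def] using ((X3_deriv2 (t - m + 1 - j)).comp t h1).deriv
  have τC : ∀ j, ContDiff ℝ 2 (τ j) := fun j => (FC j).comp (wC j)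
  have τ0 : ∀ j x, 0 ≤ τ j x := fun j x => X3_nonneg _
  have τz : ∀ j : ℕ, ∀ x ∈ D, u x < m + j - 2 → τ j x = 0 := by
    intro j x hx hu
    have := (abs_le.1 (hw j x ⟨hx, by linarith⟩).1).2
    exact X3_zero (by linarith)
  have τp : ∀ j : ℕ, ∀ x ∈ D, m + j ≤ u x → u x ≤ m + j + 2 → 1/4 ≤ τ j x := by
    intro j x hx hu hu'
    have := (abs_le.1 (hw j x ⟨hx, by linarith⟩).1).1
    have h1 : 3/4 ≤ max (w j x - m + 1 - j) 0 := le_max_of_le_left (by linarith)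
    have h2 : (3/4:ℝ)^3 ≤ (max (w j x - m + 1 - j) 0)^3 := by gcongr
    simp only [hτ, hF, X3]
    linarith
  have τl : ∀ j : ℕ, ∀ x ∈ D, u x ≤ m + j + 2 → ∀ b, 0 ≤ LeviForm (τ j) x b := by
    intro j x hx hu b
    refine le_trans ?_ (levi_comp_ge (FC j) (wC j).contDiffAt (by rw [Fdd]; positivity) b)
    rw [Fd]
    by_cases hb : b = 0
    · simp [hb, LeviForm, Hess]
    have := (hw j x ⟨hx, hu⟩).2 b hb
    positivity
  have τlp : ∀ j : ℕ, ∀ x ∈ D, m + j - 1/2 ≤ u x → u x ≤ m + j + 2 → ∀ b, b ≠ 0 → 0 < LeviForm (τ j) x b := by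
    intro j x hx hu hu' b hb
    refine lt_of_lt_of_le ?_ (levi_comp_ge (FC j) (wC j).contDiffAt (by rw [Fdd]; positivity) b)
    rw [Fd]
    have := (hw j x ⟨hx, hu'⟩).2 b hb
    have h1 := (abs_le.1 (hw j x ⟨hx, by linarith⟩).1).1
    have h2 : 0 < max (w j x - m + 1 - j) 0 := lt_max_of_lt_left (by linarith)
    positivity
  set P : ℕ → (EN N → ℝ) → Prop := fun j S => ContDiff ℝ 2 S ∧ ∀ z ∈ D, u z ≤ m + j + 1 → ∀ b, b ≠ 0 → 0 < LeviForm S z b with hP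
  have step : ∀ (j : ℕ) (S : {S // P j S}), ∃ a : ℝ, 4 * ((j:ℝ)+1) ≤ a ∧ 0 ≤ a ∧ P (j+1) (fun x => S.1 x + a * τ (j+1) x) := by
    rintro j ⟨S, hS, hl⟩
    obtain ⟨a, ha, ha0, h⟩ := exists_coef hS (τC (j+1)) (cpt (m + (j+1:ℕ) + 1))
      (fun z hz b => τl (j+1) z hz.1 (by linarith [hz.2]) b)
      (fun z hz => by
        rcases le_total (u z) (m + j + 1) with h | h
        · exact Or.inl (hl z hz.1 h)
        · exact Or.inr (τlp (j+1) z hz.1 (by push_cast; linarith) (by linarith [hz.2]))) (4 * ((j:ℝ)+1))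
    exact ⟨a, ha, ha0, hS.add (contDiff_const.mul (τC _)), fun z hz hu => h z ⟨hz, hu⟩⟩
  choose a ha ha0 haP using step
  have base : P 0 (τ 0) := ⟨τC 0, fun z hz hu => τlp 0 z hz (by push_cast; linarith [hm z hz]) (by linarith)⟩
  set S : (j : ℕ) → {S // P j S} := fun j => Nat.rec ⟨τ 0, base⟩ (fun j s => ⟨_, haP j s⟩) j with hSdef
  have Ss : ∀ j x, (S (j+1)).1 x = (S j).1 x + a j (S j) * τ (j+1) x := fun j x => rfl
  have S0 : ∀ j x, 0 ≤ (S j).1 x := by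
    intro j x
    induction j with
    | zero => exact τ0 0 x
    | succ j ih => rw [Ss]; have := mul_nonneg (ha0 j (S j)) (τ0 (j+1) x); linarith
  have Sst : ∀ k n : ℕ, ∀ x ∈ D, u x < m + k → (S (k + 1 + n)).1 x = (S (k+1)).1 x := by
    intro k n x hx hu
    induction n with
    | zero => rfl
    | succ n ih =>
      rw [← add_assoc, Ss, ih, τz _ x hx (by push_cast; linarith [(Nat.cast_nonneg n : (0:ℝ) ≤ n)])]
      ring
  have Sst' : ∀ k j : ℕ, ∀ x ∈ D, u x < m + k → k + 1 ≤ j → (S j).1 x = (S (k+1)).1 x := by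
    intro k j x hx hu hj
    obtain ⟨n, rfl⟩ := Nat.exists_eq_add_of_le hj
    exact Sst k n x hx hu
  set ρ : EN N → ℝ := fun x => (S (⌊u x - m⌋₊ + 2)).1 x with hρ
  have ρS : ∀ k : ℕ, ∀ x ∈ D, u x < m + k → ρ x = (S (k+1)).1 x := by
    intro k x hx hu
    have h1 : u x - m < (⌊u x - m⌋₊:ℝ) + 1 := Nat.lt_floor_add_one _
    have h2 : ⌊u x - m⌋₊ + 1 ≤ k := by
      have : ⌊u x - m⌋₊ < k := (Nat.floor_lt (by linarith [hm x hx])).2 (by linarith)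
      omega
    exact (Sst' (⌊u x - m⌋₊ + 1) (k+1) x hx (by push_cast; linarith) (by omega)).symm
  have ev : ∀ z ∈ D, ∃ k : ℕ, u z < m + k ∧ ρ =ᶠ[𝓝 z] (S (k+1)).1 := by
    intro z hz
    obtain ⟨k, hk⟩ := exists_nat_gt (u z - m)
    refine ⟨k, by linarith, ?_⟩
    have c1 : ContinuousAt u z := uc.continuousAt (hDo.mem_nhds hz)
    filter_upwards [hDo.mem_nhds hz, c1.eventually (gt_mem_nhds (show u z < m + k by linarith))] with x hx hux
    exact ρS k x hx hux
  have ρC : ContDiffOn ℝ 2 ρ D := by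
    intro z hz
    obtain ⟨k, hk, he⟩ := ev z hz
    exact ((S (k+1)).2.1.contDiffAt.congr_of_eventuallyEq he).contDiffWithinAt
  have ρge : ∀ z ∈ D, u z - m - 1 ≤ ρ z := by
    intro z hz
    have h1 : u z - m < (⌊u z - m⌋₊:ℝ) + 1 := Nat.lt_floor_add_one _
    have h2 : (⌊u z - m⌋₊:ℝ) ≤ u z - m := Nat.floor_le (by linarith [hm z hz])
    obtain ⟨k, hk⟩ : ∃ k, k = ⌊u z - m⌋₊ := ⟨_, rfl⟩
    rw [← hk] at h1 h2
    rcases Nat.eq_zero_or_pos k with h0 | h0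
    · have : 0 ≤ ρ z := S0 _ _
      rw [h0] at h1; push_cast at h1; linarith
    obtain ⟨j, rfl⟩ : ∃ j, k = j + 1 := ⟨k - 1, by omega⟩
    have e1 : (S (j+1+1+1)).1 z = (S (j+1)).1 z + a (j+1) (S (j+1)) * τ (j+1+1) z + a (j+1+1) (S (j+1+1)) * τ (j+1+1+1) z := rfl
    have e2 : (S (j+1)).1 z = (S j).1 z + a j (S j) * τ (j+1) z := rfl
    have e3 : ρ z = (S (j+1+1+1)).1 z := by simp only [hρ]; rw [← hk]
    have t1 := mul_nonneg (ha0 (j+1) (S (j+1))) (τ0 (j+1+1) z)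
    have t2 := mul_nonneg (ha0 (j+1+1) (S (j+1+1))) (τ0 (j+1+1+1) z)
    have t3 := S0 j z
    have t4 := τp (j+1) z hz (by linarith) (by linarith)
    have t5 := ha j (S j)
    push_cast at *
    have t6 : (4 * ((j:ℝ)+1)) * (1/4) ≤ a j (S j) * τ (j+1) z := by gcongr; exact ha0 _ _
    linarith
  refine ⟨ρ, ⟨hDo, ρC, fun z hz => S0 _ _, ?_, ?_⟩⟩
  · intro z hz b hb
    obtain ⟨k, hk, he⟩ := ev z hz
    rw [LeviForm_congr he]
    exact (S (k+1)).2.2 z hz (by push_cast; linarith) b hb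
  · intro c
    have hsub : {z ∈ D | ρ z ≤ c} ⊆ {z ∈ D | u z ≤ c + m + 1} := fun z hz => ⟨hz.1, by linarith [hz.2, ρge z hz.1]⟩
    have e : {z ∈ D | ρ z ≤ c} = {z ∈ D | u z ≤ c + m + 1} ∩ ρ ⁻¹' Iic c := by
      ext z
      exact ⟨fun hz => ⟨hsub hz, hz.2⟩, fun hz => ⟨hz.1.1, hz.2⟩⟩
    rw [e]
    have hc := cpt (c + m + 1)
    exact hc.of_isClosed_subset ((ρC.continuousOn.mono fun z hz => hz.1).preimage_isClosed_of_isClosed hc.isClosed isClosed_Iic) inter_subset_left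

end WB

open Set Filter Topology Metric MeasureTheory
open scoped ENNReal NNReal InnerProductSpace ComplexConjugate

namespace WB

lemma quot_small {A B b : ℂ} {e : ℝ} (h : b * (A + B) = 1) (he0 : 0 ≤ e) (he : e ≤ 1/2) (hBA : ‖B‖ ≤ e * ‖A‖) : ‖B * b‖ ≤ 2 * e := by
  have h1 : ‖b‖ * ‖A + B‖ = 1 := by rw [← norm_mul, h, norm_one]
  have h2 : ‖A‖ ≤ ‖A + B‖ + ‖B‖ := by simpa using norm_sub_le (A + B) B
  have h3 : ‖A‖ ≤ 2 * ‖A + B‖ := by nlinarith [norm_nonneg A]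
  have h4 : ‖b‖ * ‖A‖ ≤ 2 := by nlinarith [norm_nonneg b]
  rw [norm_mul]
  nlinarith [norm_nonneg b]

lemma pow_small {δ R : ℝ} (hδ : 0 < δ) (hR : 0 ≤ R) {n : ℕ} {e : ℝ} (hn : (max (1 - 4 * δ / (1+R)^2) 0)^n ≤ e) {w : ℂ} (hw : ‖w‖ ≤ R)
    (h : δ ≤ w.re) : ‖(1 - w)^(2*n)‖ ≤ e * ‖(1+w)^(2*n)‖ := by
  have h1 : ‖1 - w‖^2 = ‖1 + w‖^2 - 4 * w.re := by
    rw [Complex.sq_norm, Complex.sq_norm, Complex.normSq_apply, Complex.normSq_apply]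
    simp; ring
  have h2 : ‖1 + w‖ ≤ 1 + R := (norm_add_le _ _).trans (by simpa using hw)
  have h3 : ‖1 - w‖^2 ≤ max (1 - 4 * δ / (1+R)^2) 0 * ‖1 + w‖^2 := by
    have : (1 - 4 * δ / (1+R)^2) * ‖1 + w‖^2 ≤ max (1 - 4 * δ / (1+R)^2) 0 * ‖1 + w‖^2 := by gcongr; exact le_max_left _ _
    refine le_trans ?_ this
    have h4 : 4 * δ / (1+R)^2 * ‖1+w‖^2 ≤ 4 * δ := by
      have : ‖1+w‖^2 ≤ (1+R)^2 := by gcongr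
      calc _ ≤ 4 * δ / (1+R)^2 * (1+R)^2 := by gcongr
        _ = 4 * δ := by field_simp
    linarith
  rw [norm_pow, norm_pow, pow_mul, pow_mul]
  calc (‖1 - w‖^2)^n ≤ (max (1 - 4 * δ / (1+R)^2) 0 * ‖1 + w‖^2)^n := by gcongr
    _ = (max (1 - 4 * δ / (1+R)^2) 0)^n * (‖1 + w‖^2)^n := mul_pow _ _ _
    _ ≤ _ := by gcongr

lemma runge_sym {δ R ε : ℝ} (hδ : 0 < δ) (hR : 0 ≤ R) (hε : 0 < ε) : ∃ q : ℂ → ℂ, Differentiable ℂ q ∧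
    (∀ w : ℂ, ‖w‖ ≤ R → w.re ≤ -δ → ‖q w‖ ≤ ε) ∧ (∀ w : ℂ, ‖w‖ ≤ R → δ ≤ w.re → ‖q w - 1‖ ≤ ε) := by
  set X : Set ℂ := closedBall 0 R ∩ {w | δ ≤ |w.re|} with hX
  have Xc : IsCompact X := (isCompact_closedBall 0 R).inter_right
    (isClosed_le continuous_const (Complex.continuous_re.abs))
  haveI : CompactSpace X := isCompact_iff_compactSpace.1 Xc
  by_cases hne : X.Nonempty
  swap
  · refine ⟨fun _ => 0, differentiable_const _, fun w _ _ => by simpa using hε.le, fun w h1 h2 => ?_⟩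
    exact (hne ⟨w, by simpa using h1, h2.trans (le_abs_self _)⟩).elim
  haveI : Nonempty X := hne.to_subtype
  set x : C(X, ℂ) := ⟨Subtype.val, continuous_subtype_val⟩ with hx
  set S := Algebra.elemental ℂ x with hS
  haveI hcl : IsClosed (S : Set C(X, ℂ)) := Subalgebra.isClosed_topologicalClosure _
  set y : S := ⟨x, Algebra.elemental.self_mem ℂ x⟩ with hy
  haveI : CompleteSpace S := hcl.completeSpace_coe
  have spec : ∀ t : ℂ, t.re = 0 → t ∉ spectrum ℂ y := by
    intro t ht hmem
    have hb := Subalgebra.spectrum_isBounded_connectedComponentIn S y hmem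
    have hsub : {z : ℂ | z.re = 0} ⊆ connectedComponentIn (spectrum ℂ (y : C(X,ℂ)))ᶜ t := by
      refine IsPreconnected.subset_connectedComponentIn ?_ ht ?_
      · have hc : Convex ℝ {z : ℂ | z.re = 0} := convex_hyperplane (f := Complex.re) ⟨Complex.add_re, fun c x => by simp⟩ 0
        exact hc.isPreconnected
      · intro z hz hzs
        rw [ContinuousMap.spectrum_eq_range] at hzs
        obtain ⟨a, rfl⟩ := hzs
        have h1 : δ ≤ |(a:ℂ).re| := a.2.2
        have h2 : (a:ℂ).re = 0 := hz
        rw [h2, abs_zero] at h1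
        linarith
    obtain ⟨C, hC⟩ := (hb.subset hsub).exists_norm_le
    have := hC (((|C| + 1 : ℝ):ℂ) * Complex.I) (by simp)
    rw [norm_mul, Complex.norm_I, mul_one, Complex.norm_real, Real.norm_eq_abs, abs_of_pos (by positivity)] at this
    linarith [le_abs_self C]
  set e : ℝ := min (ε/4) (1/2) with he
  have e0 : 0 < e := by positivity
  obtain ⟨n, hn⟩ := exists_pow_lt_of_lt_one e0 (y := max (1 - 4 * δ / (1+R)^2) 0) (max_lt (by
    have : 0 < 4 * δ / (1+R)^2 := by positivity
    linarith) one_pos)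
  set Q : Polynomial ℂ := (1 + Polynomial.X)^(2*n) + (1 - Polynomial.X)^(2*n) with hQ
  have hunit : IsUnit (Polynomial.aeval y Q) := by
    rw [← spectrum.zero_notMem_iff ℂ, spectrum.map_polynomial_aeval]
    rintro ⟨t, ht, h0⟩
    refine spec t ?_ ht
    simp only [hQ, Polynomial.eval_add, Polynomial.eval_pow, Polynomial.eval_sub, Polynomial.eval_one, Polynomial.eval_X] at h0
    have h1 : ‖(1+t)^(2*n)‖ = ‖(1-t)^(2*n)‖ := by rw [eq_neg_of_add_eq_zero_left h0, norm_neg]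
    rw [norm_pow, norm_pow] at h1
    by_cases hn0 : n = 0
    · subst hn0; norm_num at h0
    have h2 := (pow_left_inj₀ (norm_nonneg _) (norm_nonneg _) (by omega)).1 h1
    have h3 : ‖1 + t‖^2 = ‖1 - t‖^2 := by rw [h2]
    rw [Complex.sq_norm, Complex.sq_norm, Complex.normSq_apply, Complex.normSq_apply] at h3
    simp at h3
    nlinarith
  obtain ⟨b, hb⟩ := hunit.exists_left_inv
  set g : S := Polynomial.aeval y ((1 + Polynomial.X)^(2*n) : Polynomial ℂ) * b with hg
  have bval : ∀ a : X, (b : C(X,ℂ)) a * ((1 + (a:ℂ))^(2*n) + (1 - (a:ℂ))^(2*n)) = 1 := by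
    intro a
    have h1 := congrArg (fun s : S => (s : C(X,ℂ)) a) hb
    simpa [hQ, hy, hx] using h1
  have gval : ∀ a : X, (g : C(X,ℂ)) a = (1 + (a:ℂ))^(2*n) * (b : C(X,ℂ)) a := by
    intro a
    simp [hg, hy, hx]
  have hgcl : (g : C(X,ℂ)) ∈ closure ((Algebra.adjoin ℂ {x} : Subalgebra ℂ C(X,ℂ)) : Set C(X,ℂ)) := g.2
  obtain ⟨f, hf, hfg⟩ := Metric.mem_closure_iff.1 hgcl (ε/2) (half_pos hε)
  rw [Algebra.adjoin_singleton_eq_range_aeval] at hf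
  obtain ⟨p, rfl⟩ := hf
  have hp : ∀ a : X, ‖p.eval (a:ℂ) - (g : C(X,ℂ)) a‖ ≤ ε / 2 := by
    intro a
    have h1 := (ContinuousMap.dist_apply_le_dist (f := (g : C(X,ℂ))) (g := (Polynomial.aeval x) p) a).trans hfg.le
    rw [dist_comm, dist_eq_norm] at h1
    have h2 : (Polynomial.aeval x p) a = p.eval (a:ℂ) := Polynomial.aeval_continuousMap_apply p x a
    rw [← h2]; exact h1
  refine ⟨fun w => p.eval w, p.differentiable, fun w hw hre => ?_, fun w hw hre => ?_⟩
  · have hwX : w ∈ X := ⟨by simpa using hw, by rw [mem_setOf_eq, abs_of_nonpos (by linarith)]; linarith⟩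
    have h1 := hp ⟨w, hwX⟩
    have h2 := pow_small hδ hR hn.le (w := -w) (by simpa using hw) (by simp; linarith)
    rw [sub_neg_eq_add, ← sub_eq_add_neg] at h2
    have h3 := quot_small (by rw [add_comm]; exact bval ⟨w, hwX⟩) e0.le (min_le_right _ _) h2
    rw [← gval ⟨w, hwX⟩] at h3
    simp only at h1
    have h4 := norm_sub_norm_le (p.eval w) ((g : C(X,ℂ)) ⟨w, hwX⟩)
    linarith [min_le_left (ε/4) (1/2)]
  · have hwX : w ∈ X := ⟨by simpa using hw, hre.trans (le_abs_self _)⟩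
    have h1 := hp ⟨w, hwX⟩
    have h2 := pow_small hδ hR hn.le (w := w) hw hre
    have h3 := quot_small (bval ⟨w, hwX⟩) e0.le (min_le_right _ _) h2
    have h5 : (1 - w)^(2*n) * (b : C(X,ℂ)) ⟨w, hwX⟩ = 1 - (g : C(X,ℂ)) ⟨w, hwX⟩ := by
      rw [gval ⟨w, hwX⟩]
      have := bval ⟨w, hwX⟩
      simp only at this ⊢
      linear_combination this
    rw [h5] at h3
    simp only at h1
    have h4 : p.eval w - 1 = (p.eval w - (g : C(X,ℂ)) ⟨w, hwX⟩) - (1 - (g : C(X,ℂ)) ⟨w, hwX⟩) := by ring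
    simp only [h4]
    refine (norm_sub_le _ _).trans ?_
    linarith [min_le_left (ε/4) (1/2)]

lemma runge_step {δ R ε : ℝ} (hδ : 0 < δ) (hR : 0 ≤ R) (hε : 0 < ε) : ∃ q : ℂ → ℂ, Differentiable ℂ q ∧
    (∀ w : ℂ, ‖w‖ ≤ R → w.re ≤ -(2*δ) → ‖q w‖ ≤ ε) ∧ (∀ w : ℂ, ‖w‖ ≤ R → -δ ≤ w.re → ‖q w - 1‖ ≤ ε) := by
  obtain ⟨q, hq, h1, h2⟩ := runge_sym (δ := δ/2) (R := R + 3/2*δ) (by linarith) (by positivity) hε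
  have hn : ∀ w : ℂ, ‖w‖ ≤ R → ‖w + ((3/2*δ : ℝ):ℂ)‖ ≤ R + 3/2*δ := by
    intro w hw
    refine (norm_add_le _ _).trans ?_
    rw [Complex.norm_real, Real.norm_eq_abs, abs_of_pos (by positivity)]
    linarith
  refine ⟨fun w => q (w + ((3/2*δ : ℝ):ℂ)), hq.comp (differentiable_id.add_const _), fun w hw hre => ?_, fun w hw hre => ?_⟩
  · exact h1 _ (hn w hw) (by rw [Complex.add_re, Complex.ofReal_re]; linarith)
  · exact h2 _ (hn w hw) (by rw [Complex.add_re, Complex.ofReal_re]; linarith)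

end WB

open Set Filter Topology Metric MeasureTheory
open scoped ENNReal NNReal InnerProductSpace ComplexConjugate

namespace WB
variable {N : ℕ}

noncomputable def cpl {F : Type*} [AddCommGroup F] [Module ℂ F] (f : EN N → F)
    (ha : ∀ v w, f (v + w) = f v + f w) (hs : ∀ (a : ℝ) v, f (a • v) = (a : ℂ) • f v) : EN N →ₗ[ℂ] F where
  toFun v := f v - Complex.I • f (Complex.I • v)
  map_add' v w := by
    simp only [smul_add, ha]; abel
  map_smul' c v := by
    have e1 : c • v = (c.re : ℝ) • v + (c.im : ℝ) • (Complex.I • v) := by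
      ext j
      simp only [PiLp.smul_apply, PiLp.add_apply, smul_eq_mul, Complex.real_smul]
      conv_lhs => rw [← Complex.re_add_im c]
      ring
    have e2 : Complex.I • c • v = (c.re : ℝ) • (Complex.I • v) + (-c.im : ℝ) • v := by
      ext j
      simp only [PiLp.smul_apply, PiLp.add_apply, smul_eq_mul, Complex.real_smul]
      conv_lhs => rw [← Complex.re_add_im c]
      push_cast
      linear_combination (c.im : ℂ) * (v j) * Complex.I_mul_I
    rw [e2, e1, ha, hs, hs, ha, hs, hs]
    simp only [RingHom.id_apply]
    nth_rewrite 5 [← Complex.re_add_im c]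
    push_cast
    simp only [smul_add, smul_sub, smul_smul, add_smul, mul_add, neg_smul, smul_neg, mul_neg, add_mul]
    have : (c.im : ℂ) * Complex.I * Complex.I = - c.im := by
      linear_combination (c.im : ℂ) * Complex.I_mul_I
    rw [this, mul_comm Complex.I, mul_comm Complex.I]
    module

lemma exists_cpoly (l : EN N →L[ℝ] ℝ) (H : EN N →L[ℝ] EN N →L[ℝ] ℝ) (p : EN N) :
    ∃ P : EN N → ℂ, ContDiff ℂ 2 P ∧ ∀ z, (P z).re = l (z - p) + (H (z - p) (z - p)
      - H (Complex.I • (z - p)) (Complex.I • (z - p))) / 4 := by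
  let G : EN N →ₗ[ℂ] (EN N →L[ℂ] ℂ) := cpl (fun v => (StrongDual.extendRCLike (𝕜 := ℂ) (H v)))
    (fun v w => by ext x; simp [StrongDual.extendRCLike_apply]; ring)
    (fun a v => by ext x; simp [StrongDual.extendRCLike_apply]; ring)
  let L : EN N →L[ℂ] ℂ := StrongDual.extendRCLike l
  refine ⟨fun z => L (z - p) + (LinearMap.toContinuousLinearMap G (z - p)) (z - p) / 4, ?_, fun z => ?_⟩
  · fun_prop
  · simp only [LinearMap.coe_toContinuousLinearMap', G, cpl, L, LinearMap.coe_mk, AddHom.coe_mk,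
      ContinuousLinearMap.sub_apply, ContinuousLinearMap.smul_apply, StrongDual.extendRCLike_apply]
    simp

variable {D : Set (EN N)} {ρ : EN N → ℝ} (E : Exh D ρ)
include E

lemma Exh.quad (c : ℝ) : ∃ κ > 0, ∃ C > 0, ∃ r0 > 0, ∀ p ∈ D, ρ p ≤ c → closedBall p r0 ⊆ D ∧
    ∃ P : EN N → ℂ, ContDiff ℂ 2 P ∧ ∀ z ∈ closedBall p r0,
      κ * ‖z - p‖^2 ≤ ρ z - ρ p - (P z).re ∧ ρ z - ρ p - (P z).re ≤ C * ‖z - p‖^2 := by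
  obtain ⟨m, m0, hm⟩ := E.levi_lower c
  have hK := E.cpt c
  obtain ⟨δ, δ0, hδ⟩ := hK.exists_cthickening_subset_open E.hD (fun z hz => hz.1)
  have uc : UniformContinuousOn (fderiv ℝ (fderiv ℝ ρ)) (cthickening δ {z ∈ D | ρ z ≤ c}) :=
    (hK.cthickening (r := δ)).uniformContinuousOn_of_continuous (E.cont_fderiv2.mono hδ)
  obtain ⟨δ2, δ20, h2⟩ := (Metric.uniformContinuousOn_iff (α := EN N)
    (β := EN N →L[ℝ] EN N →L[ℝ] ℝ) (f := fderiv ℝ (fderiv ℝ ρ))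
    (s := cthickening δ {z ∈ D | ρ z ≤ c})).1 uc (m/2) (by positivity)
  obtain ⟨B, hB⟩ := hK.exists_bound_of_continuousOn (E := EN N →L[ℝ] EN N →L[ℝ] ℝ)
    (f := fderiv ℝ (fderiv ℝ ρ)) (E.cont_fderiv2.mono (fun z hz => hz.1))
  have hr : 0 < min δ δ2 := lt_min δ0 δ20
  refine ⟨m/2, by positivity, |B| + m, by positivity, min δ δ2 / 2, by positivity, fun p hp hpc => ?_⟩
  have hpK : p ∈ {z ∈ D | ρ z ≤ c} := ⟨hp, hpc⟩
  have sub : ball p (min δ δ2) ⊆ cthickening δ {z ∈ D | ρ z ≤ c} := fun z hz =>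
    mem_cthickening_of_dist_le z p δ _ hpK ((mem_ball.1 hz).le.trans (min_le_left _ _))
  have sub2 : closedBall p (min δ δ2 / 2) ⊆ ball p (min δ δ2) := closedBall_subset_ball (by linarith)
  refine ⟨sub2.trans (sub.trans hδ), ?_⟩
  obtain ⟨P, hP, hPr⟩ := exists_cpoly (fderiv ℝ ρ p) (fderiv ℝ (fderiv ℝ ρ) p) p
  refine ⟨P, hP, fun z hz => ?_⟩
  have t := taylor2 (f := ρ) (p := p) hr (ε := m/2) (fun x hx => E.cda (hδ (sub hx))) (fun x hx =>
    le_trans (le_of_eq (dist_eq_norm (E := EN N →L[ℝ] EN N →L[ℝ] ℝ) (fderiv ℝ (fderiv ℝ ρ) x) (fderiv ℝ (fderiv ℝ ρ) p)).symm) (h2 x (sub hx) p (sub (mem_ball_self hr))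
      ((mem_ball.1 hx).trans_le (min_le_right _ _))).le) (sub2 hz)
  rw [abs_le] at t
  have l := hm p hp hpc (z - p)
  have b : ∀ v : EN N, fderiv ℝ (fderiv ℝ ρ) p v v ≤ |B| * ‖v‖^2 := by
    intro v
    have h1 := (le_abs_self _).trans (ContinuousLinearMap.le_opNorm₂ (fderiv ℝ (fderiv ℝ ρ) p) v v)
    have h3 := (hB p hpK).trans (le_abs_self B)
    refine h1.trans ?_
    rw [mul_assoc, ← sq]
    exact mul_le_mul_of_nonneg_right h3 (by positivity)
  have b1 := b (z - p)
  have b2 := b (Complex.I • (z - p))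
  rw [norm_smul, Complex.norm_I, one_mul] at b2
  have hP' := hPr z
  simp only [LeviForm, Hess] at t l
  have := abs_nonneg B
  have := sq_nonneg ‖z - p‖
  constructor <;> nlinarith

end WB

open Set Filter Topology Metric MeasureTheory
open scoped ENNReal NNReal InnerProductSpace ComplexConjugate

namespace WB
variable {N : ℕ}

lemma dzb_hol {f : EN N → ℂ} {z : EN N} (j : Fin N) (hf : DifferentiableAt ℂ f z) : dzb j f z = 0 := by
  have h : fderiv ℝ f z = (fderiv ℂ f z).restrictScalars ℝ := hf.fderiv_restrictScalars ℝ
  simp only [dzb, h, ContinuousLinearMap.coe_restrictScalars', map_smul, smul_eq_mul]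
  linear_combination (1/2 : ℂ) * fderiv ℂ f z (eb j) * Complex.I_mul_I

lemma dzb_sum {ι : Type*} (A : Finset ι) {f : ι → EN N → ℂ} {z : EN N} (j : Fin N)
    (hf : ∀ p ∈ A, DifferentiableAt ℝ (f p) z) :
    dzb j (fun x => ∑ p ∈ A, f p x) z = ∑ p ∈ A, dzb j (f p) z := by
  classical
  induction A using Finset.induction_on with
  | empty => simpa using dzb_hol (f := fun _ : EN N => (0:ℂ)) (z := z) j (differentiableAt_const _)
  | insert a s ha ih =>
    simp only [Finset.sum_insert ha]
    rw [dzb_add j (hf a (Finset.mem_insert_self _ _))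
      (DifferentiableAt.fun_sum fun p hp => hf p (Finset.mem_insert_of_mem hp)),
      ih fun p hp => hf p (Finset.mem_insert_of_mem hp)]

lemma ev_thick {K U : Set (EN N)} (hK : IsCompact K) (hU : IsOpen U) (h : K ⊆ U) :
    ∀ᶠ δ in 𝓝[>] (0:ℝ), ∀ x ∈ K, ball x δ ⊆ U := by
  obtain ⟨δ, δ0, hδ⟩ := hK.exists_thickening_subset_open hU h
  filter_upwards [Ioo_mem_nhdsGT δ0] with d hd x hx
  exact (ball_subset_ball hd.2.le).trans ((ball_subset_thickening hx δ).trans hδ)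

variable {D : Set (EN N)} {ρ : EN N → ℝ} (E : Exh D ρ)
include E

lemma Exh.cont : ContinuousOn ρ D := E.hρ.continuousOn

lemma Exh.isOpen_lt (c : ℝ) : IsOpen {z ∈ D | ρ z < c} := E.cont.isOpen_inter_preimage E.hD isOpen_Iio

set_option maxHeartbeats 1000000 in
lemma Exh.pass {c η κ C r r1 : ℝ} (hη : 0 < η) (hκ : 0 < κ) (hr : 0 < r) (hr1 : r1 ≤ r/4)
    (hC0 : 0 ≤ C) (hC : C * r1^2 < κ * r^2/16) (A : Finset (EN N)) (W : EN N → EN N → ℂ)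
    (hW : ∀ p ∈ A, ContDiff ℂ 2 (W p)) (hball : ∀ p ∈ A, closedBall p r ⊆ D)
    (hdisj : ∀ p ∈ A, ∀ q ∈ A, p ≠ q → 2 * r < dist p q)
    (hq : ∀ p ∈ A, ∀ z ∈ closedBall p r, κ * ‖z - p‖^2 ≤ ρ z - c - (W p z).re ∧
      ρ z - c - (W p z).re ≤ C * ‖z - p‖^2) {ε : ℝ} (hε : 0 < ε) :
    ∃ H : EN N → ℂ, DifferentiableOn ℂ H D ∧ (∀ z ∈ D, ρ z ≤ c - η → ‖H z‖ ≤ ε) ∧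
      ∀ p ∈ A, ∀ z, ‖z - p‖ ≤ r1 → (W p z).re = 0 → ‖H z - 1‖ ≤ ε := by
  have hkr : 0 < κ * r^2 := by positivity
  obtain ⟨δ, hδd⟩ : ∃ δ, δ = min (κ * r^2/16) (η/4) := ⟨_, rfl⟩
  have δ0 : 0 < δ := by rw [hδd]; exact lt_min (by positivity) (by positivity)
  have δ1 : δ ≤ κ * r^2/16 := by rw [hδd]; exact min_le_left _ _
  have δ2 : δ ≤ η/4 := by rw [hδd]; exact min_le_right _ _
  -- cutoffs
  have hcut : ∀ p : EN N, ∃ χ : EN N → ℝ, ContDiff ℝ 2 χ ∧ HasCompactSupport χ ∧ tsupport χ ⊆ ball p r ∧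
      (∀ x, χ x ∈ Icc (0:ℝ) 1) ∧ ∃ U, IsOpen U ∧ closedBall p (r/2) ⊆ U ∧ ∀ x ∈ U, χ x = 1 := fun p =>
    exists_cutoff (isCompact_closedBall p (r/2)) isOpen_ball (closedBall_subset_ball (by linarith))
  choose χ χc χs χt χ01 U hU hUs χ1 using hcut
  have χcx : ∀ p, ContDiff ℝ 2 (fun x => ((χ p x : ℝ) : ℂ)) := fun p =>
    Complex.ofRealCLM.contDiff.comp (χc p)
  have χts : ∀ p, tsupport (fun x => ((χ p x : ℝ) : ℂ)) ⊆ tsupport (χ p) := fun p =>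
    closure_mono (s := Function.support fun x => ((χ p x : ℝ) : ℂ)) (t := Function.support (χ p))
      fun x hx h => hx (by simp [h])
  have χ0 : ∀ p x, x ∉ ball p r → χ p x = 0 := fun p x hx =>
    image_eq_zero_of_notMem_tsupport fun h => hx (χt p h)
  -- constants
  have hR : ∀ᶠ R in atTop, ∀ p ∈ A, ∀ z ∈ closedBall p r, ‖W p z‖ ≤ R := by
    rw [Finset.eventually_all]
    intro p hp
    obtain ⟨B, hB⟩ := (isCompact_closedBall p r).exists_bound_of_continuousOn
      (hW p hp).continuous.continuousOn
    filter_upwards [eventually_ge_atTop B] with R hR z hz using (hB z hz).trans hR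
  obtain ⟨R, hR, hR0⟩ := (hR.and (eventually_ge_atTop 0)).exists
  have hB : ∀ᶠ B in atTop, ∀ p ∈ A, ∀ j ∈ (Finset.univ : Finset (Fin N)), ∀ z, ‖dzb j (fun x => ((χ p x : ℝ) : ℂ)) z‖ ≤ B := by
    rw [Finset.eventually_all]
    intro p hp
    rw [Finset.eventually_all]
    intro j _
    obtain ⟨B, hB⟩ := (isCompact_closedBall p r).exists_bound_of_continuousOn
      (contDiff_dzb (n := 1) (m := 0) ((χcx p).of_le (by norm_num)) (by norm_num) j).continuous.continuousOn
    filter_upwards [eventually_ge_atTop B, eventually_ge_atTop 0] with R hR h0 z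
    by_cases hz : z ∈ closedBall p r
    · exact (hB z hz).trans hR
    · rw [dzb_eq_zero j fun h => hz (ball_subset_closedBall (χt p (χts p h)))]; simpa using h0
  obtain ⟨B, hB, hB0⟩ := (hB.and (eventually_ge_atTop 0)).exists
  -- the thickening
  have hT : ∀ᶠ d in 𝓝[>] (0:ℝ), (∀ x ∈ {z ∈ D | ρ z ≤ c - η}, ball x d ⊆ {z ∈ D | ρ z < c - η/2}) ∧
      ∀ p ∈ A, ∀ x ∈ closedBall p r1 ∩ {z | (W p z).re = 0},
        ball x d ⊆ ball p (r/2) ∩ {z ∈ D | ρ z < c + κ * r^2/16} ∩ {z | -δ < (W p z).re} := by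
    refine (ev_thick (E.cpt _) (E.isOpen_lt _) fun z hz => ⟨hz.1, by linarith [hz.2]⟩).and ?_
    rw [Finset.eventually_all]
    intro p hp
    have cre : Continuous fun z => (W p z).re := Complex.continuous_re.comp (hW p hp).continuous
    refine ev_thick ((isCompact_closedBall p r1).inter_right (isClosed_eq cre continuous_const))
      ((isOpen_ball.inter (E.isOpen_lt _)).inter (_root_.isOpen_lt continuous_const cre)) ?_
    rintro z ⟨hz, hz0⟩
    have hzr : z ∈ closedBall p r := closedBall_subset_closedBall (by linarith) hz
    have h2 := (hq p hp z hzr).2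
    have hz0' : (W p z).re = 0 := hz0
    have h3 : ‖z - p‖ ≤ r1 := by rwa [mem_closedBall, dist_eq_norm] at hz
    have h4 : ‖z - p‖^2 ≤ r1^2 := by gcongr
    refine ⟨⟨closedBall_subset_ball (by linarith) hz, hball p hp hzr, ?_⟩, ?_⟩
    · nlinarith
    · simp only [mem_setOf_eq, hz0']; linarith
  obtain ⟨d, ⟨hT1, hT2⟩, d0⟩ := (hT.and self_mem_nhdsWithin).exists
  obtain ⟨C0, hC0', happ⟩ := E.approx_sup (c := c + κ * r^2/16) (c' := c + κ * r^2/8) (by linarith) d0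
  obtain ⟨M, hM⟩ : ∃ M : ℝ, M = (N+1) * (A.card + 1) * (B + 1) := ⟨_, rfl⟩
  have M0 : 0 < M := by rw [hM]; positivity
  have hM1 : 1 ≤ M := by
    rw [hM]
    have h1 : (1:ℝ) ≤ N + 1 := by linarith [Nat.cast_nonneg (α := ℝ) N]
    have h2 : (1:ℝ) ≤ A.card + 1 := by linarith [Nat.cast_nonneg (α := ℝ) A.card]
    have h3 : 1 ≤ B + 1 := by linarith
    exact one_le_mul_of_one_le_of_one_le (one_le_mul_of_one_le_of_one_le h1 h2) h3
  have hMA : A.card ≤ M := by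
    rw [hM]
    have h2 : (0:ℝ) ≤ A.card := Nat.cast_nonneg _
    have h1 : (0:ℝ) ≤ N := Nat.cast_nonneg _
    have : (A.card + 1 : ℝ) * 1 ≤ (A.card + 1) * ((N+1) * (B+1)) := by
      gcongr; nlinarith
    nlinarith
  obtain ⟨e, he⟩ : ∃ e : ℝ, e = ε / C0 / M := ⟨_, rfl⟩
  have e0 : 0 < e := by rw [he]; positivity
  have heM : M * e = ε / C0 := by rw [he]; field_simp
  obtain ⟨q, qd, q1, q2⟩ := runge_step δ0 hR0 e0
  have qW : ∀ p ∈ A, ContDiff ℝ 2 (fun z => q (W p z)) := fun p hp =>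
    ((qd.contDiff (n := 2)).comp (hW p hp)).restrict_scalars ℝ
  have tC : ∀ p ∈ A, ContDiff ℝ 2 (fun z => ((χ p z : ℝ) : ℂ) * q (W p z)) := fun p hp => (χcx p).mul (qW p hp)
  have tT : ∀ p ∈ A, (fun z => ((χ p z : ℝ) : ℂ) * q (W p z)) ∈ Test D := by
    intro p hp
    have ts : tsupport (fun z => ((χ p z : ℝ) : ℂ) * q (W p z)) ⊆ tsupport (χ p) :=
      closure_mono (s := Function.support (fun z => ((χ p z : ℝ) : ℂ) * q (W p z))) (t := Function.support (χ p))
        fun x hx h => hx (by simp [h])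
    exact ⟨tC p hp, (χs p).of_isClosed_subset (isClosed_tsupport _) ts,
      (ts.trans (χt p)).trans (ball_subset_closedBall.trans (hball p hp))⟩
  have gT : (fun z => ∑ p ∈ A, ((χ p z : ℝ) : ℂ) * q (W p z)) ∈ Test D := by
    have := Submodule.sum_mem (Test D) tT
    convert this using 1
    ext z; simp
  have dg : ∀ z ∈ D, ρ z ≤ c + κ * r^2/8 → ∀ j, ‖dzb j (fun z => ∑ p ∈ A, ((χ p z : ℝ) : ℂ) * q (W p z)) z‖
      ≤ A.card * (B * e) := by
    intro z hz hzc j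
    rw [dzb_sum A j fun p hp => ((tC p hp).differentiable (by norm_num)) z]
    refine (norm_sum_le _ _).trans ?_
    rw [← nsmul_eq_mul]
    refine Finset.sum_le_card_nsmul _ _ _ fun p hp => ?_
    rw [dzb_mul j (((χcx p).differentiable (by norm_num)) z) (((qW p hp).differentiable (by norm_num)) z),
      dzb_hol (f := fun z => q (W p z)) j ((qd.comp ((hW p hp).differentiable (by norm_num))) z), mul_zero, zero_add, norm_mul]
    have hBz := hB p hp j (Finset.mem_univ _) z
    by_cases h0 : dzb j (fun x => ((χ p x : ℝ) : ℂ)) z = 0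
    · rw [h0]; simp; positivity
    · have h1 : z ∈ ball p r := by
        by_contra h
        exact h0 (dzb_eq_zero j fun h' => h (χt p (χts p h')))
      have h2 : z ∉ U p := by
        intro h
        apply h0
        have : (fun x => ((χ p x : ℝ) : ℂ)) =ᶠ[𝓝 z] fun _ => (1:ℂ) := by
          filter_upwards [(hU p).mem_nhds h] with x hx
          simp [χ1 p x hx]
        rw [dzb_congr j this, dzb_hol j (differentiableAt_const _)]
      have h3 : r/2 < ‖z - p‖ := by
        by_contra h
        exact h2 (hUs p (by rw [mem_closedBall, dist_eq_norm]; linarith))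
      have h4 := (hq p hp z (ball_subset_closedBall h1)).1
      have h5 : (r/2)^2 ≤ ‖z - p‖^2 := by gcongr
      have h6 := q1 (W p z) (hR p hp z (ball_subset_closedBall h1)) (by nlinarith)
      gcongr
  obtain ⟨H, Hd, hH⟩ := happ _ gT (ε / C0) (by positivity) (by
    intro z hz hzc
    have : ∀ j ∈ (Finset.univ : Finset (Fin N)), ‖dzb j (fun z => ∑ p ∈ A, ((χ p z : ℝ) : ℂ) * q (W p z)) z‖^2
      ≤ (A.card * (B * e))^2 := fun j _ => by
      gcongr; exact dg z hz hzc j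
    refine (Finset.sum_le_card_nsmul _ _ _ this).trans ?_
    rw [← heM, nsmul_eq_mul, Finset.card_univ, Fintype.card_fin]
    have h2 : (0:ℝ) ≤ A.card := Nat.cast_nonneg _
    have h1 : (0:ℝ) ≤ N := Nat.cast_nonneg _
    have h7 : (N:ℝ) ≤ (N+1)^2 := by nlinarith
    calc (N:ℝ) * (A.card * (B * e))^2 ≤ (N+1)^2 * ((A.card + 1) * ((B+1) * e))^2 := by
          gcongr <;> linarith
      _ = (M * e)^2 := by rw [hM]; ring)
  have eC : C0 * (ε / C0) = ε := by field_simp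
  refine ⟨H, Hd, fun z hz hzc => ?_, fun p hp z hz hz0 => ?_⟩
  · have := hH z 0 fun y hy => ?_
    · rwa [eC, sub_zero] at this
    · obtain ⟨y1, y2⟩ := hT1 z ⟨hz, hzc⟩ hy
      refine ⟨y1, by linarith, ?_⟩
      rw [sub_zero, ← heM]
      refine (norm_sum_le _ _).trans ?_
      refine (Finset.sum_le_card_nsmul _ _ e fun p hp => ?_).trans ?_
      · by_cases hy : y ∈ ball p r
        · rw [norm_mul]
          have h4 := (hq p hp y (ball_subset_closedBall hy)).1
          have h5 : 0 ≤ κ * ‖y - p‖^2 := by positivity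
          have h6 := q1 (W p y) (hR p hp y (ball_subset_closedBall hy)) (by nlinarith)
          have h7 : ‖((χ p y : ℝ) : ℂ)‖ ≤ 1 := by
            rw [Complex.norm_real, Real.norm_eq_abs, abs_of_nonneg (χ01 p y).1]; exact (χ01 p y).2
          calc _ ≤ 1 * e := by gcongr
            _ = e := one_mul e
        · rw [χ0 p y hy]; simpa using e0.le
      · rw [nsmul_eq_mul]; gcongr
  · have := hH z 1 fun y hy => ?_
    · rwa [eC] at this
    · obtain ⟨⟨y1, y2, y3⟩, y4⟩ := hT2 p hp z ⟨by rwa [mem_closedBall, dist_eq_norm], hz0⟩ hy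
      refine ⟨y2, y3, ?_⟩
      have hy4 : -δ ≤ (W p y).re := le_of_lt y4
      have yr : y ∈ closedBall p r := ball_subset_closedBall (ball_subset_ball (by linarith) y1)
      have e1 : ∑ p ∈ A, ((χ p y : ℝ) : ℂ) * q (W p y) = q (W p y) := by
        rw [Finset.sum_eq_single_of_mem p hp fun p' hp' hne => ?_]
        · rw [χ1 p y (hUs p (ball_subset_closedBall y1))]; simp
        · rw [χ0 p' y fun h => ?_]
          · simp
          · have h1 := hdisj p' hp' p hp hne
            have h2 := dist_triangle_right p' p y
            rw [mem_ball, dist_comm] at h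
            rw [mem_ball, dist_comm] at y1
            linarith
      simp only [e1]
      refine (q2 _ (hR p hp y yr) hy4).trans ?_
      rw [← heM]; exact le_mul_of_one_le_left e0.le hM1

end WB

open Set Filter Topology Metric MeasureTheory
open scoped ENNReal NNReal InnerProductSpace ComplexConjugate

namespace WB
variable {N : ℕ}

/-- grid points -/
noncomputable def gpt (h : ℝ) (i : Fin N → ℤ × ℤ) : EN N :=
  WithLp.toLp 2 (fun j => ((h * (i j).1 : ℝ) : ℂ) + ((h * (i j).2 : ℝ) : ℂ) * Complex.I)

lemma gpt_re (h : ℝ) (i : Fin N → ℤ × ℤ) (j : Fin N) : (gpt h i j).re = h * (i j).1 := by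
  simp [gpt]

lemma gpt_im (h : ℝ) (i : Fin N → ℤ × ℤ) (j : Fin N) : (gpt h i j).im = h * (i j).2 := by
  simp [gpt]

lemma gpt_near {h : ℝ} (hh : 0 < h) (z : EN N) : ∃ i, ‖z - gpt h i‖ ≤ (N + 1) * h := by
  refine ⟨fun j => (round ((z j).re / h), round ((z j).im / h)), ?_⟩
  have key : ∀ x : ℝ, |x - h * round (x / h)| ≤ h / 2 := by
    intro x
    have := abs_sub_round (x / h)
    have e : x - h * round (x / h) = h * (x / h - round (x / h)) := by field_simp
    rw [e, abs_mul, abs_of_pos hh]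
    nlinarith
  rw [EuclideanSpace.norm_eq]
  refine Real.sqrt_le_iff.2 ⟨by positivity, ?_⟩
  have hj : ∀ j ∈ (Finset.univ : Finset (Fin N)), ‖(z - gpt h fun j => (round ((z j).re / h), round ((z j).im / h))) j‖^2 ≤ h^2 := by
    intro j _
    have : ‖(z - gpt h fun j => (round ((z j).re / h), round ((z j).im / h))) j‖ ≤ h := by
      refine (Complex.norm_le_abs_re_add_abs_im _).trans ?_
      rw [PiLp.sub_apply, Complex.sub_re, Complex.sub_im, gpt_re, gpt_im]
      linarith [key (z j).re, key (z j).im]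
    gcongr
  refine (Finset.sum_le_card_nsmul _ _ _ hj).trans ?_
  rw [nsmul_eq_mul, Finset.card_univ, Fintype.card_fin, mul_pow]
  have : (0:ℝ) ≤ N := Nat.cast_nonneg _
  gcongr
  nlinarith

lemma le_norm_gpt {h : ℝ} (hh : 0 < h) (i i' : Fin N → ℤ × ℤ) (j : Fin N) :
    h * |((i j).1 - (i' j).1 : ℤ)| ≤ ‖gpt h i - gpt h i'‖ ∧ h * |((i j).2 - (i' j).2 : ℤ)| ≤ ‖gpt h i - gpt h i'‖ := by
  have h1 : ‖(gpt h i - gpt h i') j‖ ≤ ‖gpt h i - gpt h i'‖ := PiLp.norm_apply_le _ j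
  have h2 := (Complex.abs_re_le_norm _).trans h1
  have h3 := (Complex.abs_im_le_norm _).trans h1
  rw [PiLp.sub_apply] at h2 h3
  rw [Complex.sub_re, gpt_re, gpt_re, ← mul_sub, abs_mul, abs_of_pos hh] at h2
  rw [Complex.sub_im, gpt_im, gpt_im, ← mul_sub, abs_mul, abs_of_pos hh] at h3
  constructor
  · push_cast; exact h2
  · push_cast; exact h3

/-- colours -/
def gcol (m : ℕ) (i : Fin N → ℤ × ℤ) : Fin N → ZMod m × ZMod m := fun j => ((i j).1, (i j).2)

lemma int_col {m : ℕ} {a b : ℤ} (h : (a : ZMod m) = b) (hne : a ≠ b) : (m : ℤ) ≤ |a - b| := by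
  rw [ZMod.intCast_eq_intCast_iff_dvd_sub] at h
  have : (m : ℤ) ∣ |a - b| := by rw [dvd_abs, ← neg_sub, dvd_neg]; exact h
  exact Int.le_of_dvd (abs_pos.2 (sub_ne_zero.2 hne)) this

lemma gpt_sep {h : ℝ} (hh : 0 < h) {m : ℕ} {i i' : Fin N → ℤ × ℤ} (hc : gcol m i = gcol m i') (hne : i ≠ i') :
    m * h ≤ ‖gpt h i - gpt h i'‖ := by
  obtain ⟨j, hj⟩ := Function.ne_iff.1 hne
  have hcj := congrFun hc j
  simp only [gcol, Prod.mk.injEq] at hcj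
  obtain ⟨l1, l2⟩ := le_norm_gpt hh i i' j
  by_cases h1 : (i j).1 = (i' j).1
  · have h2 : (i j).2 ≠ (i' j).2 := fun h2 => hj (Prod.ext h1 h2)
    have : (m : ℝ) ≤ (|(i j).2 - (i' j).2| : ℤ) := by exact_mod_cast int_col hcj.2 h2
    refine le_trans ?_ l2
    rw [mul_comm]; exact mul_le_mul_of_nonneg_left this hh.le
  · have : (m : ℝ) ≤ (|(i j).1 - (i' j).1| : ℤ) := by exact_mod_cast int_col hcj.1 h1
    refine le_trans ?_ l1
    rw [mul_comm]; exact mul_le_mul_of_nonneg_left this hh.le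

lemma gpt_fin {h : ℝ} (hh : 0 < h) {S : Set (EN N)} (hS : Bornology.IsBounded S) :
    {i : Fin N → ℤ × ℤ | gpt h i ∈ S}.Finite := by
  obtain ⟨R, hR⟩ := hS.exists_norm_le
  refine (Set.Finite.pi' (t := fun _ : Fin N => Icc (-⌈R/h⌉) ⌈R/h⌉ ×ˢ Icc (-⌈R/h⌉) ⌈R/h⌉)
    (fun _ => (Set.finite_Icc _ _).prod (Set.finite_Icc _ _))).subset fun i hi j => ?_
  have h1 : ‖gpt h i j‖ ≤ R := (PiLp.norm_apply_le _ j).trans (hR _ hi)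
  have h2 := (Complex.abs_re_le_norm _).trans h1
  have h3 := (Complex.abs_im_le_norm _).trans h1
  rw [gpt_re, abs_mul, abs_of_pos hh] at h2
  rw [gpt_im, abs_mul, abs_of_pos hh] at h3
  have key : ∀ k : ℤ, h * |(k:ℝ)| ≤ R → k ∈ Icc (-⌈R/h⌉) ⌈R/h⌉ := by
    intro k hk
    have : |(k:ℝ)| ≤ R / h := by rw [le_div_iff₀ hh]; linarith
    have h4 : ((|k| : ℤ) : ℝ) ≤ ⌈R/h⌉ := by push_cast; exact this.trans (Int.le_ceil _)
    have h5 : |k| ≤ ⌈R/h⌉ := by exact_mod_cast h4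
    exact abs_le.1 h5
  exact ⟨key _ h2, key _ h3⟩

variable {D : Set (EN N)} {ρ : EN N → ℝ} (E : Exh D ρ)
include E

lemma Exh.iter {a η τ : ℝ} (c : ℕ → ℝ) (T : ℕ → Set (EN N)) (n : ℕ)
    (hT : ∀ i < n, T i ⊆ {z ∈ D | ρ z ≤ c i + τ}) (hτ : 0 ≤ τ) (hη : 0 ≤ η)
    (hc : ∀ i j, i < j → c i + τ ≤ c j - η) (ha : ∀ i, a ≤ c i - η)
    (hp : ∀ i < n, ∀ ε > 0, ∃ H : EN N → ℂ, DifferentiableOn ℂ H D ∧ (∀ z ∈ D, ρ z ≤ c i - η → ‖H z‖ ≤ ε) ∧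
      ∀ z ∈ T i, ‖H z - 1‖ ≤ ε) {f : EN N → ℂ} (hf : DifferentiableOn ℂ f D) (v : ℂ) {ε : ℝ} (hε : 0 < ε) :
    ∃ f' : EN N → ℂ, DifferentiableOn ℂ f' D ∧ (∀ z ∈ D, ρ z ≤ a → ‖f' z - f z‖ ≤ ε) ∧
      ∀ i < n, ∀ z ∈ T i, ‖f' z - v‖ ≤ ε := by
  induction n generalizing ε with
  | zero => exact ⟨f, hf, fun z _ _ => by simpa using hε.le, fun i hi => absurd hi (Nat.not_lt_zero i)⟩
  | succ n ih =>
    obtain ⟨g, hg, g1, g2⟩ := ih (fun i hi => hT i (by omega)) (fun i hi => hp i (by omega)) (half_pos hε)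
    obtain ⟨B, hB⟩ := (E.cpt (c n + τ)).exists_bound_of_continuousOn (f := fun z => v - g z)
      ((continuousOn_const.sub hg.continuousOn).mono fun z hz => hz.1)
    obtain ⟨H, hH, H1, H2⟩ := hp n (by omega) (ε / 2 / (|B| + 1)) (by positivity)
    have sm : ∀ z ∈ D, ρ z ≤ c n - η → ‖(g z + H z * (v - g z)) - g z‖ ≤ ε / 2 := by
      intro z hz hzc
      have b := (hB z ⟨hz, by linarith⟩).trans (le_abs_self B)
      rw [add_sub_cancel_left, norm_mul]
      calc _ ≤ ε / 2 / (|B| + 1) * (|B| + 1) := by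
            gcongr
            · exact H1 z hz hzc
            · linarith
        _ = ε / 2 := by field_simp
    refine ⟨fun z => g z + H z * (v - g z), hg.add (hH.mul (hg.const_sub v)), fun z hz hza => ?_, fun i hi z hz => ?_⟩
    · have h1 := sm z hz (hza.trans (ha n))
      have h2 := g1 z hz hza
      have h3 := norm_sub_le_norm_sub_add_norm_sub (g z + H z * (v - g z)) (g z) (f z)
      simp only
      linarith
    · rcases Nat.lt_succ_iff_lt_or_eq.1 hi with h | h
      · have hz' := hT i hi hz
        have h1 := sm z hz'.1 (hz'.2.trans (hc i n h))
        have h2 := g2 i h z hz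
        have h3 := norm_sub_le_norm_sub_add_norm_sub (g z + H z * (v - g z)) (g z) v
        simp only
        linarith
      · subst h
        have b := (hB z (hT i hi hz)).trans (le_abs_self B)
        have e : g z + H z * (v - g z) - v = (H z - 1) * (v - g z) := by ring
        simp only
        rw [e, norm_mul]
        calc _ ≤ ε / 2 / (|B| + 1) * (|B| + 1) := by
              gcongr
              · exact H2 z hz
              · linarith
          _ = ε / 2 := by field_simp
          _ ≤ ε := by linarith

end WB

open Set Filter Topology Metric MeasureTheory
open scoped ENNReal NNReal InnerProductSpace ComplexConjugate

namespace WB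
variable {N : ℕ}

lemma path_cross {γ : ℝ → EN N} {u : ℝ → ℝ} {t0 t1 s M : ℝ} {n : ℕ} {b : ℕ → ℝ} (ht : t0 ≤ t1)
    (hu : ContinuousOn u (Icc t0 t1)) (hs : 0 < s) (hM : 0 ≤ M) (hn : M < n * s) (hb : Monotone b)
    (h0 : u t0 ≤ b 0) (h1 : b n ≤ u t1) (hv : eVariationOn γ (Icc t0 t1) ≤ ENNReal.ofReal M) :
    ∃ k < n, ∃ t t', t0 ≤ t ∧ t ≤ t' ∧ t' ≤ t1 ∧ u t = b k ∧ u t' = b (k+1) ∧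
      ∀ τ ∈ Icc t t', dist (γ τ) (γ t) < s := by
  by_contra hcon
  push Not at hcon
  have key : ∀ k ≤ n, ∃ t ∈ Icc t0 t1, u t = b k ∧ ENNReal.ofReal (k * s) ≤ eVariationOn γ (Icc t0 t) := by
    intro k
    induction k with
    | zero =>
      intro _
      obtain ⟨t, ht, h⟩ := intermediate_value_Icc ht hu ⟨h0, (hb (Nat.zero_le n)).trans h1⟩
      exact ⟨t, ht, h, by simp⟩
    | succ k ih =>
      intro hk
      obtain ⟨t, htm, h, hvar⟩ := ih (by omega)
      obtain ⟨t', ht', h'⟩ := intermediate_value_Icc htm.2 (hu.mono (Icc_subset_Icc_left htm.1))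
        ⟨h.le.trans (hb (Nat.le_succ k)), (hb hk).trans h1⟩
      refine ⟨t', ⟨htm.1.trans ht'.1, ht'.2⟩, h', ?_⟩
      obtain ⟨τ, hτ, hd⟩ := hcon k (by omega) t t' htm.1 ht'.1 ht'.2 h h'
      have eadd := eVariationOn.Icc_add_Icc γ (s := univ) (a := t0) (b := t) (c := t') htm.1 ht'.1 (mem_univ _)
      simp only [univ_inter] at eadd
      rw [← eadd]
      have e1 : ENNReal.ofReal s ≤ eVariationOn γ (Icc t t') := by
        refine le_trans ?_ (eVariationOn.edist_le γ hτ (left_mem_Icc.2 ht'.1))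
        rw [edist_dist]
        exact ENNReal.ofReal_le_ofReal hd
      have e2 : ((k + 1 : ℕ) : ℝ) * s = k * s + s := by push_cast; ring
      rw [e2, ENNReal.ofReal_add (by positivity) hs.le]
      exact add_le_add hvar e1
  obtain ⟨t, htm, -, h⟩ := key n le_rfl
  have := h.trans ((eVariationOn.mono γ (Icc_subset_Icc_right htm.2)).trans hv)
  have h2 : 0 < n * s := by
    rcases Nat.eq_zero_or_pos n with h | h
    · subst h; simp at hn; linarith
    · positivity
  rw [ENNReal.ofReal_le_ofReal_iff'] at this
  rcases this with h | h <;> linarith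

variable {D : Set (EN N)} {ρ : EN N → ℝ} (E : Exh D ρ)
include E

set_option maxHeartbeats 1000000 in
theorem Exh.labyrinth (a : ℝ) {M : ℝ} (hM : 0 ≤ M) : ∃ S : Set (EN N), IsCompact S ∧ S ⊆ {z ∈ D | a < ρ z} ∧
    (∀ (γ : ℝ → EN N) (t0 t1 : ℝ), t0 ≤ t1 → ContinuousOn γ (Icc t0 t1) → MapsTo γ (Icc t0 t1) D →
      ρ (γ t0) ≤ a → a + 1 ≤ ρ (γ t1) → eVariationOn γ (Icc t0 t1) ≤ ENNReal.ofReal M →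
      ∃ t ∈ Icc t0 t1, γ t ∈ S) ∧
    ∀ f : EN N → ℂ, DifferentiableOn ℂ f D → ∀ v : ℂ, ∀ ε > 0, ∃ f' : EN N → ℂ, DifferentiableOn ℂ f' D ∧
      (∀ z ∈ D, ρ z ≤ a → ‖f' z - f z‖ ≤ ε) ∧ ∀ z ∈ S, ‖f' z - v‖ ≤ ε := by
  classical
  obtain ⟨κ, κ0, C, C0, r0, r00, hQ⟩ := E.quad (a + 2)
  have hbl : ∀ p ∈ D, ρ p ≤ a + 2 → closedBall p r0 ⊆ D := fun p hp hc => (hQ p hp hc).1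
  choose! P hPc hP using fun p hp hc => (hQ p hp hc).2
  obtain ⟨K, hK⟩ : ∃ K, K = 4 + 16 * C / κ := ⟨_, rfl⟩
  have hK4 : 4 ≤ K := by rw [hK]; have : 0 < 16 * C / κ := by positivity
                         linarith
  have hKC : 16 * C < κ * K^2 := by
    have h1 : κ * K = 4 * κ + 16 * C := by rw [hK]; field_simp
    nlinarith
  obtain ⟨m, hm⟩ := exists_nat_gt (4 * K * (N + 1))
  have hm0 : NeZero m := ⟨by rintro rfl; have : 0 ≤ 4 * K * (N + 1) := by positivity
                             push_cast at hm; linarith⟩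
  obtain ⟨Kc, hKc⟩ : ∃ Kc, Kc = Fintype.card (Fin N → ZMod m × ZMod m) := ⟨_, rfl⟩
  have e : (Fin N → ZMod m × ZMod m) ≃ Fin Kc := hKc ▸ Fintype.equivFin _
  have Kc0 : 0 < Kc := by rw [hKc]; exact Fintype.card_pos
  obtain ⟨d, hd, d0⟩ := ((ev_thick (E.cpt (a+1)) (E.isOpen_lt (a+2))
    fun z hz => ⟨hz.1, by linarith [hz.2]⟩).and self_mem_nhdsWithin).exists
  have d0 : 0 < d := d0
  have Kcr : (0:ℝ) < Kc := by exact_mod_cast Kc0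
  obtain ⟨s, s0, sd, sr, s1, sM⟩ : ∃ s > 0, s < d ∧ K * (2 * s) ≤ r0 ∧ s ≤ 1 ∧ 8 * C * Kc * (M + 1) * s ≤ 1 := by
    have hK0 : 0 < K := by linarith
    refine ⟨min (min (d/2) (r0/(2*K))) (min 1 (1/(8 * C * Kc * (M+1)))), by positivity, ?_, ?_, ?_, ?_⟩
    · exact ((min_le_left _ _).trans (min_le_left _ _)).trans_lt (by linarith)
    · have : min (min (d/2) (r0/(2*K))) (min 1 (1/(8 * C * Kc * (M+1)))) ≤ r0/(2*K) :=
        (min_le_left _ _).trans (min_le_right _ _)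
      rw [le_div_iff₀ (by positivity)] at this
      linarith
    · exact (min_le_right _ _).trans (min_le_left _ _)
    · have : min (min (d/2) (r0/(2*K))) (min 1 (1/(8 * C * Kc * (M+1)))) ≤ 1/(8 * C * Kc * (M+1)) :=
        (min_le_right _ _).trans (min_le_right _ _)
      rw [le_div_iff₀ (by positivity)] at this
      linarith
  obtain ⟨n, hn1, hn2⟩ : ∃ n : ℕ, M < n * s ∧ n * s ≤ M + 1 := by
    refine ⟨⌊M/s⌋₊ + 1, ?_, ?_⟩
    · have := Nat.lt_floor_add_one (M/s)
      rw [div_lt_iff₀ s0] at this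
      exact_mod_cast this
    · have := Nat.floor_le (show 0 ≤ M/s by positivity)
      rw [le_div_iff₀ s0] at this
      push_cast; linarith
  obtain ⟨Δ, hΔ⟩ : ∃ Δ, Δ = 8 * C * s^2 := ⟨_, rfl⟩
  have Δ0 : 0 < Δ := by rw [hΔ]; positivity
  have hLΔ : n * (Kc * Δ) ≤ 1 := by
    calc n * (Kc * Δ) = (8 * C * Kc * s) * (n * s) := by rw [hΔ]; ring
      _ ≤ (8 * C * Kc * s) * (M + 1) := by gcongr
      _ ≤ 1 := by linarith
  obtain ⟨h, hh⟩ : ∃ h, h = s / (N + 1) := ⟨_, rfl⟩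
  have h0 : 0 < h := by rw [hh]; positivity
  have hhN : (N + 1) * h = s := by rw [hh]; field_simp
  obtain ⟨c, hc⟩ : ∃ c : ℕ → ℝ, ∀ l, c l = a + l * Δ + Δ / 2 := ⟨_, fun _ => rfl⟩
  obtain ⟨col, hcol⟩ : ∃ col : ℕ → (Fin N → ZMod m × ZMod m), ∀ l, col l = e.symm ⟨l % Kc, Nat.mod_lt _ Kc0⟩ :=
    ⟨_, fun _ => rfl⟩
  have hfin : ∀ l, {i : Fin N → ℤ × ℤ | gcol m i = col l ∧ gpt h i ∈ {z ∈ D | ρ z ≤ a + 2}}.Finite := fun l =>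
    (gpt_fin h0 (E.cpt (a+2)).isBounded).subset fun i hi => hi.2
  obtain ⟨A, hA⟩ : ∃ A : ℕ → Finset (EN N), ∀ l p, p ∈ A l ↔ ∃ i : Fin N → ℤ × ℤ,
      (gcol m i = col l ∧ gpt h i ∈ {z ∈ D | ρ z ≤ a + 2}) ∧ gpt h i = p :=
    ⟨fun l => (hfin l).toFinset.image (gpt h), fun l p => by simp⟩
  have hAD : ∀ l, ∀ p ∈ A l, p ∈ D ∧ ρ p ≤ a + 2 := by
    intro l p hp
    obtain ⟨i, ⟨_, hi⟩, rfl⟩ := (hA l p).1 hp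
    exact hi
  obtain ⟨W, hW⟩ : ∃ W : ℕ → EN N → EN N → ℂ, ∀ l p z, W l p z = P p z + ((ρ p - c l : ℝ) : ℂ) := ⟨_, fun _ _ _ => rfl⟩
  have hWre : ∀ l p z, (W l p z).re = (P p z).re + (ρ p - c l) := by intro l p z; rw [hW]; simp
  have hWc : ∀ l, ∀ p ∈ A l, ContDiff ℂ 2 (W l p) := by
    intro l p hp
    have := (hPc p (hAD l p hp).1 (hAD l p hp).2).add (contDiff_const (c := ((ρ p - c l : ℝ) : ℂ)))
    convert this using 1
    ext z; exact hW l p z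
  have hq : ∀ l, ∀ p ∈ A l, ∀ z ∈ closedBall p (K * (2 * s)), κ * ‖z - p‖^2 ≤ ρ z - c l - (W l p z).re ∧
      ρ z - c l - (W l p z).re ≤ C * ‖z - p‖^2 := by
    intro l p hp z hz
    have := hP p (hAD l p hp).1 (hAD l p hp).2 z (closedBall_subset_closedBall sr hz)
    rw [hWre]
    constructor <;> linarith [this.1, this.2]
  have hsub : ∀ p : EN N, closedBall p (2 * s) ⊆ closedBall p (K * (2 * s)) := fun p =>
    closedBall_subset_closedBall (by nlinarith)
  obtain ⟨T, hT⟩ : ∃ T : ℕ → Set (EN N), ∀ l, T l = ⋃ p ∈ A l, closedBall p (2 * s) ∩ {z | (W l p z).re = 0} :=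
    ⟨_, fun _ => rfl⟩
  have hTc : ∀ l, IsCompact (T l) := by
    intro l
    rw [hT]
    refine (A l).isCompact_biUnion fun p hp => ?_
    exact (isCompact_closedBall p _).inter_right
      (isClosed_eq (Complex.continuous_re.comp (hWc l p hp).continuous) continuous_const)
  have hTm : ∀ l z, z ∈ T l ↔ ∃ p ∈ A l, z ∈ closedBall p (2 * s) ∧ (W l p z).re = 0 := by
    intro l z; rw [hT]; simp only [mem_iUnion, mem_inter_iff, mem_setOf_eq, exists_prop]
  have hTs : ∀ l, ∀ z ∈ T l, z ∈ D ∧ c l ≤ ρ z ∧ ρ z ≤ c l + Δ / 2 := by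
    intro l z hz
    obtain ⟨p, hp, hzp, hz0⟩ := (hTm l z).1 hz
    have h1 := hq l p hp z (hsub p hzp)
    rw [hz0] at h1
    have h2 : ‖z - p‖ ≤ 2 * s := by rwa [mem_closedBall, dist_eq_norm] at hzp
    have h3 : ‖z - p‖^2 ≤ (2 * s)^2 := by gcongr
    have h4 : 0 ≤ κ * ‖z - p‖^2 := by positivity
    refine ⟨hbl p (hAD l p hp).1 (hAD l p hp).2 (closedBall_subset_closedBall sr (hsub p hzp)), by linarith [h1.1], ?_⟩
    rw [hΔ]; nlinarith [h1.2]
  refine ⟨⋃ l ∈ Finset.range (n * Kc), T l, (Finset.range (n * Kc)).isCompact_biUnion fun l _ => hTc l, ?_, ?_, ?_⟩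
  · intro z hz
    simp only [mem_iUnion] at hz
    obtain ⟨l, _, hz⟩ := hz
    obtain ⟨z1, z2, _⟩ := hTs l z hz
    refine ⟨z1, ?_⟩
    have : 0 ≤ (l:ℝ) * Δ := by positivity
    rw [hc] at z2
    linarith
  · intro γ t0 t1 ht hγ hγD g0 g1 hv
    have hu : ContinuousOn (fun t => ρ (γ t)) (Icc t0 t1) := E.cont.comp hγ hγD
    obtain ⟨k, hk, t, t', ht0, htt, ht1, ut, ut', hst⟩ := path_cross (u := fun t => ρ (γ t)) (n := n)
      (b := fun k : ℕ => a + k * (Kc * Δ)) ht hu s0 hM hn1 (fun i j hij => by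
        have : (i:ℝ) ≤ j := by exact_mod_cast hij
        simp only; gcongr) (by simpa using g0) (by linarith) hv
    have hsubI : Icc t t' ⊆ Icc t0 t1 := Icc_subset_Icc ht0 ht1
    obtain ⟨i, hi⟩ := gpt_near h0 (γ t)
    rw [hhN] at hi
    have hkn : (k:ℝ) * (Kc * Δ) ≤ 1 := by
      refine le_trans ?_ hLΔ
      have : (k:ℝ) ≤ n := by exact_mod_cast hk.le
      gcongr
    have hpi : gpt h i ∈ {z ∈ D | ρ z < a + 2} := by
      refine hd (γ t) ⟨hγD (hsubI (left_mem_Icc.2 htt)), ?_⟩ ?_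
      · linarith
      · rw [mem_ball, dist_comm, dist_eq_norm]; linarith
    obtain ⟨l, hl⟩ : ∃ l : ℕ, l = k * Kc + (e (gcol m i) : ℕ) := ⟨_, rfl⟩
    have hel : (e (gcol m i) : ℕ) < Kc := (e (gcol m i)).2
    have hcl : col l = gcol m i := by
      rw [hcol, Equiv.symm_apply_eq]
      apply Fin.ext
      simp only [hl]
      rw [mul_comm, Nat.mul_add_mod, Nat.mod_eq_of_lt hel]
    have hlL : l < n * Kc := by
      calc l < k * Kc + Kc := by omega
        _ = (k+1) * Kc := by ring
        _ ≤ n * Kc := Nat.mul_le_mul_right _ hk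
    have hpA : gpt h i ∈ A l := (hA l _).2 ⟨i, ⟨hcl.symm, hpi.1, hpi.2.le⟩, rfl⟩
    have near : ∀ τ ∈ Icc t t', γ τ ∈ closedBall (gpt h i) (2 * s) := by
      intro τ hτ
      have h1 := hst τ hτ
      have h2 := dist_triangle (γ τ) (γ t) (gpt h i)
      rw [dist_eq_norm (γ t)] at h2
      rw [mem_closedBall]; linarith
    have hw : ContinuousOn (fun τ => (W l (gpt h i) (γ τ)).re) (Icc t t') :=
      (Complex.continuous_re.comp (hWc l _ hpA).continuous).comp_continuousOn (hγ.mono hsubI)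
    have hlc : (l : ℝ) = k * Kc + (e (gcol m i) : ℕ) := by rw [hl]; push_cast; rfl
    have q1 := (hq l _ hpA _ (hsub _ (near t (left_mem_Icc.2 htt)))).1
    have q2 := (hq l _ hpA _ (hsub _ (near t' (right_mem_Icc.2 htt)))).2
    have q3 := near t' (right_mem_Icc.2 htt)
    rw [mem_closedBall, dist_eq_norm] at q3
    have q4 : C * ‖γ t' - gpt h i‖^2 ≤ C * (2 * s)^2 := by gcongr
    have q5 : 0 ≤ κ * ‖γ t - gpt h i‖^2 := by positivity
    have hcc := hc l
    rw [hlc] at hcc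
    have el0 : (0:ℝ) ≤ (e (gcol m i) : ℕ) := Nat.cast_nonneg _
    have el1 : ((e (gcol m i) : ℕ) : ℝ) + 1 ≤ Kc := by exact_mod_cast hel
    have el2 := mul_le_mul_of_nonneg_right el1 Δ0.le
    have el3 := mul_nonneg el0 Δ0.le
    push_cast at ut'
    obtain ⟨τ, hτ, hτ0⟩ := intermediate_value_Icc htt hw (show (0:ℝ) ∈ _ from ⟨by linarith, by linarith⟩)
    refine ⟨τ, hsubI hτ, ?_⟩
    simp only [mem_iUnion]
    exact ⟨l, Finset.mem_range.2 hlL, (hTm l _).2 ⟨_, hpA, near τ hτ, hτ0⟩⟩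
  · intro f hf v ε hε
    obtain ⟨f', hf', f1, f2⟩ := E.iter (a := a) (η := Δ/2) (τ := Δ/2) c T (n * Kc) (fun l _ z hz =>
      ⟨(hTs l z hz).1, (hTs l z hz).2.2⟩) (by positivity) (by positivity) (fun i j hij => by
        have : (i:ℝ) + 1 ≤ j := by exact_mod_cast hij
        have := mul_le_mul_of_nonneg_right this Δ0.le
        rw [hc, hc]; linarith) (fun i => by
        have : 0 ≤ (i:ℝ) * Δ := by positivity
        rw [hc]; linarith) (fun l _ ε' hε' => by
        obtain ⟨H, H0, H1, H2⟩ := E.pass (c := c l) (η := Δ/2) (κ := κ) (C := C) (r := K * (2 * s)) (r1 := 2 * s)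
          (by positivity) κ0 (by positivity) (by nlinarith) C0.le (by
            have : 0 < (2 * s)^2 := by positivity
            have := mul_lt_mul_of_pos_right hKC this
            nlinarith) (A l) (W l) (hWc l)
          (fun p hp => (closedBall_subset_closedBall sr).trans (hbl p (hAD l p hp).1 (hAD l p hp).2))
          (fun p hp q hq' hne => by
            obtain ⟨i, ⟨hi, _⟩, rfl⟩ := (hA l p).1 hp
            obtain ⟨i', ⟨hi', _⟩, rfl⟩ := (hA l q).1 hq'
            have := gpt_sep h0 (hi.trans hi'.symm) (fun h => hne (by rw [h]))
            rw [dist_eq_norm]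
            refine lt_of_lt_of_le ?_ this
            have h6 := mul_lt_mul_of_pos_right hm h0
            calc 2 * (K * (2 * s)) = 4 * K * (N + 1) * h := by rw [← hhN]; ring
              _ < m * h := h6) (hq l) hε'
        refine ⟨H, H0, H1, fun z hz => ?_⟩
        obtain ⟨p, hp, hzp, hz0⟩ := (hTm l z).1 hz
        exact H2 p hp z (by rwa [mem_closedBall, dist_eq_norm] at hzp) hz0) hf v hε
    refine ⟨f', hf', f1, fun z hz => ?_⟩
    simp only [mem_iUnion] at hz
    obtain ⟨l, hl, hz⟩ := hz
    exact f2 l (Finset.mem_range.1 hl) z hz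

end WB

open Set Filter Topology Metric MeasureTheory
open scoped ENNReal NNReal InnerProductSpace ComplexConjugate

namespace WB
variable {N : ℕ}

abbrev KK (D : Set (EN N)) : Set (Set (EN N)) := {K : Set (EN N) | K ⊆ D ∧ IsCompact K}

def emb (D : Set (EN N)) (f : Hol D) : UniformOnFun (EN N) ℂ (KK D) := UniformOnFun.ofFun (KK D) f.1

lemma hol_tendsto {D : Set (EN N)} {ι : Type*} {p : Filter ι} {F : ι → Hol D} {f : Hol D} :
    Tendsto F p (𝓝 f) ↔ ∀ K, K ⊆ D → IsCompact K →
      TendstoUniformlyOn (fun i => (F i).1) f.1 p K := by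
  have hi : IsInducing (emb D) := ⟨rfl⟩
  rw [hi.tendsto_nhds_iff, UniformOnFun.tendsto_iff_tendstoUniformlyOn]
  exact ⟨fun h K h1 h2 => h K ⟨h1, h2⟩, fun h K hK => h K hK.1 hK.2⟩

lemma Exh.exhaust {D : Set (EN N)} {ρ : EN N → ℝ} (E : Exh D ρ) {K : Set (EN N)} (hK : K ⊆ D)
    (hc : IsCompact K) : ∃ n : ℕ, K ⊆ {z ∈ D | ρ z ≤ n} := by
  obtain ⟨b, hb⟩ := (hc.image_of_continuousOn (E.cont.mono hK)).bddAbove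
  obtain ⟨n, hn⟩ := exists_nat_ge b
  exact ⟨n, fun z hz => ⟨hK hz, (hb (mem_image_of_mem ρ hz)).trans hn⟩⟩

lemma hol_closed {D : Set (EN N)} (hD : IsOpen D) {f : ℕ → EN N → ℂ} {g : EN N → ℂ}
    (hf : ∀ n, DifferentiableOn ℂ (f n) D)
    (h : ∀ K, K ⊆ D → IsCompact K → TendstoUniformlyOn f g atTop K) : DifferentiableOn ℂ g D := by
  intro z hz
  obtain ⟨r, hr, hb⟩ := Metric.nhds_basis_closedBall.mem_iff.1 (hD.mem_nhds hz)
  have hU := h _ hb (isCompact_closedBall z r)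
  have hs : ball z (2 * (r/2)) ⊆ closedBall z r := by
    rw [show 2 * (r/2) = r by ring]; exact ball_subset_closedBall
  have := hol_lim (f := f) (g := g) (z := z) (r := r/2) (by positivity)
    (fun n => (hf n).mono (hs.trans hb)) ((hU.mono hs).uniformCauchySeqOn)
    (fun x hx => hU.tendsto_at (by
      apply ball_subset_closedBall
      exact ball_subset_ball (by linarith) hx))
  exact ((this z (mem_ball_self (by positivity))).differentiableAt
    (ball_mem_nhds z (by positivity))).differentiableWithinAt

lemma Exh.baire {D : Set (EN N)} {ρ : EN N → ℝ} (E : Exh D ρ) : BaireSpace (Hol D) := by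
  letI u : UniformSpace (Hol D) := UniformSpace.comap (emb D) inferInstance
  have hu : IsUniformInducing (emb D) := ⟨rfl⟩
  have h1 : (uniformity (UniformOnFun (EN N) ℂ (KK D))).IsCountablyGenerated := by
    refine UniformOnFun.isCountablyGenerated_uniformity (KK D)
      (t := fun n : ℕ => {z ∈ D | ρ z ≤ n}) (fun n => ⟨fun z hz => hz.1, E.cpt n⟩) ?_
      (fun K hK => E.exhaust hK.1 hK.2)
    intro m n hmn z hz
    exact ⟨hz.1, hz.2.trans (by exact_mod_cast hmn)⟩
  have h2 : (uniformity (Hol D)).IsCountablyGenerated := by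
    rw [← hu.comap_uniformity]; infer_instance
  have h3 : CompleteSpace (Hol D) := by
    refine UniformSpace.complete_of_cauchySeq_tendsto fun F hF => ?_
    obtain ⟨G, hG⟩ := cauchySeq_tendsto_of_complete (u := emb D ∘ F) (hu.uniformContinuous.comp_cauchySeq hF)
    have hG' := UniformOnFun.tendsto_iff_tendstoUniformlyOn.1 hG
    have hg : DifferentiableOn ℂ (UniformOnFun.toFun (KK D) G) D :=
      hol_closed E.hD (f := fun n => (F n).1) (fun n => (F n).2) (fun K h1 h2 => hG' K ⟨h1, h2⟩)
    refine ⟨⟨_, hg⟩, ?_⟩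
    rw [hu.isInducing.tendsto_nhds_iff]
    exact hG
  have h4 : @BaireSpace (Hol D) u.toTopologicalSpace := inferInstance
  exact h4

lemma V_open {D S : Set (EN N)} (hS : IsCompact S) (hSD : S ⊆ D) (c : ℂ) (ε : ℝ) :
    IsOpen {g : Hol D | ∀ z ∈ S, ‖g.1 z - c‖ < ε} := by
  rw [isOpen_iff_mem_nhds]
  intro g hg
  rcases S.eq_empty_or_nonempty with rfl | hne
  · simp
  have hc : ContinuousOn (fun z => ‖g.1 z - c‖) S :=
    ((g.2.continuousOn.mono hSD).sub continuousOn_const).norm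
  obtain ⟨z0, hz0, hmax⟩ := hS.exists_isMaxOn hne hc
  have h0 := hg z0 hz0
  have ht := hol_tendsto.1 (tendsto_id (x := 𝓝 g)) S hSD hS
  rw [Metric.tendstoUniformlyOn_iff] at ht
  filter_upwards [ht (ε - ‖g.1 z0 - c‖) (by linarith)] with g' hg' z hz
  have h1 := hg' z hz
  have h2 : ‖g.1 z - c‖ ≤ ‖g.1 z0 - c‖ := hmax hz
  rw [dist_comm, dist_eq_norm] at h1
  have h3 : ‖g'.1 z - c‖ ≤ ‖g'.1 z - g.1 z‖ + ‖g.1 z - c‖ := by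
    have := norm_add_le (g'.1 z - g.1 z) (g.1 z - c)
    simpa using this
  simp only [id] at h1
  linarith

lemma Exh.path_far {D : Set (EN N)} {ρ : EN N → ℝ} (E : Exh D ρ) {γ : ℝ → EN N} {ζ : EN N}
    (hm : MapsTo γ (Ico (0:ℝ) 1) D) (hζ : ζ ∈ frontier D) (ht : Tendsto γ (𝓝[<] (1:ℝ)) (𝓝 ζ))
    (a : ℝ) : ∃ t ∈ Ico (0:ℝ) 1, a ≤ ρ (γ t) := by
  by_contra hcon
  push Not at hcon
  have hmem : ζ ∈ {z ∈ D | ρ z ≤ a} := by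
    refine (E.cpt a).isClosed.mem_of_tendsto ht ?_
    filter_upwards [Ico_mem_nhdsLT (show (0:ℝ) < 1 by norm_num)] with t ht
    exact ⟨hm ht, (hcon t ht).le⟩
  rw [E.hD.frontier_eq] at hζ
  exact hζ.2 hmem.1

lemma final (D : Set (EN N)) (hD : Pseudoconvex D) : ResidualIn (WildSet D) := by
  obtain ⟨ρ, E⟩ := exists_exh hD
  haveI := E.baire
  have hlab := fun k : ℕ => E.labyrinth (k:ℝ) (M := (k:ℝ)) (Nat.cast_nonneg k)
  choose S hSc hSD hblock happ using hlab
  have hSD' : ∀ k, S k ⊆ D := fun k z hz => (hSD k hz).1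
  let c : ℕ → ℂ := TopologicalSpace.denseSeq ℂ
  let V : ℕ → ℕ → Set (Hol D) := fun j k => {g | ∀ z ∈ S k, ‖g.1 z - c j‖ < 1 / ((k:ℝ) + 1)}
  let U : ℕ × ℕ → Set (Hol D) := fun p => ⋃ k ∈ Ici p.2, V p.1 k
  have hUo : ∀ p, IsOpen (U p) := fun p =>
    isOpen_biUnion fun k _ => V_open (hSc k) (hSD' k) _ _
  have hUd : ∀ p, Dense (U p) := by
    rintro ⟨j, n⟩ f
    have := fun k : ℕ => happ k f.1 f.2 (c j) (1 / (2 * ((k:ℝ) + 1))) (by positivity)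
    choose F hF1 hF2 hF3 using this
    let G : ℕ → Hol D := fun k => ⟨F k, hF1 k⟩
    have hG : Tendsto G atTop (𝓝 f) := by
      rw [hol_tendsto]
      intro K hK hKc
      obtain ⟨m, hm⟩ := E.exhaust hK hKc
      rw [Metric.tendstoUniformlyOn_iff]
      intro ε hε
      obtain ⟨q, hq⟩ := exists_nat_one_div_lt hε
      filter_upwards [eventually_ge_atTop (max m q)] with k hk z hz
      have h1 := hF2 k z (hK hz) ((hm hz).2.trans
        (by exact_mod_cast (le_max_left m q).trans hk))
      rw [dist_comm, dist_eq_norm]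
      refine lt_of_le_of_lt h1 (lt_of_le_of_lt ?_ hq)
      have : (q:ℝ) ≤ k := by exact_mod_cast (le_max_right m q).trans hk
      apply one_div_le_one_div_of_le (by positivity)
      linarith [(Nat.cast_nonneg k : (0:ℝ) ≤ k)]
    refine mem_closure_of_tendsto hG ?_
    filter_upwards [eventually_ge_atTop n] with k hk
    refine mem_biUnion (show k ∈ Ici n from hk) ?_
    intro z hz
    refine lt_of_le_of_lt (hF3 k z hz) ?_
    apply one_div_lt_one_div_of_lt (by positivity)
    linarith [(Nat.cast_nonneg k : (0:ℝ) ≤ k)]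
  refine ⟨⋂ p, U p, ?_, IsGδ.iInter_of_isOpen hUo, dense_iInter_of_isOpen hUo hUd⟩
  intro f hf γ hγ w
  obtain ⟨hm, hcont, -, hvar, ζ, hζ, hlim⟩ := hγ
  have step : ∀ n : ℕ, ∃ t ∈ Ico (0:ℝ) 1, (n:ℝ) < ρ (γ t) ∧ ‖f.1 (γ t) - w‖ < 2 / ((n:ℝ) + 1) := by
    intro n
    have hn1 : (0:ℝ) < 1 / ((n:ℝ) + 1) := by positivity
    obtain ⟨j, hj⟩ := (TopologicalSpace.denseRange_denseSeq ℂ).exists_dist_lt w hn1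
    obtain ⟨m1, hm1⟩ := exists_nat_ge (eVariationOn γ (Ico (0:ℝ) 1)).toReal
    obtain ⟨m2, hm2⟩ := exists_nat_ge (ρ (γ 0))
    have hfU := mem_iInter.1 hf (j, max n (max m1 m2))
    obtain ⟨k, hk, hfk⟩ := mem_iUnion₂.1 hfU
    have hk : max n (max m1 m2) ≤ k := hk
    have hkn : (n:ℝ) ≤ k := by exact_mod_cast (le_max_left _ _).trans hk
    have hk1 : (m1:ℝ) ≤ k := by
      exact_mod_cast ((le_max_left _ _).trans (le_max_right _ _)).trans hk
    have hk2 : (m2:ℝ) ≤ k := by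
      exact_mod_cast ((le_max_right _ _).trans (le_max_right _ _)).trans hk
    obtain ⟨t1, ht1, hρ1⟩ := E.path_far hm hζ hlim (k + 1)
    have hsub : Icc 0 t1 ⊆ Ico (0:ℝ) 1 := fun x hx => ⟨hx.1, hx.2.trans_lt ht1.2⟩
    obtain ⟨t, ht, htS⟩ := hblock k γ 0 t1 ht1.1 (hcont.mono hsub) (hm.mono_left hsub)
      (hm2.trans hk2) hρ1 (by
        refine (eVariationOn.mono γ hsub).trans ?_
        rw [ENNReal.le_ofReal_iff_toReal_le hvar.ne (Nat.cast_nonneg k)]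
        exact hm1.trans hk1)
    refine ⟨t, hsub ht, hkn.trans_lt (hSD k htS).2, ?_⟩
    have h1 := hfk _ htS
    have h2 : 1 / ((k:ℝ) + 1) ≤ 1 / ((n:ℝ) + 1) :=
      one_div_le_one_div_of_le (by positivity) (by linarith)
    have h3 : ‖c j - w‖ < 1 / ((n:ℝ) + 1) := by
      rw [← dist_eq_norm, dist_comm]; exact hj
    have h4 : ‖f.1 (γ t) - w‖ ≤ ‖f.1 (γ t) - c j‖ + ‖c j - w‖ := by
      simpa using norm_add_le (f.1 (γ t) - c j) (c j - w)
    have h5 : 2 / ((n:ℝ) + 1) = 1 / ((n:ℝ) + 1) + 1 / ((n:ℝ) + 1) := by ring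
    linarith
  choose r hr1 hr2 hr3 using step
  refine ⟨r, hr1, ?_, ?_⟩
  · rw [tendsto_order]
    refine ⟨fun b hb => ?_, fun b hb => Eventually.of_forall fun n => (hr1 n).2.trans hb⟩
    have hsub : Icc 0 b ⊆ Ico (0:ℝ) 1 := fun x hx => ⟨hx.1, hx.2.trans_lt hb⟩
    obtain ⟨m, hm'⟩ := E.exhaust (K := γ '' Icc 0 b) ((hm.mono_left hsub).image_subset)
      (isCompact_Icc.image_of_continuousOn (hcont.mono hsub))
    filter_upwards [eventually_ge_atTop m] with n hn
    by_contra hcon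
    have h1 := (hm' (mem_image_of_mem γ (show r n ∈ Icc 0 b from ⟨(hr1 n).1, not_lt.1 hcon⟩))).2
    have h2 := hr2 n
    have h3 : (m:ℝ) ≤ n := by exact_mod_cast hn
    linarith
  · rw [tendsto_iff_norm_sub_tendsto_zero]
    have h0 : Tendsto (fun n : ℕ => 2 / ((n:ℝ) + 1)) atTop (𝓝 0) := by
      have := (tendsto_one_div_add_atTop_nhds_zero_nat (𝕜 := ℝ)).const_mul 2
      simpa [div_eq_mul_inv] using this
    exact squeeze_zero (fun n => norm_nonneg _) (fun n => (hr3 n).le) h0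

end WB

/-- **Theorem A (residuality).** If `D` is a pseudoconvex domain in `ℂ^N`, then the set of
`f ∈ 𝒪(D)` whose cluster set along every finite length path to `bD` is maximal (every `c ∈ ℂ`
is a limit of `f ∘ γ (r_n)` for some sequence `r_n → 1` in `[0,1)`) is residual in `𝒪(D)`. -/
theorem theoremA_residual {N : ℕ} (D : Set (EN N)) (hD : Pseudoconvex D) :
    ResidualIn (WildSet D) := by
  exact WB.final D hD
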